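/- Let K be any field and suppose m = Σ_{j=1}^{k} m_j with each m_j > 0. If the strictly decreasing integer sequence z = (z_1 > ... > z_m) consists of k disjoint subsequences of consecutive integers of lengths m_1,...,m_k, then there exists a vector bundle E on P^m defined over K with supernatural cohomology, root sequence z, and rank equal to the multinomial coefficient m!/(m_1!···m_k!). -/

import Mathlib

open MvPolynomial Finset Module

noncomputable section

/-- The standard graded polynomial ring `S = K[x_1, …, x_n]`. -/
abbrev PolyS (K : Type) [Field K] (n : ℕ) : Type := MvPolynomial (Fin n) K

/-- The `K`-subspace of homogeneous polynomials of integer degree `z`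
(it is `0` if `z < 0`). -/
def homogZ (K : Type) [Field K] (n : ℕ) (z : ℤ) : Submodule K (PolyS K n) :=
  ⨆ (_ : 0 ≤ z), MvPolynomial.homogeneousSubmodule (Fin n) K z.toNat

/-- The degree-`ℓ` piece of the graded free module `⊕ₚ S(-dg p)`. -/
def freePiece {K : Type} [Field K] {n r : ℕ} (dg : Fin r → ℤ) (ℓ : ℤ) :
    Submodule K (Fin r → PolyS K n) :=
  Submodule.pi Set.univ fun p => homogZ K n (ℓ - dg p)

/-- A (homologically indexed) finite complex of graded free `S`-modules
`F₀ ← F₁ ← ⋯ ← F_len ← 0`, where `Fᵢ = ⊕ₚ S(-deg i p)` and the (degree `0`)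
map `Fᵢ₊₁ → Fᵢ` is given by the matrix `dd i`, whose entries are homogeneous
of the appropriate degrees. -/
structure FreeComplex (K : Type) [Field K] (n : ℕ) where
  len : ℕ
  rk : ℕ → ℕ
  deg : (i : ℕ) → Fin (rk i) → ℤ
  dd : (i : ℕ) → Matrix (Fin (rk i)) (Fin (rk (i+1))) (PolyS K n)
  rk_eq_zero : ∀ i, len < i → rk i = 0
  isHomog : ∀ i p q, dd i p q ∈ homogZ K n (deg (i+1) q - deg i p)
  isComplex : ∀ i, dd i * dd (i+1) = 0

variable {K : Type} [Field K] {n : ℕ}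

/-- `F` is exact in positive homological degrees; that is, it is a graded free
resolution of the finitely generated graded module `M = coker (F₁ → F₀)`. -/
def IsResolution (F : FreeComplex K n) : Prop :=
  ∀ i, LinearMap.ker ((F.dd i).mulVecLin) = LinearMap.range ((F.dd (i+1)).mulVecLin)

/-- The complex is minimal: entries of the differentials lie in the maximal ideal,
i.e. all (constant) entries between generators of equal degrees vanish. -/
def IsMinimal (F : FreeComplex K n) : Prop :=
  ∀ i p q, F.deg (i+1) q = F.deg i p → F.dd i p q = 0

/-- Betti number `β_{i,j}`: the number of generators of `Fᵢ` of degree `j`. -/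
def bettiNum (F : FreeComplex K n) (i : ℕ) (j : ℤ) : ℕ :=
  (Finset.univ.filter fun p => F.deg i p = j).card

/-- The dimension of the degree-`ℓ` piece of the module `M = coker (F₁ → F₀)`
resolved by `F`. -/
def MPieceDim (F : FreeComplex K n) (ℓ : ℤ) : ℕ :=
  finrank K ((freePiece (F.deg 0) ℓ) ⧸
    (Submodule.comap (freePiece (F.deg 0) ℓ).subtype
      ((LinearMap.range ((F.dd 0).mulVecLin)).restrictScalars K)))

/-- The Hilbert polynomial of the twisted free module `S(-a)` in `n` variables:
`binom (t - a + n - 1, n - 1)`. -/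
def genHilb (n : ℕ) (a : ℤ) : Polynomial ℚ :=
  if n = 0 then 0 else
    Polynomial.C (((n - 1).factorial : ℚ))⁻¹ *
      ∏ k ∈ Finset.range (n - 1),
        (Polynomial.X - Polynomial.C (a : ℚ) + Polynomial.C ((k : ℚ) + 1))

/-- The Hilbert polynomial of `M = coker (F₁ → F₀)`, computed from the free
resolution `F` by additivity. -/
def hilbPoly (F : FreeComplex K n) : Polynomial ℚ :=
  ∑ i ∈ Finset.range (F.len + 1),
    Polynomial.C ((-1 : ℚ) ^ i) * ∑ p : Fin (F.rk i), genHilb n (F.deg i p)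

/-- The Krull dimension of a module read off from its Hilbert polynomial:
`0` for the zero polynomial (finite length), `deg + 1` otherwise. -/
def polyDim (P : Polynomial ℚ) : ℕ := if P = 0 then 0 else P.natDegree + 1

/-- `M = coker (F₁ → F₀)` is a Cohen-Macaulay module of codimension `c`:
`F` is a minimal free resolution of length exactly `c` (so `pd M = c`, and by
Auslander–Buchsbaum `depth M = n - c`) and `dim M = n - c`. -/
def IsCMcodim (F : FreeComplex K n) (c : ℕ) : Prop :=
  IsResolution F ∧ IsMinimal F ∧ (∀ i, c < i → F.rk i = 0) ∧ F.rk c ≠ 0 ∧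
    polyDim (hilbPoly F) = n - c

/-- The multiplicity `e(M)` of a module of codimension `c`, computed from the
Betti numbers of a free resolution:
`e(M) = ((-1)^c / c!) ⬝ Σ_{i,j} (-1)^i β_{i,j} j^c`. -/
def multQ (F : FreeComplex K n) (c : ℕ) : ℚ :=
  ((-1 : ℚ) ^ c / c.factorial) *
    ∑ i ∈ Finset.range (F.len + 1),
      (-1 : ℚ) ^ i * ∑ p : Fin (F.rk i), ((F.deg i p : ℚ)) ^ c


/-- A (cohomologically indexed) finite complex of graded free `S`-modules
`0 → E⁰ → E¹ → ⋯ → E^len → 0`, where `Eⁱ = ⊕ₚ S(-deg i p)` and the (degree `0`)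
map `Eⁱ → Eⁱ⁺¹` is given by the matrix `dd i`. -/
structure CoComplex (K : Type) [Field K] (n : ℕ) where
  len : ℕ
  rk : ℕ → ℕ
  deg : (i : ℕ) → Fin (rk i) → ℤ
  dd : (i : ℕ) → Matrix (Fin (rk (i+1))) (Fin (rk i)) (PolyS K n)
  rk_eq_zero : ∀ i, len < i → rk i = 0
  isHomog : ∀ i p q, dd i p q ∈ homogZ K n (deg i q - deg (i+1) p)
  isComplex : ∀ i, dd (i+1) * dd i = 0

/-- The degree-`ℓ` part of the cocycles at cohomological position `i`. -/
def CoComplex.kerPiece (E : CoComplex K n) (i : ℕ) (ℓ : ℤ) :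
    Submodule K (Fin (E.rk i) → PolyS K n) :=
  ((LinearMap.ker ((E.dd i).mulVecLin)).restrictScalars K) ⊓ freePiece (E.deg i) ℓ

/-- The coboundaries at cohomological position `i` (as a `K`-subspace). -/
def CoComplex.imSub (E : CoComplex K n) : (i : ℕ) → Submodule K (Fin (E.rk i) → PolyS K n)
  | 0 => ⊥
  | (j+1) => (LinearMap.range ((E.dd j).mulVecLin)).restrictScalars K

/-- `dim_K (Hⁱ(E))_ℓ`, the dimension of the degree-`ℓ` component of the `i`-th
cohomology module of the complex `E`. -/
def cohomDim (E : CoComplex K n) (i : ℕ) (ℓ : ℤ) : ℕ :=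
  finrank K ((E.kerPiece i ℓ) ⧸
    (Submodule.comap (E.kerPiece i ℓ).subtype (E.imSub i)))

/-- The bilinear pairing `⟨F, E⟩ = Σ_{j ≤ i, k} (-1)^{i-j} β_{i,k}(F) ⬝ dim_K (H^j E)_{-k}`
of a free resolution `F` against a free cocomplex `E`. -/
def pairing (F : FreeComplex K n) (E : CoComplex K n) : ℤ :=
  ∑ i ∈ Finset.range (F.len + 1), ∑ j ∈ Finset.range (i + 1),
    (-1 : ℤ) ^ (i - j) * ∑ p : Fin (F.rk i), (cohomDim E j (-(F.deg i p)) : ℤ)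

/-- The modified pairing `⟨F, E⟩_{c,τ}`: terms with `j ≤ i` are kept when `j < τ`
or `j ≤ i - 2`, and the terms with `j = τ`, `i = τ + ε` (`ε ∈ {0,1}`) are kept
only when the degree `k` of the generator satisfies `k ≤ c + ε`. -/
def pairingMod (F : FreeComplex K n) (E : CoComplex K n) (c : ℤ) (τ : ℕ) : ℤ :=
  (∑ i ∈ Finset.range (F.len + 1), ∑ j ∈ Finset.range (i + 1),
    if j < τ ∨ j + 2 ≤ i then
      (-1 : ℤ) ^ (i - j) * ∑ p : Fin (F.rk i), (cohomDim E j (-(F.deg i p)) : ℤ)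
    else 0) +
  ∑ ε ∈ Finset.range 2,
    (-1 : ℤ) ^ ε * ∑ p ∈ Finset.univ.filter (fun p => F.deg (τ + ε) p ≤ c + ε),
      (cohomDim E τ (-(F.deg (τ + ε) p)) : ℤ)

/-- The dual cocomplex `Hom(F, S)`: `0 → F₀^∨ → F₁^∨ → ⋯`. Its `j`-th cohomology
is `Ext^j_S(M, S)` for the module `M` resolved by `F`. -/
def dualCo (F : FreeComplex K n) : CoComplex K n where
  len := F.len
  rk := F.rk
  deg := fun i p => -F.deg i p
  dd := fun i => (F.dd i).transpose
  rk_eq_zero := F.rk_eq_zero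
  isHomog := by
    intro i p q
    have h := F.isHomog i q p
    rw [neg_sub_neg]
    exact h
  isComplex := by
    intro i
    rw [← Matrix.transpose_mul, F.isComplex i, Matrix.transpose_zero]

/-- `dim_K Ext^j_S(M, S)_e`, where `M = coker (F₁ → F₀)` (zero for `j < 0`). -/
def extDim (F : FreeComplex K n) (j : ℤ) (e : ℤ) : ℕ :=
  if 0 ≤ j then cohomDim (dualCo F) j.toNat e else 0

/-- `h^i(𝓔(d)) = dim_K H^i(ℙ^{n-1}, 𝓔(d))` for the coherent sheaf `𝓔 = M~` on
`ℙ^{n-1}` associated to the module `M = coker (F₁ → F₀)` resolved by `F`,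
expressed via graded local duality:
`h^i(𝓔(d)) = dim Ext^{n-1-i}(M,S)_{-d-n}` for `i ≥ 1`, and
`h^0(𝓔(d)) = dim M_d - dim Ext^{n}(M,S)_{-d-n} + dim Ext^{n-1}(M,S)_{-d-n}`. -/
def sheafH (F : FreeComplex K n) (i : ℕ) (d : ℤ) : ℕ :=
  if i = 0 then
    MPieceDim F d - extDim F (n : ℤ) (-d - n) + extDim F ((n : ℤ) - 1) (-d - n)
  else extDim F ((n : ℤ) - 1 - i) (-d - n)

/-- The ideal generated by the `s × s` minors of a matrix. -/
def minorsIdeal {a b : ℕ} (M : Matrix (Fin a) (Fin b) (PolyS K n)) (s : ℕ) :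
    Ideal (PolyS K n) :=
  Ideal.span (Set.range fun fg : (Fin s ↪ Fin a) × (Fin s ↪ Fin b) =>
    (M.submatrix fg.1 fg.2).det)

/-- The `r`-th Fitting ideal of `M = coker (F₁ → F₀)`: the ideal of
`(rk F₀ - r)`-minors of the presentation matrix. -/
def fittingIdeal (F : FreeComplex K n) (r : ℤ) : Ideal (PolyS K n) :=
  if (F.rk 0 : ℤ) - r ≤ 0 then ⊤ else minorsIdeal (F.dd 0) ((F.rk 0 : ℤ) - r).toNat

/-- The irrelevant maximal ideal `(x_1, …, x_n)` of `S`. -/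
def irrel (K : Type) [Field K] (n : ℕ) : Ideal (PolyS K n) :=
  Ideal.span (Set.range (MvPolynomial.X : Fin n → PolyS K n))

/-- The coherent sheaf `M~` on `ℙ^{n-1}` associated to `M = coker (F₁ → F₀)` is a
locally free sheaf (vector bundle) of rank `r`: the Fitting ideal `Fitt_{r-1}(M)`
is zero and `Fitt_r(M)` contains a power of the irrelevant ideal. -/
def IsVectorBundle (F : FreeComplex K n) (r : ℕ) : Prop :=
  fittingIdeal F ((r : ℤ) - 1) = ⊥ ∧ ∃ N : ℕ, (irrel K n) ^ N ≤ fittingIdeal F r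

/-- The rank of a sheaf of dimension `s`: the normalized leading coefficient of
its Hilbert polynomial, `χ(𝓔(d)) = (rank 𝓔 / s!) d^s + O(d^{s-1})`. -/
def sheafRank (F : FreeComplex K n) (s : ℕ) : ℚ :=
  (s.factorial : ℚ) * (hilbPoly F).coeff s

/-- The sheaf `M~` has natural cohomology: for each `d` at most one `h^i(𝓔(d))`
is nonzero. -/
def HasNaturalCohomology (F : FreeComplex K n) : Prop :=
  ∀ (d : ℤ) (i i' : ℕ), sheafH F i d ≠ 0 → sheafH F i' d ≠ 0 → i = i'

/-- The sheaf `𝓔 = M~` (of dimension `s`) has supernatural cohomology with root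
sequence `z_1 > ⋯ > z_s`: it has natural cohomology and its Hilbert polynomial
`d ↦ χ(𝓔(d))` has the distinct integral roots `z_1 > ⋯ > z_s`. -/
def IsSupernaturalWithRoots (F : FreeComplex K n) {s : ℕ} (z : Fin s → ℤ) : Prop :=
  StrictAnti z ∧ HasNaturalCohomology F ∧
    ∃ a : ℚ, a ≠ 0 ∧
      hilbPoly F = Polynomial.C a * ∏ i : Fin s, (Polynomial.X - Polynomial.C ((z i : ℚ)))

set_option linter.unusedSectionVars false

/-! ## Part 1: a small Koszul complex framework -/

namespace Kz

/-- Data for a Koszul complex. -/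
structure KD (Γ : Type) [AddCommGroup Γ] (τ : Γ) where
  A : Type
  [acg : AddCommGroup A]
  g : ℕ → A →+ A
  X : Γ → AddSubgroup A
  comm : ∀ s t a, g s (g t a) = g t (g s a)
  shift : ∀ s c a, a ∈ X (c - τ) → g s a ∈ X c

attribute [instance] KD.acg

/-- the underlying group of the Koszul complex -/
def KC (A : Type) : ℕ → Type
  | 0 => A
  | N + 1 => KC A N × KC A N

instance kcAcg {A : Type} [AddCommGroup A] : ∀ N, AddCommGroup (KC A N)
  | 0 => inferInstanceAs (AddCommGroup A)
  | N + 1 => letI := kcAcg (A := A) N; inferInstanceAs (AddCommGroup (KC A N × KC A N))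

variable {A B C : Type} [AddCommGroup A] [AddCommGroup B] [AddCommGroup C]

def kmap (φ : A →+ B) : ∀ N, KC A N →+ KC B N
  | 0 => φ
  | N + 1 => AddMonoidHom.prodMap (kmap φ N) (kmap φ N)

def kd (g : ℕ → A →+ A) : ∀ N, KC A N →+ KC A N
  | 0 => (0 : A →+ A)
  | N + 1 => AddMonoidHom.prod ((kd g N).coprod (kmap (g N) N))
      (-((kd g N).comp (AddMonoidHom.snd _ _)))

def inc : ∀ N, A →+ KC A N
  | 0 => AddMonoidHom.id A
  | N + 1 => (AddMonoidHom.inl _ _).comp (inc N)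

def kmk {N : ℕ} (a b : KC A N) : KC A (N+1) := (a, b)
def kz (a : A) : KC A 0 := a
theorem kz_surj (a : KC A 0) : ∃ b, a = kz b := ⟨a, rfl⟩
theorem kmk_surj {N : ℕ} (a : KC A (N+1)) : ∃ b c, a = kmk b c := ⟨a.1, a.2, rfl⟩
theorem kmap_zero' (φ : A →+ B) (a : A) : kmap φ 0 (kz a) = kz (φ a) := rfl
theorem kmap_succ (φ : A →+ B) (N) (a b : KC A N) :
    kmap φ (N+1) (kmk a b) = kmk (kmap φ N a) (kmap φ N b) := rfl
theorem kd_zero' (g : ℕ → A →+ A) (a : KC A 0) : kd g 0 a = 0 := rfl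
theorem kd_succ (g : ℕ → A →+ A) (N) (a b : KC A N) :
    kd g (N+1) (kmk a b) = kmk (kd g N a + kmap (g N) N b) (- kd g N b) := rfl
theorem inc_zero' (a : A) : inc 0 a = kz a := rfl
theorem inc_succ (N) (a : A) : inc (N+1) a = kmk (inc N a) (0 : KC A N) := rfl

theorem mk_eq_zero {N : ℕ} (a b : KC A N) : kmk a b = (0 : KC A (N+1)) ↔
    a = 0 ∧ b = 0 := Prod.ext_iff
theorem kz_eq_zero (a : A) : kz a = (0 : KC A 0) ↔ a = 0 := Iff.rfl
theorem kz_inj (a b : A) : kz a = kz b ↔ a = b := Iff.rfl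
theorem mk_eq_mk {N : ℕ} (a b a' b' : KC A N) : kmk a b = kmk a' b' ↔
    a = a' ∧ b = b' := Prod.ext_iff

theorem kmap_comp (φ : A →+ B) (ψ : B →+ C) : ∀ N (a : KC A N),
    kmap (ψ.comp φ) N a = kmap ψ N (kmap φ N a)
  | 0, a => rfl
  | N + 1, ω => by
    obtain ⟨a, b, rfl⟩ := kmk_surj ω
    simp only [kmap_succ, kmap_comp φ ψ N]

theorem kmap_kmap_comm (φ ψ : A →+ A) (h : ∀ a, φ (ψ a) = ψ (φ a)) (N) (a : KC A N) :
    kmap φ N (kmap ψ N a) = kmap ψ N (kmap φ N a) := by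
  rw [← kmap_comp, ← kmap_comp]
  congr 2
  ext a; exact h a

theorem kmap_kd (φ : A →+ B) (g : ℕ → A →+ A) (g' : ℕ → B →+ B)
    (h : ∀ s a, φ (g s a) = g' s (φ a)) : ∀ N (a : KC A N),
    kmap φ N (kd g N a) = kd g' N (kmap φ N a)
  | 0, a => by rw [kd_zero', kd_zero', map_zero]
  | N + 1, ω => by
    obtain ⟨a, b, rfl⟩ := kmk_surj ω
    have h2 : kmap φ N (kmap (g N) N b) = kmap (g' N) N (kmap φ N b) := by
      rw [← kmap_comp, ← kmap_comp]; congr 2; ext a; exact h N a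
    simp only [kmap_succ, kd_succ, map_add, map_neg, kmap_kd φ g g' h N, h2]

theorem kd_kd (g : ℕ → A →+ A) (h : ∀ s t a, g s (g t a) = g t (g s a)) :
    ∀ N (a : KC A N), kd g N (kd g N a) = 0
  | 0, a => rfl
  | N + 1, ω => by
    obtain ⟨a, b, rfl⟩ := kmk_surj ω
    have h2 := kmap_kd (g N) g g (fun s a => h N s a) N b
    rw [kd_succ, kd_succ, mk_eq_zero]
    simp only [map_add, map_neg, kd_kd g h N, h2]
    simp

theorem kmap_inc (φ : A →+ B) : ∀ N (a : A), kmap φ N (inc N a) = inc N (φ a)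
  | 0, a => rfl
  | N + 1, a => by rw [inc_succ, kmap_succ, kmap_inc φ N, map_zero]; rfl

theorem kd_inc (g : ℕ → A →+ A) : ∀ N (a : A), kd g N (inc N a) = 0
  | 0, a => rfl
  | N + 1, a => by
    rw [inc_succ, kd_succ, kd_inc g N, map_zero, map_zero, mk_eq_zero]; simp

variable {Γ Γ' : Type} [AddCommGroup Γ] [AddCommGroup Γ'] 

def kP (X : Γ → AddSubgroup A) (τ : Γ) : ∀ N, ℤ → Γ → AddSubgroup (KC A N)
  | 0, i, c => if i = 0 then X c else ⊥
  | N + 1, i, c => (kP X τ N i c).prod (kP X τ N (i-1) (c-τ))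

theorem mem_kP_zero (X : Γ → AddSubgroup A) (τ c : Γ) (a : A) :
    kz a ∈ kP X τ 0 0 c ↔ a ∈ X c := by
  change (@Membership.mem A _ _ (if (0:ℤ) = 0 then X c else ⊥) a) ↔ _
  rw [if_pos rfl]

theorem mem_kP_zero' (X : Γ → AddSubgroup A) (τ c : Γ) (i : ℤ) (hi : i ≠ 0) (a : KC A 0) :
    a ∈ kP X τ 0 i c ↔ a = 0 := by
  change (@Membership.mem A _ _ (if i = 0 then X c else ⊥) a) ↔ _
  rw [if_neg hi]; exact AddSubgroup.mem_bot

attribute [irreducible] kz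

theorem mem_kP_succ (X : Γ → AddSubgroup A) (τ c : Γ) (N) (i : ℤ) (a b : KC A N) :
    kmk a b ∈ kP X τ (N+1) i c ↔ a ∈ kP X τ N i c ∧ b ∈ kP X τ N (i-1) (c-τ) :=
  Iff.rfl

theorem kP_neg (X : Γ → AddSubgroup A) (τ : Γ) : ∀ N (i : ℤ) c, i < 0 → ∀ a ∈ kP X τ N i c, a = 0
  | 0, i, c, hi, a, ha => (mem_kP_zero' X τ c i hi.ne a).1 ha
  | N + 1, i, c, hi, ω, ha => by
    obtain ⟨a, b, rfl⟩ := kmk_surj ω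
    rw [mem_kP_succ] at ha
    rw [mk_eq_zero]
    exact ⟨kP_neg X τ N i c hi a ha.1, kP_neg X τ N _ _ (by omega) b ha.2⟩

theorem kP_gt (X : Γ → AddSubgroup A) (τ : Γ) : ∀ (N : ℕ) (i : ℤ) c, (N:ℤ) < i → ∀ a ∈ kP X τ N i c, a = 0
  | 0, i, c, hi, a, ha => (mem_kP_zero' X τ c i (by simpa using hi.ne') a).1 ha
  | N + 1, i, c, hi, ω, ha => by
    obtain ⟨a, b, rfl⟩ := kmk_surj ω
    rw [mem_kP_succ] at ha
    rw [mk_eq_zero]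
    push_cast at hi
    exact ⟨kP_gt X τ N i c (by omega) a ha.1, kP_gt X τ N _ _ (by omega) b ha.2⟩

theorem kP_empty (X : Γ → AddSubgroup A) (τ : Γ) : ∀ N (i : ℤ) c,
    (∀ a ∈ X (c - i • τ), a = 0) → ∀ a ∈ kP X τ N i c, a = 0
  | 0, i, c, h, a, ha => by
    by_cases hi : i = 0
    · subst hi
      obtain ⟨a, rfl⟩ := kz_surj a
      rw [mem_kP_zero] at ha
      rw [kz_eq_zero]; exact h a (by simpa using ha)
    · exact (mem_kP_zero' X τ c i hi a).1 ha
  | N + 1, i, c, h, ω, ha => by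
    obtain ⟨a, b, rfl⟩ := kmk_surj ω
    rw [mem_kP_succ] at ha
    rw [mk_eq_zero]
    refine ⟨kP_empty X τ N i c h a ha.1, kP_empty X τ N _ _ ?_ b ha.2⟩
    have : c - τ - (i - 1) • τ = c - i • τ := by rw [sub_smul, one_smul]; abel
    rwa [this]

theorem kP_reindex (X : Γ' → AddSubgroup A) (τ : Γ) (τ' : Γ') (h : Γ → Γ')
    (hh : ∀ c, h (c - τ) = h c - τ') : ∀ N (i : ℤ) c,
    kP (fun c => X (h c)) τ N i c = kP X τ' N i (h c)
  | 0, i, c => rfl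
  | N + 1, i, c => by
    simp only [kP]
    rw [kP_reindex X τ τ' h hh N, kP_reindex X τ τ' h hh N, hh]

theorem kmap_mem (φ : A →+ B) (X : Γ → AddSubgroup A) (Y : Γ' → AddSubgroup B) (τ : Γ) (τ' : Γ')
    (h : Γ → Γ') (hh : ∀ c, h (c - τ) = h c - τ')
    (hφ : ∀ c a, a ∈ X c → φ a ∈ Y (h c)) :
    ∀ N (i : ℤ) c (a : KC A N), a ∈ kP X τ N i c → kmap φ N a ∈ kP Y τ' N i (h c)
  | 0, i, c, a, ha => by
    by_cases hi : i = 0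
    · subst hi
      obtain ⟨a, rfl⟩ := kz_surj a
      rw [mem_kP_zero] at ha
      rw [kmap_zero']; exact (mem_kP_zero _ _ _ _).2 (hφ c a ha)
    · rw [mem_kP_zero' _ _ _ _ hi] at ha
      rw [ha, map_zero]; exact zero_mem _
  | N + 1, i, c, ω, ha => by
    obtain ⟨a, b, rfl⟩ := kmk_surj ω
    rw [mem_kP_succ] at ha
    rw [kmap_succ, mem_kP_succ, ← hh]
    exact ⟨kmap_mem φ X Y τ τ' h hh hφ N _ _ _ ha.1, kmap_mem φ X Y τ τ' h hh hφ N _ _ _ ha.2⟩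

theorem kmap_inj (φ : A →+ B) (X : Γ → AddSubgroup A) (τ : Γ)
    (hφ : ∀ c a, a ∈ X c → φ a = 0 → a = 0) :
    ∀ N (i : ℤ) c (a : KC A N), a ∈ kP X τ N i c → kmap φ N a = 0 → a = 0
  | 0, i, c, a, ha, h0 => by
    by_cases hi : i = 0
    · subst hi
      obtain ⟨a, rfl⟩ := kz_surj a
      rw [mem_kP_zero] at ha
      rw [kmap_zero', kz_eq_zero] at h0
      rw [kz_eq_zero]
      exact hφ c a ha h0
    · rwa [mem_kP_zero' _ _ _ _ hi] at ha
  | N + 1, i, c, ω, ha, h0 => by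
    obtain ⟨a, b, rfl⟩ := kmk_surj ω
    rw [mem_kP_succ] at ha
    rw [kmap_succ, mk_eq_zero] at h0
    rw [mk_eq_zero]
    exact ⟨kmap_inj φ X τ hφ N _ _ _ ha.1 h0.1, kmap_inj φ X τ hφ N _ _ _ ha.2 h0.2⟩

theorem kmap_surj (φ : A →+ B) (X : Γ → AddSubgroup A) (Y : Γ → AddSubgroup B) (τ : Γ)
    (hφ : ∀ c b, b ∈ Y c → ∃ a ∈ X c, φ a = b) :
    ∀ N (i : ℤ) c (b : KC B N), b ∈ kP Y τ N i c → ∃ a ∈ kP X τ N i c, kmap φ N a = b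
  | 0, i, c, a, ha => by
    by_cases hi : i = 0
    · subst hi
      obtain ⟨a, rfl⟩ := kz_surj a
      rw [mem_kP_zero] at ha
      obtain ⟨b, hb, h⟩ := hφ c a ha
      exact ⟨kz b, (mem_kP_zero _ _ _ _).2 hb, by rw [kmap_zero', h]⟩
    · rw [mem_kP_zero' _ _ _ _ hi] at ha
      exact ⟨0, zero_mem _, by rw [ha, map_zero]⟩
  | N + 1, i, c, ω, ha => by
    obtain ⟨a, b, rfl⟩ := kmk_surj ω
    rw [mem_kP_succ] at ha
    obtain ⟨a', h1, h2⟩ := kmap_surj φ X Y τ hφ N _ _ _ ha.1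
    obtain ⟨b', h3, h4⟩ := kmap_surj φ X Y τ hφ N _ _ _ ha.2
    exact ⟨kmk a' b', (mem_kP_succ _ _ _ _ _ _ _).2 ⟨h1, h3⟩, by rw [kmap_succ, h2, h4]⟩

theorem kmap_exact (ψ : A →+ B) (φ : B →+ C) (W : Γ → AddSubgroup A) (X : Γ → AddSubgroup B) (τ : Γ)
    (hφ : ∀ c b, b ∈ X c → φ b = 0 → ∃ a ∈ W c, ψ a = b) :
    ∀ N (i : ℤ) c (b : KC B N), b ∈ kP X τ N i c → kmap φ N b = 0 →
      ∃ a ∈ kP W τ N i c, kmap ψ N a = b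
  | 0, i, c, a, ha, h0 => by
    by_cases hi : i = 0
    · subst hi
      obtain ⟨a, rfl⟩ := kz_surj a
      rw [mem_kP_zero] at ha
      rw [kmap_zero', kz_eq_zero] at h0
      obtain ⟨b, hb, h⟩ := hφ c a ha h0
      exact ⟨kz b, (mem_kP_zero _ _ _ _).2 hb, by rw [kmap_zero', h]⟩
    · rw [mem_kP_zero' _ _ _ _ hi] at ha
      exact ⟨0, zero_mem _, by rw [ha, map_zero]⟩
  | N + 1, i, c, ω, ha, h0 => by
    obtain ⟨a, b, rfl⟩ := kmk_surj ω
    rw [mem_kP_succ] at ha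
    rw [kmap_succ, mk_eq_zero] at h0
    obtain ⟨a', h1, h2⟩ := kmap_exact ψ φ W X τ hφ N _ _ _ ha.1 h0.1
    obtain ⟨b', h3, h4⟩ := kmap_exact ψ φ W X τ hφ N _ _ _ ha.2 h0.2
    exact ⟨kmk a' b', (mem_kP_succ _ _ _ _ _ _ _).2 ⟨h1, h3⟩, by rw [kmap_succ, h2, h4]⟩

theorem inc_mem (X : Γ → AddSubgroup A) (τ : Γ) : ∀ N c (a : A), inc N a ∈ kP X τ N 0 c ↔ a ∈ X c
  | 0, c, a => by rw [inc_zero', mem_kP_zero]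
  | N + 1, c, a => by
    rw [inc_succ, mem_kP_succ, inc_mem X τ N]
    exact ⟨fun h => h.1, fun h => ⟨h, zero_mem _⟩⟩

theorem eq_inc (X : Γ → AddSubgroup A) (τ : Γ) : ∀ N c (a : KC A N), a ∈ kP X τ N 0 c →
    ∃ q ∈ X c, inc N q = a
  | 0, c, a, h => by
    obtain ⟨a, rfl⟩ := kz_surj a
    exact ⟨a, (mem_kP_zero _ _ _ _).1 h, inc_zero' a⟩
  | N + 1, c, ω, h => by
    obtain ⟨a, b, rfl⟩ := kmk_surj ω
    rw [mem_kP_succ] at h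
    obtain ⟨q, hq, rfl⟩ := eq_inc X τ N c a h.1
    have := kP_neg X τ N _ _ (by norm_num) b h.2
    exact ⟨q, hq, by rw [this]; rfl⟩

theorem inc_injective : ∀ N, Function.Injective (inc (A := A) N)
  | 0 => fun _ _ h => h
  | N + 1 => fun a b h => by
    rw [inc_succ, inc_succ, mk_eq_mk] at h
    exact inc_injective N h.1

variable {τ : Γ}

namespace KD

variable (D E G : KD Γ τ)

abbrev P (N : ℕ) (i : ℤ) (c : Γ) : AddSubgroup (KC D.A N) := kP D.X τ N i c
abbrev d (N : ℕ) : KC D.A N →+ KC D.A N := kd D.g N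

theorem d_d (N) (a) : D.d N (D.d N a) = 0 := kd_kd D.g D.comm N a

theorem d_mem : ∀ N (i : ℤ) c (a : KC D.A N), a ∈ D.P N i c → D.d N a ∈ D.P N (i-1) c
  | 0, i, c, a, ha => by rw [d, kd_zero']; exact zero_mem _
  | N + 1, i, c, ω, ha => by
    obtain ⟨a, b, rfl⟩ := kmk_surj ω
    rw [P, mem_kP_succ] at ha
    rw [P, d, kd_succ, mem_kP_succ]
    refine ⟨add_mem (d_mem N i c a ha.1) ?_, neg_mem (d_mem N _ _ b ha.2)⟩
    have := kmap_mem (D.g N) D.X D.X τ τ (fun c => c + τ) (fun c => by abel)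
      (fun c a ha => D.shift N _ a (by simpa using ha)) N (i-1) (c-τ) b ha.2
    simpa using this

/-- vanishing of Koszul homology -/
def V (N : ℕ) (i : ℤ) (c : Γ) : Prop :=
  ∀ a ∈ D.P N i c, D.d N a = 0 → ∃ b ∈ D.P N (i+1) c, D.d N b = a

theorem V_of_zero {N i c} (h : ∀ a ∈ D.P N i c, a = 0) : D.V N i c := fun a ha _ =>
  ⟨0, zero_mem _, by rw [map_zero, h a ha]⟩

theorem V_neg {N i c} (h : i < 0) : D.V N i c := D.V_of_zero (kP_neg _ _ _ _ _ h)
theorem V_gt {N : ℕ} {i c} (h : (N:ℤ) < i) : D.V N i c := D.V_of_zero (kP_gt _ _ _ _ _ h)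
theorem V_empty {N : ℕ} {i : ℤ} {c} (h : ∀ a ∈ D.X (c - i • τ), a = 0) : D.V N i c :=
  D.V_of_zero (kP_empty _ _ _ _ _ h)

/-- shift the grading -/
abbrev sh (e : Γ) : KD Γ τ where
  A := D.A
  g := D.g
  X := fun c => D.X (c - e)
  comm := D.comm
  shift := fun s c a ha => D.shift s _ a (by convert ha using 2; abel)

theorem sh_P (e : Γ) (N i c) : (D.sh e).P N i c = D.P N i (c - e) :=
  kP_reindex D.X τ τ (fun c => c - e) (fun c => by abel) N i c

theorem sh_V (e : Γ) (N i c) : (D.sh e).V N i c ↔ D.V N i (c - e) := by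
  have h1 := D.sh_P e N i c
  have h2 := D.sh_P e N (i+1) c
  unfold V
  rw [h1, h2]

variable {D E G}

/-- morphisms -/
structure Hom (D E : KD Γ τ) (φ : D.A →+ E.A) : Prop where
  comm : ∀ s a, φ (D.g s a) = E.g s (φ a)
  mem : ∀ c a, a ∈ D.X c → φ a ∈ E.X c

theorem Hom.d {φ : D.A →+ E.A} (h : Hom D E φ) (N) (a : KC D.A N) :
    kmap φ N (D.d N a) = E.d N (kmap φ N a) := kmap_kd φ _ _ h.comm N a

theorem Hom.P {φ : D.A →+ E.A} (h : Hom D E φ) {N i c} {a : KC D.A N} (ha : a ∈ D.P N i c) :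
    kmap φ N a ∈ E.P N i c :=
  kmap_mem φ D.X E.X τ τ id (fun _ => rfl) h.mem N i c a ha

def Inj (D E : KD Γ τ) (φ : D.A →+ E.A) (N : ℕ) (i : ℤ) (c : Γ) : Prop :=
  ∀ a ∈ D.P N i c, D.d N a = 0 → (∃ b ∈ E.P N (i+1) c, E.d N b = kmap φ N a) →
    ∃ b ∈ D.P N (i+1) c, D.d N b = a

def Surj (D E : KD Γ τ) (φ : D.A →+ E.A) (N : ℕ) (i : ℤ) (c : Γ) : Prop :=
  ∀ a ∈ E.P N i c, E.d N a = 0 → ∃ a' ∈ D.P N i c, D.d N a' = 0 ∧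
    ∃ b ∈ E.P N (i+1) c, a = kmap φ N a' + E.d N b

/-- short exact sequences -/
structure SES (D E G : KD Γ τ) (ψ : D.A →+ E.A) (φ : E.A →+ G.A) : Prop where
  h1 : Hom D E ψ
  h2 : Hom E G φ
  inj : ∀ c a, a ∈ D.X c → ψ a = 0 → a = 0
  zero : ∀ c a, a ∈ D.X c → φ (ψ a) = 0
  exact : ∀ c b, b ∈ E.X c → φ b = 0 → ∃ a ∈ D.X c, ψ a = b
  surj : ∀ c b, b ∈ G.X c → ∃ a ∈ E.X c, φ a = b

section ses
variable {ψ : D.A →+ E.A} {φ : E.A →+ G.A} {N : ℕ} {i : ℤ} {c : Γ}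

theorem SES.kzero (h : SES D E G ψ φ) (a : KC D.A N) (ha : a ∈ D.P N i c) : kmap φ N (kmap ψ N a) = 0 := by
  induction N generalizing i c with
  | zero =>
    by_cases hi : i = 0
    · subst hi
      obtain ⟨q, rfl⟩ := kz_surj a
      rw [KD.P, mem_kP_zero] at ha
      rw [kmap_zero', kmap_zero', h.zero _ q ha, kz_eq_zero]
    · rw [KD.P, mem_kP_zero' _ _ _ _ hi] at ha
      rw [ha, map_zero, map_zero]
  | succ N ih =>
    obtain ⟨a, b, rfl⟩ := kmk_surj a
    rw [KD.P, mem_kP_succ] at ha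
    rw [kmap_succ, kmap_succ, ih a ha.1, ih b ha.2]; rfl

theorem SES.Inj_of (h : SES D E G ψ φ) (hV : G.V N (i+1) c) : Inj D E ψ N i c := by
  rintro ω hω hdω ⟨η, hη, hdη⟩
  obtain ⟨ζ, hζ, hdζ⟩ := hV (kmap φ N η) (h.h2.P hη) (by rw [← h.h2.d, hdη, h.kzero _ hω])
  obtain ⟨ξ, hξ, rfl⟩ := kmap_surj φ E.X G.X τ h.surj N _ _ _ hζ
  have hm : η - E.d N ξ ∈ E.P N (i+1) c := by
    refine sub_mem hη ?_
    have := E.d_mem N _ _ _ hξ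
    simpa using this
  obtain ⟨θ, hθ, hθ2⟩ := kmap_exact ψ φ D.X E.X τ h.exact N _ _ _ hm (by
    rw [map_sub, h.h2.d, hdζ, sub_self])
  refine ⟨θ, hθ, ?_⟩
  rw [← sub_eq_zero]
  refine kmap_inj ψ D.X τ h.inj N i c _ (sub_mem ?_ hω) ?_
  · simpa using D.d_mem N _ _ _ hθ
  · rw [map_sub, h.h1.d, hθ2, map_sub, E.d_d, hdη]; simp

theorem SES.Surj_of (h : SES D E G ψ φ) (hV : G.V N i c) : Surj D E ψ N i c := by
  rintro ω hω hdω
  obtain ⟨ζ, hζ, hdζ⟩ := hV (kmap φ N ω) (h.h2.P hω) (by rw [← h.h2.d, hdω, map_zero])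
  obtain ⟨ξ, hξ, rfl⟩ := kmap_surj φ E.X G.X τ h.surj N _ _ _ hζ
  have hm : ω - E.d N ξ ∈ E.P N i c := by
    refine sub_mem hω ?_
    have := E.d_mem N _ _ _ hξ
    simpa using this
  obtain ⟨θ, hθ, hθ2⟩ := kmap_exact ψ φ D.X E.X τ h.exact N _ _ _ hm (by
    rw [map_sub, h.h2.d, hdζ, sub_self])
  refine ⟨θ, hθ, ?_, ξ, hξ, by rw [hθ2]; abel⟩
  refine kmap_inj ψ D.X τ h.inj N (i-1) c _ (D.d_mem N _ _ _ hθ) ?_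
  rw [h.h1.d, hθ2, map_sub, E.d_d, hdω]; simp

theorem SES.V_quot (h : SES D E G ψ φ) (hE : E.V N i c) (hD : D.V N (i-1) c) : G.V N i c := by
  rintro ω hω hdω
  obtain ⟨ξ, hξ, rfl⟩ := kmap_surj φ E.X G.X τ h.surj N _ _ _ hω
  obtain ⟨θ, hθ, hθ2⟩ := kmap_exact ψ φ D.X E.X τ h.exact N _ _ _ (E.d_mem N _ _ _ hξ) (by
    rw [h.h2.d, hdω])
  have hθ0 : D.d N θ = 0 := by
    refine kmap_inj ψ D.X τ h.inj N _ c _ (D.d_mem N _ _ _ hθ) ?_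
    rw [h.h1.d, hθ2, E.d_d]
  obtain ⟨κ, hκ, hdκ⟩ := hD θ hθ hθ0
  rw [sub_add_cancel] at hκ
  obtain ⟨η, hη, hdη⟩ := hE (ξ - kmap ψ N κ) (sub_mem hξ (h.h1.P hκ)) (by
    rw [map_sub, ← h.h1.d, hdκ, hθ2, sub_self])
  refine ⟨kmap φ N η, h.h2.P hη, ?_⟩
  rw [← h.h2.d, hdη, map_sub, h.kzero _ hκ, sub_zero]

end ses

variable {N : ℕ} {i : ℤ} {c : Γ}

theorem V_of_Inj {φ : D.A →+ E.A} (hφ : Hom D E φ) (h : Inj D E φ N i c) (hV : E.V N i c) :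
    D.V N i c := fun a ha hda =>
  h a ha hda (hV _ (hφ.P ha) (by rw [← hφ.d, hda, map_zero]))

theorem V_of_Surj {φ : D.A →+ E.A} (hφ : Hom D E φ) (h : Surj D E φ N i c) (hV : D.V N i c) :
    E.V N i c := by
  intro a ha hda
  obtain ⟨a', ha', hda', b, hb, rfl⟩ := h a ha hda
  obtain ⟨b', hb', rfl⟩ := hV a' ha' hda'
  exact ⟨kmap φ N b' + b, add_mem (hφ.P hb') hb, by rw [map_add, hφ.d]⟩

theorem Inj.comp {φ : D.A →+ E.A} {ψ : E.A →+ G.A} (hφ : Hom D E φ)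
    (h1 : Inj D E φ N i c) (h2 : Inj E G ψ N i c) : Inj D G (ψ.comp φ) N i c := by
  intro a ha hda hb
  rw [kmap_comp] at hb
  exact h1 a ha hda (h2 _ (hφ.P ha) (by rw [← hφ.d, hda, map_zero]) hb)

theorem Surj.comp {φ : D.A →+ E.A} {ψ : E.A →+ G.A} (hψ : Hom E G ψ)
    (h1 : Surj D E φ N i c) (h2 : Surj E G ψ N i c) : Surj D G (ψ.comp φ) N i c := by
  intro a ha hda
  obtain ⟨a', ha', hda', b, hb, rfl⟩ := h2 a ha hda
  obtain ⟨a'', ha'', hda'', b', hb', rfl⟩ := h1 a' ha' hda'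
  refine ⟨a'', ha'', hda'', kmap ψ N b' + b, add_mem (hψ.P hb') hb, ?_⟩
  rw [kmap_comp, map_add, map_add, hψ.d]; abel

theorem Inj_of_V {φ : D.A →+ E.A} (h : D.V N i c) : Inj D E φ N i c :=
  fun a ha hda _ => h a ha hda

theorem Surj_of_V {φ : D.A →+ E.A} (h : E.V N i c) : Surj D E φ N i c := by
  intro a ha hda
  obtain ⟨b, hb, rfl⟩ := h a ha hda
  exact ⟨0, zero_mem _, map_zero _, b, hb, by rw [map_zero, zero_add]⟩

/-- multiplication by `g N` as a map from the shifted datum -/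
theorem hom_g (D : KD Γ τ) (s : ℕ) : Hom (D.sh τ) D (D.g s) where
  comm := fun t a => D.comm s t a
  mem := fun c a ha => D.shift s c a ha

theorem V_cone (hi : Inj (D.sh τ) D (D.g N) N (i-1) c) (hs : Surj (D.sh τ) D (D.g N) N i c) :
    D.V (N+1) i c := by
  rintro ω hab h0
  obtain ⟨a, b, rfl⟩ := kmk_surj ω
  rw [P, mem_kP_succ] at hab
  rw [KD.d, kd_succ, mk_eq_zero, neg_eq_zero] at h0
  obtain ⟨η, hη, hdη⟩ := hi b (by rw [sh_P]; exact hab.2) h0.2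
    ⟨-a, by rw [sub_add_cancel]; exact neg_mem hab.1, by
      rw [map_neg, neg_eq_iff_add_eq_zero]; exact h0.1⟩
  rw [sub_add_cancel] at hη
  obtain ⟨ω, hω, hdω, ζ, hζ, hh⟩ := hs (a + kmap (D.g N) N η)
    (add_mem hab.1 ((D.hom_g N).P hη)) (by
      have e1 : D.d N (kmap (D.g N) N η) = kmap (D.g N) N b := by
        rw [← hdη]; exact ((D.hom_g N).d N η).symm
      rw [map_add, e1]; exact h0.1)
  rw [sh_P] at hη hω
  refine ⟨kmk ζ (ω - η), ?_, ?_⟩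
  · rw [P, mem_kP_succ]
    refine ⟨hζ, ?_⟩
    rw [add_sub_cancel_right]
    exact sub_mem hω hη
  · have e1 : kd D.g N η = b := hdη
    have e2 : kd D.g N ω = 0 := hdω
    rw [KD.d, kd_succ, mk_eq_mk, map_sub, map_sub, e1, e2]
    refine ⟨?_, by simp⟩
    have : a = (kmap (D.g N) N ω + D.d N ζ) - kmap (D.g N) N η := by rw [← hh]; abel
    rw [this, KD.d]
    abel

theorem V_succ (h1 : D.V N i c) (h2 : D.V N (i-1) (c-τ)) : D.V (N+1) i c :=
  V_cone (Inj_of_V ((D.sh_V τ N (i-1) c).2 h2)) (Surj_of_V h1)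

theorem exists_of_d_eq_inc : ∀ (N : ℕ) (c : Γ) (η : KC D.A N) (q : D.A), η ∈ D.P N 1 c →
    D.d N η = inc N q → ∃ Q : ℕ → D.A, (∀ s, Q s ∈ D.X (c - τ)) ∧ q = ∑ s ∈ range N, D.g s (Q s)
  | 0, c, η, q, _, h => ⟨0, fun _ => zero_mem _, by
      rw [KD.d, kd_zero', inc_zero', eq_comm, kz_eq_zero] at h; simpa using h⟩
  | N + 1, c, ω, q, hm, h => by
    obtain ⟨α, β, rfl⟩ := kmk_surj ω
    rw [P, mem_kP_succ] at hm
    obtain ⟨β0, hβ0, rfl⟩ := eq_inc D.X τ N _ β hm.2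
    rw [KD.d, kd_succ, inc_succ, mk_eq_mk, kmap_inc, ← eq_sub_iff_add_eq, ← map_sub] at h
    obtain ⟨Q, hQ, hq⟩ := exists_of_d_eq_inc N c α _ hm.1 h.1
    refine ⟨Function.update Q N β0, ?_, ?_⟩
    · intro s
      by_cases hs : s = N
      · subst hs; simpa using hβ0
      · simpa [Function.update_of_ne hs] using hQ s
    · rw [sum_range_succ, Function.update_self, ← sub_eq_iff_eq_add, hq]
      refine sum_congr rfl fun s hs => ?_
      rw [Function.update_of_ne (by simp at hs; omega)]

theorem exists_d_eq_inc : ∀ (N : ℕ) (c : Γ) (Q : ℕ → D.A), (∀ s, Q s ∈ D.X (c - τ)) →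
    ∃ η ∈ D.P N 1 c, D.d N η = inc N (∑ s ∈ range N, D.g s (Q s))
  | 0, c, Q, _ => ⟨0, zero_mem _, by simp⟩
  | N + 1, c, Q, hQ => by
    obtain ⟨η, hη, h⟩ := exists_d_eq_inc N c Q hQ
    refine ⟨kmk η (inc N (Q N)), ?_, ?_⟩
    · rw [P, mem_kP_succ, sub_self, inc_mem]
      exact ⟨hη, hQ N⟩
    · rw [KD.d, kd_succ, inc_succ, mk_eq_mk, kmap_inc, kd_inc, sum_range_succ, map_add]
      rw [KD.d] at h
      exact ⟨by rw [h], neg_zero⟩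

theorem V_zero_iff : D.V N 0 c ↔
    ∀ q ∈ D.X c, ∃ Q : ℕ → D.A, (∀ s, Q s ∈ D.X (c - τ)) ∧ q = ∑ s ∈ range N, D.g s (Q s) := by
  constructor
  · intro h q hq
    obtain ⟨η, hη, h⟩ := h (inc N q) ((inc_mem _ _ _ _ _).2 hq) (kd_inc _ _ _)
    exact exists_of_d_eq_inc N c η q hη h
  · intro h a ha _
    obtain ⟨q, hq, rfl⟩ := eq_inc _ _ _ _ _ ha
    obtain ⟨Q, hQ, rfl⟩ := h q hq
    exact exists_d_eq_inc N c Q hQ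

/-- pass from one grading group to another -/
abbrev pull {τ' : Γ'} (D : KD Γ' τ') (h : Γ → Γ') (τ : Γ) (hh : ∀ c, h (c - τ) = h c - τ') : KD Γ τ where
  A := D.A
  g := D.g
  X := fun c => D.X (h c)
  comm := D.comm
  shift := fun s c a ha => D.shift s _ a (by rwa [← hh])

theorem pull_V {τ' : Γ'} (D : KD Γ' τ') (h : Γ → Γ') (τ : Γ) (hh : ∀ c, h (c - τ) = h c - τ')
    (N i c) : (D.pull h τ hh).V N i c ↔ D.V N i (h c) := by
  have h1 := kP_reindex D.X τ τ' h hh N i c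
  have h2 := kP_reindex D.X τ τ' h hh N (i+1) c
  unfold V P
  rw [h1, h2]

end KD
end Kz


/-! ## Part 2: the multigraded ring -/

namespace Kz

section T
variable {K : Type} [Field K] {k : ℕ}

/-- the Cox ring (with extra variables) -/
abbrev TT (K : Type) [Field K] (k : ℕ) : Type := MvPolynomial (Fin k × ℕ) K

def md (μ : Fin k × ℕ →₀ ℕ) : Fin k → ℤ :=
  Finsupp.weight (fun x : Fin k × ℕ => (Pi.single x.1 (1:ℤ) : Fin k → ℤ)) μ

theorem md_zero : md (0 : Fin k × ℕ →₀ ℕ) = 0 := map_zero _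
theorem md_add (μ ν : Fin k × ℕ →₀ ℕ) : md (μ + ν) = md μ + md ν := map_add _ _ _
theorem md_single (x : Fin k × ℕ) (n : ℕ) : md (Finsupp.single x n) = n • Pi.single x.1 (1:ℤ) := by
  simp [md, Finsupp.weight_apply]

theorem md_nonneg (μ : Fin k × ℕ →₀ ℕ) (l : Fin k) : 0 ≤ md μ l := by
  rw [md, Finsupp.weight_apply, Finsupp.sum, Finset.sum_apply]
  refine Finset.sum_nonneg fun x _ => ?_
  rw [Pi.smul_apply, Pi.single_apply]
  split_ifs <;> simp

theorem md_pos (μ : Fin k × ℕ →₀ ℕ) (l : Fin k) (h : md μ l ≠ 0) : ∃ i, μ (l, i) ≠ 0 := by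
  by_contra hc
  push Not at hc
  apply h
  rw [md, Finsupp.weight_apply, Finsupp.sum, Finset.sum_apply]
  refine Finset.sum_eq_zero fun x hx => ?_
  rw [Pi.smul_apply, Pi.single_apply]
  split_ifs with hl
  · exfalso
    rw [Finsupp.mem_support_iff] at hx
    apply hx
    have := hc x.2
    rw [hl] at this
    simpa using this
  · simp

/-- multigraded pieces -/
def XP (K : Type) [Field K] {k : ℕ} (p : Fin k → ℕ) (c : Fin k → ℤ) : Submodule K (TT K k) :=
  restrictSupport K {μ | md μ = c ∧ ∀ x, μ x ≠ 0 → x.2 < p x.1}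

theorem mem_XP {p : Fin k → ℕ} {c : Fin k → ℤ} {q : TT K k} : q ∈ XP K p c ↔
    ∀ μ, coeff μ q ≠ 0 → md μ = c ∧ ∀ x, μ x ≠ 0 → x.2 < p x.1 := by
  rw [XP, mem_restrictSupport_iff]
  constructor
  · intro h μ hμ
    exact h (by simpa using hμ)
  · intro h μ hμ
    exact h μ (by simpa using hμ)

theorem XP_mul {p : Fin k → ℕ} {c c' : Fin k → ℤ} {q q' : TT K k} (h : q ∈ XP K p c)
    (h' : q' ∈ XP K p c') : q * q' ∈ XP K p (c + c') := by
  rw [mem_XP] at *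
  intro μ hμ
  rw [coeff_mul] at hμ
  obtain ⟨⟨a, b⟩, hab, hne⟩ := Finset.exists_ne_zero_of_sum_ne_zero hμ
  rw [HasAntidiagonal.mem_antidiagonal] at hab
  simp only at hab hne
  obtain ⟨h1, h2⟩ := h a (left_ne_zero_of_mul hne)
  obtain ⟨h3, h4⟩ := h' b (right_ne_zero_of_mul hne)
  refine ⟨by rw [← hab, md_add, h1, h3], fun x hx => ?_⟩
  rw [← hab, Finsupp.add_apply] at hx
  by_cases hx1 : a x = 0
  · exact h4 x (by omega)
  · exact h2 x hx1

theorem XP_one {p : Fin k → ℕ} : (1 : TT K k) ∈ XP K p 0 := by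
  rw [mem_XP]
  intro μ hμ
  rw [coeff_one] at hμ
  have : μ = 0 := by by_contra h; exact hμ (if_neg (Ne.symm h))
  subst this
  exact ⟨md_zero, by simp⟩

theorem XP_X {p : Fin k → ℕ} (l : Fin k) (i : ℕ) (h : i < p l) :
    (X (l, i) : TT K k) ∈ XP K p (Pi.single l 1) := by
  rw [mem_XP]
  intro μ hμ
  rw [coeff_X] at hμ
  have : Finsupp.single (l, i) 1 = μ := by
    by_contra hne
    exact hμ (if_neg hne)
  subst this
  refine ⟨by rw [md_single, one_smul], fun x hx => ?_⟩
  rw [Finsupp.single_apply] at hx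
  have : (l, i) = x := by by_contra hne; exact hx (if_neg hne)
  subst this; exact h

theorem XP_pow {p : Fin k → ℕ} {c : Fin k → ℤ} {q : TT K k} (h : q ∈ XP K p c) (n : ℕ) :
    q ^ n ∈ XP K p (n • c) := by
  induction n with
  | zero => simpa using XP_one
  | succ n ih => rw [pow_succ, succ_nsmul]; exact XP_mul ih h

theorem XP_prod {p : Fin k → ℕ} {ι : Type} (s : Finset ι) (q : ι → TT K k) (c : ι → Fin k → ℤ)
    (h : ∀ i ∈ s, q i ∈ XP K p (c i)) : ∏ i ∈ s, q i ∈ XP K p (∑ i ∈ s, c i) := by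
  classical
  induction s using Finset.induction_on with
  | empty => simpa using XP_one
  | insert a s ha ih =>
    rw [prod_insert ha, sum_insert ha]
    exact XP_mul (h a (mem_insert_self _ _)) (ih fun i hi => h i (mem_insert_of_mem hi))

theorem XP_empty_neg {p : Fin k → ℕ} {c : Fin k → ℤ} (l : Fin k) (hl : c l < 0) :
    ∀ q ∈ XP K p c, q = 0 := by
  intro q hq
  rw [mem_XP] at hq
  ext μ
  rw [coeff_zero]
  by_contra h
  have := md_nonneg μ l
  rw [(hq μ h).1] at this
  omega

theorem XP_empty_zero {p : Fin k → ℕ} {c : Fin k → ℤ} (l : Fin k) (hp : p l = 0) (hl : c l ≠ 0) :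
    ∀ q ∈ XP K p c, q = 0 := by
  intro q hq
  rw [mem_XP] at hq
  ext μ
  rw [coeff_zero]
  by_contra h
  obtain ⟨h1, h2⟩ := hq μ h
  obtain ⟨i, hi⟩ := md_pos μ l (by rwa [h1])
  have := h2 _ hi
  simp [hp] at this

/-- the multiplication polynomial -/
def fpoly (K : Type) [Field K] {k : ℕ} (p : Fin k → ℕ) : Polynomial (TT K k) :=
  ∏ l, ∑ i ∈ range (p l), Polynomial.C (X (l, i)) * Polynomial.X ^ i

def ff (K : Type) [Field K] {k : ℕ} (p : Fin k → ℕ) (s : ℕ) : TT K k := (fpoly K p).coeff s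

theorem ff_factor_coeff (p : Fin k → ℕ) (l : Fin k) (s : ℕ) :
    (∑ i ∈ range (p l), Polynomial.C (X (l, i) : TT K k) * Polynomial.X ^ i).coeff s =
      if s < p l then X (l, s) else 0 := by
  simp [Polynomial.finsetSum_coeff, Polynomial.coeff_X_pow]

theorem ff_mem (p : Fin k → ℕ) (s : ℕ) : ff K p s ∈ XP K p (fun _ => 1) := by
  have key : ∀ L : Finset (Fin k), ∀ s, (∏ l ∈ L, ∑ i ∈ range (p l),
      Polynomial.C (X (l, i) : TT K k) * Polynomial.X ^ i).coeff s ∈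
      XP K p (∑ l ∈ L, Pi.single l 1) := by
    intro L
    induction L using Finset.induction_on with
    | empty =>
      intro s
      rw [prod_empty, sum_empty, Polynomial.coeff_one]
      split_ifs
      · exact XP_one
      · exact zero_mem _
    | insert a L ha ih =>
      intro s
      rw [prod_insert ha, sum_insert ha, Polynomial.coeff_mul]
      refine sum_mem fun x _ => XP_mul ?_ (ih _)
      rw [ff_factor_coeff]
      split_ifs with h
      · exact XP_X a _ h
      · exact zero_mem _
  have := key univ s
  have h2 : (∑ l : Fin k, Pi.single l (1:ℤ) : Fin k → ℤ) = fun _ => 1 := by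
    ext j; simp [Finset.sum_apply, Pi.single_apply]
  rw [h2] at this
  exact this

theorem factor_natDegree (p : Fin k → ℕ) (l : Fin k) :
    (∑ i ∈ range (p l), Polynomial.C (X (l, i) : TT K k) * Polynomial.X ^ i).natDegree ≤ p l - 1 := by
  rw [Polynomial.natDegree_le_iff_coeff_eq_zero]
  intro N hN
  rw [ff_factor_coeff, if_neg (by omega)]

theorem ff_top_aux (p : Fin k → ℕ) (hp : ∀ l, 1 ≤ p l) (L : Finset (Fin k)) :
    (∏ l ∈ L, ∑ i ∈ range (p l), Polynomial.C (X (l, i) : TT K k) * Polynomial.X ^ i).natDegree ≤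
      ∑ l ∈ L, (p l - 1) ∧
    (∏ l ∈ L, ∑ i ∈ range (p l), Polynomial.C (X (l, i) : TT K k) * Polynomial.X ^ i).coeff
      (∑ l ∈ L, (p l - 1)) = ∏ l ∈ L, X (l, p l - 1) := by
  induction L using Finset.induction_on with
  | empty => simp
  | insert a L ha ih =>
    rw [prod_insert ha, sum_insert ha, prod_insert ha]
    refine ⟨Polynomial.natDegree_mul_le_of_le (factor_natDegree p a) ih.1, ?_⟩
    rw [Polynomial.coeff_mul_add_eq_of_natDegree_le (factor_natDegree p a) ih.1, ih.2,
      ff_factor_coeff, if_pos (by have := hp a; omega)]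

theorem ff_top (p : Fin k → ℕ) (hp : ∀ l, 1 ≤ p l) :
    ff K p (∑ l, (p l - 1)) = ∏ l, X (l, p l - 1) := (ff_top_aux p hp univ).2

theorem ff_zero (p : Fin k → ℕ) (hp : ∀ l, 1 ≤ p l) :
    ff K p 0 = ∏ l, X (l, 0) := by
  rw [ff, fpoly, Polynomial.coeff_zero_prod]
  refine prod_congr rfl fun l _ => ?_
  rw [ff_factor_coeff, if_pos (Nat.lt_of_lt_of_le Nat.zero_lt_one (hp l))]

/-- kill a variable -/
def kill (x : Fin k × ℕ) : TT K k →ₐ[K] TT K k := aeval fun y => if y = x then 0 else X y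

theorem kill_monomial (x : Fin k × ℕ) (μ : Fin k × ℕ →₀ ℕ) (a : K) :
    kill x (monomial μ a) = if μ x = 0 then monomial μ a else 0 := by
  rw [kill, aeval_monomial]
  split_ifs with h
  · rw [monomial_eq]
    congr 1
    refine Finsupp.prod_congr fun y hy => ?_
    rw [if_neg]
    rintro rfl
    simp [h] at hy
  · rw [Finsupp.prod, prod_eq_zero (i := x) (by simpa using h), mul_zero]
    rw [if_pos rfl, zero_pow h]

theorem coeff_kill (x : Fin k × ℕ) (μ : Fin k × ℕ →₀ ℕ) (q : TT K k) :
    coeff μ (kill x q) = if μ x = 0 then coeff μ q else 0 := by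
  induction q using MvPolynomial.induction_on' with
  | monomial ν a =>
    rw [kill_monomial]
    split_ifs with h1 h2 h3
    · rfl
    · rw [coeff_monomial, if_neg]; rintro rfl; exact h2 h1
    · rw [coeff_zero, coeff_monomial, if_neg]; rintro rfl; exact h1 h3
    · rw [coeff_zero]
  | add p q hp hq =>
    rw [map_add, coeff_add, hp, hq, coeff_add]
    split_ifs <;> simp

theorem kill_ff (p : Fin k → ℕ) (l : Fin k) (r s : ℕ) (hr : p l = r + 1) :
    kill (l, r) (ff K p s) = ff K (Function.update p l r) s := by
  have : (fpoly K p).map (kill (l, r)).toRingHom = fpoly K (Function.update p l r) := by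
    rw [fpoly, fpoly, Polynomial.map_prod]
    refine prod_congr rfl fun j _ => ?_
    ext1 n
    rw [Polynomial.coeff_map, ff_factor_coeff, ff_factor_coeff]
    by_cases hj : j = l
    · subst hj
      rw [Function.update_self, hr]
      by_cases h1 : n < r
      · rw [if_pos h1, if_pos (by omega)]
        change kill (j, r) (X (j, n)) = _
        rw [kill, aeval_X, if_neg]
        simp; omega
      · rw [if_neg h1]
        split_ifs with h2
        · have : n = r := by omega
          subst this
          change kill (j, n) (X (j, n)) = _
          rw [kill, aeval_X, if_pos rfl]
        · exact map_zero _
    · rw [Function.update_of_ne hj]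
      split_ifs
      · change kill (l, r) (X (j, n)) = _
        rw [kill, aeval_X, if_neg]
        simp [hj]
      · exact map_zero _
  rw [ff, ff, ← this, Polynomial.coeff_map]; rfl

/-- the Koszul datum -/
@[reducible] def DT (K : Type) [Field K] {k : ℕ} (t : ℕ) (p : Fin k → ℕ) :
    KD (Fin k → ℤ) (fun _ => (t:ℤ)) where
  A := TT K k
  g := fun s => AddMonoidHom.mulLeft (ff K p s ^ t)
  X := fun c => (XP K p c).toAddSubgroup
  comm := fun s u a => mul_left_comm (ff K p s ^ t) (ff K p u ^ t) (a : TT K k)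
  shift := fun s c a ha => by
    have := XP_mul (XP_pow (ff_mem (K := K) p s) t) ha
    have h2 : (t • (fun _ => (1:ℤ)) : Fin k → ℤ) + (c - fun _ => (t:ℤ)) = c := by
      ext j; simp
    rw [h2] at this
    exact this

theorem mulX_hom (t : ℕ) (p : Fin k → ℕ) (y : TT K k) (e : Fin k → ℤ) (hy : y ∈ XP K p e) :
    KD.Hom ((DT K t p).sh e) (DT K t p) (AddMonoidHom.mulLeft y) where
  comm := fun s a => mul_left_comm y (ff K p s ^ t) (a : TT K k)
  mem := fun c a ha => by
    have := XP_mul hy ha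
    rw [add_sub_cancel] at this
    exact this

theorem XP_div {p : Fin k → ℕ} {c e : Fin k → ℤ} (x : Fin k × ℕ) (q : TT K k)
    (hq : X x * q ∈ XP K p c) (he : e = Pi.single x.1 1) : q ∈ XP K p (c - e) := by
  subst he
  rw [mem_XP] at *
  intro μ hμ
  have := hq (μ + Finsupp.single x 1) (by
    rw [mul_comm, coeff_mul_X]; exact hμ)
  rw [md_add, md_single, one_smul] at this
  refine ⟨by rw [← this.1]; simp, fun y hy => this.2 y ?_⟩
  rw [Finsupp.add_apply]; omega

theorem kill_mem {p : Fin k → ℕ} {l : Fin k} {r : ℕ} (hr : p l = r + 1) {c : Fin k → ℤ}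
    {a : TT K k} (ha' : a ∈ XP K p c) : kill (l, r) a ∈ XP K (Function.update p l r) c := by
  rw [mem_XP] at *
  intro μ hμ
  rw [coeff_kill] at hμ
  split_ifs at hμ with h
  · refine ⟨(ha' μ hμ).1, fun x hx => ?_⟩
    have h2 := (ha' μ hμ).2 x hx
    by_cases hxl : x.1 = l
    · rw [hxl, Function.update_self]
      rw [hxl, hr] at h2
      have : x.2 ≠ r := by
        rintro rfl
        rw [← hxl] at h
        exact hx h
      omega
    · rwa [Function.update_of_ne hxl]
  · exact absurd rfl hμ

theorem kill_eq_zero {l : Fin k} {r : ℕ} {b : TT K k} (h' : kill (l, r) b = 0) :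
    ∃ q, b = X (l, r) * q := by
  change (X (l, r) : TT K k) ∣ b
  rw [X_dvd_iff_modMonomial_eq_zero]
  ext μ
  rw [coeff_zero]
  by_cases hle : Finsupp.single (l, r) 1 ≤ μ
  · exact coeff_modMonomial_of_le _ hle
  · rw [coeff_modMonomial_of_not_le _ hle]
    have := coeff_kill (l, r) μ b
    rw [h', coeff_zero, if_pos] at this
    · exact this.symm
    · by_contra h0
      apply hle
      rw [Finsupp.single_le_iff]
      omega

theorem mem_of_update {p : Fin k → ℕ} {l : Fin k} {r : ℕ} (hr : p l = r + 1) {c : Fin k → ℤ}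
    {b : TT K k} (hb' : b ∈ XP K (Function.update p l r) c) : b ∈ XP K p c := by
  rw [mem_XP] at *
  intro μ hμ
  refine ⟨(hb' μ hμ).1, fun x hx => ?_⟩
  have h2 := (hb' μ hμ).2 x hx
  by_cases hxl : x.1 = l
  · rw [hxl, Function.update_self] at h2
    rw [hxl]; omega
  · rwa [Function.update_of_ne hxl] at h2

theorem kill_of_update {p : Fin k → ℕ} {l : Fin k} {r : ℕ} {c : Fin k → ℤ}
    {b : TT K k} (hb' : b ∈ XP K (Function.update p l r) c) : kill (l, r) b = b := by
  rw [mem_XP] at hb'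
  ext μ
  rw [coeff_kill]
  split_ifs with h
  · rfl
  · by_contra hne
    have h2 := (hb' μ (Ne.symm hne)).2 _ h
    rw [Function.update_self] at h2
    exact lt_irrefl _ h2

theorem X_mul_inj {x : Fin k × ℕ} {a : TT K k} (h : AddMonoidHom.mulLeft (X x) a = 0) : a = 0 :=
  (mul_eq_zero.1 (show X x * a = 0 from h)).resolve_left (X_ne_zero _)

def killA (x : Fin k × ℕ) : TT K k →+ TT K k := (kill x).toLinearMap.toAddMonoidHom

theorem killA_apply (x : Fin k × ℕ) (a : TT K k) : killA x a = kill x a := rfl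

theorem killA_comm {p : Fin k → ℕ} {l : Fin k} {r : ℕ} (t : ℕ) (hr : p l = r + 1) (s : ℕ)
    (a : TT K k) : killA (l, r) (AddMonoidHom.mulLeft (ff K p s ^ t) a) =
      AddMonoidHom.mulLeft (ff K (Function.update p l r) s ^ t) (killA (l, r) a) := by
  rw [AddMonoidHom.coe_mulLeft, AddMonoidHom.coe_mulLeft, killA_apply, killA_apply,
    map_mul, map_pow, kill_ff p l r s hr]

theorem killA_zero {x : Fin k × ℕ} (a : TT K k) :
    killA x (AddMonoidHom.mulLeft (X x) a) = 0 := by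
  rw [AddMonoidHom.coe_mulLeft, killA_apply, map_mul, kill, aeval_X, if_pos rfl, zero_mul]

theorem ses_y (t : ℕ) (p : Fin k → ℕ) (l : Fin k) (r : ℕ) (hr : p l = r + 1) :
    KD.SES ((DT K t p).sh (Pi.single l 1)) (DT K t p) (DT K t (Function.update p l r))
      (AddMonoidHom.mulLeft (X (l, r) : TT K k))
      (killA (l, r)) where
  h1 := mulX_hom t p _ _ (XP_X l r (by omega))
  h2 := ⟨fun s a => killA_comm t hr s a, fun c a ha => kill_mem hr ha⟩
  inj := fun c a _ h => X_mul_inj h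
  zero := fun _ a _ => killA_zero a
  exact := fun c b hb h => by
    obtain ⟨q, hq⟩ := kill_eq_zero h
    have hb' : b ∈ XP K p c := hb
    rw [hq] at hb'
    exact ⟨q, XP_div (l, r) q hb' rfl, hq.symm⟩
  surj := fun c b hb => ⟨b, mem_of_update hr hb, kill_of_update hb⟩

/-- vanishing for the multigraded ring -/
def VT (K : Type) [Field K] {k : ℕ} (t N : ℕ) (p : Fin k → ℕ) (i : ℤ) (c : Fin k → ℤ) : Prop :=
  (DT K t p).V N i c

variable {t N : ℕ} {p : Fin k → ℕ} {i : ℤ} {c : Fin k → ℤ}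

theorem VT_A {l : Fin k} {r : ℕ} (hr : p l = r + 1) (h1 : VT K t N p i c)
    (h2 : VT K t N p (i-1) (c - Pi.single l 1)) : VT K t N (Function.update p l r) i c :=
  (ses_y t p l r hr).V_quot h1 (((DT K t p).sh_V _ _ _ _).2 h2)

theorem VT_B {l : Fin k} {r : ℕ} (hr : p l = r + 1) (h1 : VT K t N p i (c - Pi.single l 1))
    (h2 : VT K t N (Function.update p l r) i c) : VT K t N p i c :=
  KD.V_of_Surj (ses_y t p l r hr).h1 ((ses_y t p l r hr).Surj_of h2)
    (((DT K t p).sh_V _ _ _ _).2 h1)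

theorem VT_C {l : Fin k} {r : ℕ} (hr : p l = r + 1) (h1 : VT K t N p i c)
    (h2 : VT K t N (Function.update p l r) (i+1) c) : VT K t N p i (c - Pi.single l 1) :=
  ((DT K t p).sh_V _ _ _ _).1 (KD.V_of_Inj (ses_y t p l r hr).h1
    ((ses_y t p l r hr).Inj_of h2) h1)

theorem VT_empty_neg (l : Fin k) (h : c l - i * t < 0) : VT K t N p i c :=
  (DT K t p).V_empty fun a ha => XP_empty_neg (K := K) (p := p) l (by simpa using h) a ha

theorem VT_empty_zero (l : Fin k) (hp : p l = 0) (h : c l - i * t ≠ 0) : VT K t N p i c :=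
  (DT K t p).V_empty fun a ha => XP_empty_zero (K := K) l hp (by simpa using h) a ha

end T
end Kz


/-! ## Part 3: base vanishing -/

namespace Kz
section T
variable {K : Type} [Field K] {k : ℕ}

/-- injectivity of multiplication by `y` on homology -/
def IA (t : ℕ) (p : Fin k → ℕ) (N : ℕ) (i : ℤ) (y : TT K k) (c0 c1 : Fin k → ℤ) : Prop :=
  ∀ a ∈ (DT K t p).P N i c0, (DT K t p).d N a = 0 →
    (∃ b ∈ (DT K t p).P N (i+1) c1, (DT K t p).d N b = kmap (AddMonoidHom.mulLeft y) N a) →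
    ∃ b ∈ (DT K t p).P N (i+1) c0, (DT K t p).d N b = a

/-- surjectivity of multiplication by `y` on homology -/
def SA (t : ℕ) (p : Fin k → ℕ) (N : ℕ) (i : ℤ) (y : TT K k) (c0 c1 : Fin k → ℤ) : Prop :=
  ∀ a ∈ (DT K t p).P N i c1, (DT K t p).d N a = 0 → ∃ a' ∈ (DT K t p).P N i c0,
    (DT K t p).d N a' = 0 ∧
    ∃ b ∈ (DT K t p).P N (i+1) c1, a = kmap (AddMonoidHom.mulLeft y) N a' + (DT K t p).d N b

variable {t N : ℕ} {p : Fin k → ℕ} {i : ℤ}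

theorem IA_iff {y : TT K k} {e c : Fin k → ℤ} :
    KD.Inj ((DT K t p).sh e) (DT K t p) (AddMonoidHom.mulLeft y) N i c ↔ IA t p N i y (c - e) c := by
  have h1 := (DT K t p).sh_P e N i c
  have h2 := (DT K t p).sh_P e N (i+1) c
  unfold KD.Inj IA
  rw [h1, h2]

theorem SA_iff {y : TT K k} {e c : Fin k → ℤ} :
    KD.Surj ((DT K t p).sh e) (DT K t p) (AddMonoidHom.mulLeft y) N i c ↔ SA t p N i y (c - e) c := by
  have h1 := (DT K t p).sh_P e N i c
  unfold KD.Surj SA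
  rw [h1]

theorem mulP {y : TT K k} {c0 c1 : Fin k → ℤ} (hy : y ∈ XP K p (c1 - c0)) {a : KC (TT K k) N}
    (ha : a ∈ (DT K t p).P N i c0) :
    kmap (AddMonoidHom.mulLeft y) N a ∈ (DT K t p).P N i c1 := by
  have h1 := (DT K t p).sh_P (c1 - c0) N i c1
  rw [sub_sub_cancel] at h1
  rw [← h1] at ha
  exact (mulX_hom t p y _ hy).P ha

theorem muld {y : TT K k} {a : KC (TT K k) N} :
    kmap (AddMonoidHom.mulLeft y) N ((DT K t p).d N a) =
    (DT K t p).d N (kmap (AddMonoidHom.mulLeft y) N a) :=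
  kmap_kd _ _ _ (fun s a => mul_left_comm y (ff K p s ^ t) (a : TT K k)) N a

theorem mulLeft_mul (y y' : TT K k) : AddMonoidHom.mulLeft (y' * y) =
    (AddMonoidHom.mulLeft y').comp (AddMonoidHom.mulLeft y) := by
  refine AddMonoidHom.ext fun a => ?_
  exact mul_assoc y' y a

theorem IA.comp {y y' : TT K k} {c0 c1 c2 : Fin k → ℤ} (hy : y ∈ XP K p (c1 - c0))
    (h1 : IA t p N i y c0 c1) (h2 : IA t p N i y' c1 c2) : IA t p N i (y' * y) c0 c2 := by
  intro a ha hda hb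
  rw [mulLeft_mul, kmap_comp] at hb
  exact h1 a ha hda (h2 _ (mulP hy ha) (by rw [← muld, hda, map_zero]) hb)

theorem SA.comp {y y' : TT K k} {c0 c1 c2 : Fin k → ℤ} (hy' : y' ∈ XP K p (c2 - c1))
    (h1 : SA t p N i y c0 c1) (h2 : SA t p N i y' c1 c2) : SA t p N i (y' * y) c0 c2 := by
  intro a ha hda
  obtain ⟨a', ha', hda', b, hb, rfl⟩ := h2 a ha hda
  obtain ⟨a'', ha'', hda'', b', hb', rfl⟩ := h1 a' ha' hda'
  refine ⟨a'', ha'', hda'', kmap (AddMonoidHom.mulLeft y') N b' + b, add_mem (mulP hy' hb') hb, ?_⟩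
  rw [mulLeft_mul, kmap_comp, map_add, map_add, muld]; abel

theorem kmap_one : ∀ N (a : KC (TT K k) N), kmap (AddMonoidHom.mulLeft (1 : TT K k)) N a = a
  | 0, a => by
    obtain ⟨a, rfl⟩ := kz_surj a
    rw [kmap_zero', AddMonoidHom.coe_mulLeft, one_mul]
  | N + 1, a => by
    obtain ⟨a, b, rfl⟩ := kmk_surj a
    rw [kmap_succ, kmap_one N, kmap_one N]

theorem IA_one (c : Fin k → ℤ) : IA t p N i (1 : TT K k) c c := by
  rintro a _ _ ⟨b, hb, h⟩
  rw [kmap_one] at h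
  exact ⟨b, hb, h⟩

theorem SA_one (c : Fin k → ℤ) : SA t p N i (1 : TT K k) c c := by
  intro a ha h
  exact ⟨a, ha, h, 0, zero_mem _, by rw [kmap_one, map_zero, add_zero]⟩

theorem IA_of_neg {y : TT K k} {c0 c1 : Fin k → ℤ} (hi : i < 0) : IA t p N i y c0 c1 :=
  fun a ha hda _ => (DT K t p).V_neg hi a ha hda

theorem SA_of_neg {y : TT K k} {c0 c1 : Fin k → ℤ} (hi : i < 0) : SA t p N i y c0 c1 := by
  intro a ha hda
  have := kP_neg _ _ _ _ _ hi a ha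
  exact ⟨0, zero_mem _, map_zero _, 0, zero_mem _, by rw [this, map_zero, map_zero, add_zero]⟩

/-- indicator of a finset -/
def ind (D : Finset (Fin k)) : Fin k → ℤ := fun l => if l ∈ D then 1 else 0

theorem ytop_mem (hp : ∀ l, 1 ≤ p l) (D : Finset (Fin k)) :
    ∏ l ∈ D, (X (l, p l - 1) : TT K k) ∈ XP K p (ind D) := by
  have h := XP_prod (p := p) D (fun l => (X (l, p l - 1) : TT K k)) (fun l => Pi.single l 1)
    (fun l _ => XP_X l _ (by have := hp l; omega))
  have h2 : (∑ l ∈ D, Pi.single l (1:ℤ) : Fin k → ℤ) = ind D := by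
    ext j; simp [ind, Finset.sum_apply, Pi.single_apply]
  rwa [h2] at h

theorem sum_update (hp : ∀ l, 1 ≤ p l) (hN : ∑ l, (p l - 1) = N) (j : Fin k) (hj : 2 ≤ p j) :
    ∑ l, (Function.update p j (p j - 1) l - 1) + 1 = N := by
  rw [← hN, ← Finset.add_sum_erase _ _ (mem_univ j), ← Finset.add_sum_erase _ _ (mem_univ j)]
  rw [Function.update_self]
  have : ∑ x ∈ univ.erase j, (Function.update p j (p j - 1) x - 1) =
      ∑ x ∈ univ.erase j, (p x - 1) := by
    refine sum_congr rfl fun x hx => ?_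
    rw [Function.update_of_ne (ne_of_mem_erase hx)]
  rw [this]; omega

def kap (p : Fin k → ℕ) (c : Fin k → ℤ) (l : Fin k) : ℤ := 2 * c l + if 2 ≤ p l then 1 else 0

/-- the inductive statement -/
def BaseSt (K : Type) [Field K] (k t N : ℕ) : Prop :=
  ∀ (p : Fin k → ℕ) (c : Fin k → ℤ) (i : ℤ), (∀ l, 1 ≤ p l) → ∑ l, (p l - 1) = N →
    (∀ l l', l ≠ l' → c l - c l' ≤ (p l' : ℤ) - 1) →
    (1 ≤ i ∨ ∃ l, ((N:ℤ)+1) * t - ((p l : ℤ) - 1) ≤ c l) → VT K t (N+1) p i c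

theorem base_quot (hp : ∀ l, 1 ≤ p l) (hN : ∑ l, (p l - 1) = N)
    (IH : ∀ M, N = M + 1 → BaseSt K k t M)
    (c : Fin k → ℤ) (hc : ∀ l l', l ≠ l' → c l - c l' ≤ (p l' : ℤ) - 1)
    (D : Finset (Fin k)) (j : Fin k) (hjD : j ∈ D) (hjm : ∀ l ∈ D, kap p c j ≤ kap p c l)
    (hD : ∀ l ∈ D, ∀ l', l' ∉ D → kap p c l' ≤ kap p c l)
    (hi : 1 ≤ i ∨ ∃ l, (N:ℤ) * t - ((p l : ℤ) - 1) + 1 ≤ c l) :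
    VT K t N (Function.update p j (p j - 1)) i (c - ind (D.erase j)) := by
  have hk : ∀ l, kap p c l = 2 * c l + if 2 ≤ p l then 1 else 0 := fun l => rfl
  have hind : ∀ l, (c - ind (D.erase j)) l = c l - if l ∈ D.erase j then 1 else 0 := fun l => rfl
  have hjj : (c - ind (D.erase j)) j = c j := by rw [hind, if_neg (by simp)]; simp
  by_cases h2 : 2 ≤ p j
  · have hs := sum_update hp hN j h2
    obtain ⟨M, rfl⟩ : ∃ M, N = M + 1 := ⟨_, hs.symm⟩
    refine IH M rfl _ _ i ?_ (by omega) ?_ ?_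
    · intro l
      by_cases hl : l = j
      · subst hl; rw [Function.update_self]; omega
      · rw [Function.update_of_ne hl]; exact hp l
    · intro l l' hll
      rw [hind, hind]
      have hcl := hc l l' hll
      have hpl := hp l'
      have k1 := hk l
      have k2 := hk l'
      have k3 := hk j
      rw [if_pos h2] at k3
      by_cases hl' : l' = j
      · subst hl'
        rw [Function.update_self]
        by_cases hlD : l ∈ D
        · rw [if_pos (by simp [hlD, hll]), if_neg (by simp)]; omega
        · have := hD _ hjD l hlD
          rw [if_neg (by simp [hlD]), if_neg (by simp)]
          split_ifs at k1 <;> omega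
      · rw [Function.update_of_ne hl']
        by_cases hl'D : l' ∈ D
        · rw [if_pos (show l' ∈ D.erase j by simp [hl', hl'D])]
          have hm := hjm l' hl'D
          by_cases hlj : l = j
          · subst hlj
            rw [if_neg (by simp)]
            split_ifs at k2 <;> omega
          · by_cases hlD : l ∈ D
            · rw [if_pos (by simp [hlD, hlj])]; omega
            · rw [if_neg (by simp [hlD])]
              have := hD _ hjD l hlD
              split_ifs at k1 k2 <;> omega
        · rw [if_neg (show ¬ l' ∈ D.erase j by simp [hl'D])]
          split_ifs <;> omega
    · rcases hi with hi | ⟨l, hl⟩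
      · exact Or.inl hi
      · right
        refine ⟨l, ?_⟩
        push_cast at hl
        by_cases hlj : l = j
        · subst hlj
          rw [hjj, Function.update_self]
          push_cast [Nat.cast_sub (hp l)]
          linarith
        · rw [hind, Function.update_of_ne hlj]
          split_ifs <;> linarith
  · have hpj : p j = 1 := by have := hp j; omega
    have hu : Function.update p j (p j - 1) j = 0 := by rw [Function.update_self, hpj]
    by_cases hne : c j - i * t = 0
    swap
    · exact VT_empty_zero j hu (by rwa [hjj])
    by_cases hex : ∃ l, (c - ind (D.erase j)) l < c j
    · obtain ⟨l, hl⟩ := hex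
      exact VT_empty_neg l (by linarith)
    push Not at hex
    have hall : ∀ l, c l = c j ∧ p l = 1 := by
      intro l
      by_cases hlj : l = j
      · subst hlj; exact ⟨rfl, hpj⟩
      have h3 := hex l
      rw [hind] at h3
      have h4 := hc l j hlj
      rw [hpj] at h4
      have h5 := hp l
      by_cases hlD : l ∈ D
      · rw [if_pos (by simp [hlD, hlj])] at h3
        push_cast at h4
        omega
      · rw [if_neg (by simp [hlD])] at h3
        have h6 := hD j hjD l hlD
        rw [hk, hk, if_neg h2] at h6
        split_ifs at h6 <;> omega
    have hN0 : N = 0 := by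
      rw [← hN]; exact sum_eq_zero fun l _ => by have := (hall l).2; omega
    subst hN0
    rcases hi with hi | ⟨l, hl⟩
    · exact (DT K t _).V_gt (by push_cast; omega)
    · rw [(hall l).1, (hall l).2] at hl
      push_cast at hl
      by_cases hi0 : i = 0
      · subst hi0; omega
      · by_cases hi1 : 0 < i
        · exact (DT K t _).V_gt (by push_cast; omega)
        · exact (DT K t _).V_neg (by omega)

theorem base_D (hp : ∀ l, 1 ≤ p l) (hN : ∑ l, (p l - 1) = N)
    (IH : ∀ M, N = M + 1 → BaseSt K k t M)
    (c : Fin k → ℤ) (hc : ∀ l l', l ≠ l' → c l - c l' ≤ (p l' : ℤ) - 1) : ∀ (s : ℕ)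
    (D : Finset (Fin k)) (_ : D.card = s)
    (_ : ∀ l ∈ D, ∀ l', l' ∉ D → kap p c l' ≤ kap p c l),
    (0 ≤ i → IA t p N i (∏ l ∈ D, (X (l, p l - 1) : TT K k)) (c - ind D) c) ∧
    ((1 ≤ i ∨ ∃ l, (N:ℤ) * t - ((p l : ℤ) - 1) + 1 ≤ c l) →
      SA t p N i (∏ l ∈ D, (X (l, p l - 1) : TT K k)) (c - ind D) c) := by
  intro s
  induction s with
  | zero =>
    intro D hs _
    rw [card_eq_zero] at hs
    subst hs
    have : ind (∅ : Finset (Fin k)) = 0 := by ext; simp [ind]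
    rw [this, prod_empty, sub_zero]
    exact ⟨fun _ => IA_one c, fun _ => SA_one c⟩
  | succ s ih =>
    intro D hs hD
    obtain ⟨j, hjD, hjm⟩ := D.exists_min_image (kap p c) (card_pos.1 (by omega))
    obtain ⟨ih1, ih2⟩ := ih (D.erase j) (by rw [card_erase_of_mem hjD]; omega) (by
      intro l hl l' hl'
      by_cases h : l' = j
      · subst h; exact hjm l (mem_of_mem_erase hl)
      · exact hD l (mem_of_mem_erase hl) l' (by simpa [h] using hl'))
    have hr : p j = (p j - 1) + 1 := by have := hp j; omega
    have hses := ses_y (K := K) t p j _ hr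
    have hind : ind D = ind (D.erase j) + Pi.single j 1 := by
      ext l
      simp only [ind, Pi.add_apply, Pi.single_apply]
      by_cases h : l = j
      · subst h; simp [hjD]
      · simp [h]
    have hpr : ∏ l ∈ D, (X (l, p l - 1) : TT K k) =
        (∏ l ∈ D.erase j, (X (l, p l - 1) : TT K k)) * X (j, p j - 1) := by
      rw [mul_comm, ← mul_prod_erase D _ hjD]
    have hyj : (X (j, p j - 1) : TT K k) ∈ XP K p (c - ind (D.erase j) - (c - ind D)) := by
      have : c - ind (D.erase j) - (c - ind D) = Pi.single j 1 := by rw [hind]; abel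
      rw [this]
      exact XP_X j _ (by omega)
    have hy' : ∏ l ∈ D.erase j, (X (l, p l - 1) : TT K k) ∈ XP K p (c - (c - ind (D.erase j))) := by
      rw [sub_sub_cancel]; exact ytop_mem hp _
    rw [hpr]
    constructor
    · intro hi
      have hV := base_quot (i := i + 1) hp hN IH c hc D j hjD hjm hD (Or.inl (by omega))
      have h1 := IA_iff.1 (hses.Inj_of hV)
      rw [sub_sub, ← hind] at h1
      exact IA.comp hyj h1 (ih1 hi)
    · intro hi
      have hV := base_quot (i := i) hp hN IH c hc D j hjD hjm hD hi
      have h1 := SA_iff.1 (hses.Surj_of hV)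
      rw [sub_sub, ← hind] at h1
      exact SA.comp hy' h1 (ih2 hi)

theorem base_pow (hp : ∀ l, 1 ≤ p l) (hN : ∑ l, (p l - 1) = N)
    (IH : ∀ M, N = M + 1 → BaseSt K k t M)
    (c : Fin k → ℤ) (hc : ∀ l l', l ≠ l' → c l - c l' ≤ (p l' : ℤ) - 1) (u : ℕ) :
    (0 ≤ i → IA t p N i (ff K p N ^ u) (c - fun _ => (u:ℤ)) c) ∧
    ((1 ≤ i ∨ ∃ l, (N:ℤ) * t - ((p l : ℤ) - 1) + u ≤ c l) →
      SA t p N i (ff K p N ^ u) (c - fun _ => (u:ℤ)) c) := by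
  have hy : ff K p N = ∏ l, (X (l, p l - 1) : TT K k) := by rw [← hN]; exact ff_top p hp
  induction u with
  | zero =>
    have : (fun _ => ((0:ℕ):ℤ) : Fin k → ℤ) = 0 := by ext; simp
    rw [this, pow_zero, sub_zero]
    exact ⟨fun _ => IA_one c, fun _ => SA_one c⟩
  | succ u ih =>
    have hc' : ∀ l l', l ≠ l' → (c - (fun _ => (u:ℤ)) : Fin k → ℤ) l - (c - (fun _ => (u:ℤ)) : Fin k → ℤ) l' ≤ (p l' : ℤ) - 1 := by
      intro l l' h
      have := hc l l' h
      simp only [Pi.sub_apply]; linarith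
    have hb := base_D (i := i) hp hN IH (c - fun _ => (u:ℤ)) hc' _ univ rfl (by simp)
    rw [← hy] at hb
    have hind : (c - fun _ => (u:ℤ)) - ind univ = c - fun _ => ((u+1 : ℕ):ℤ) := by
      ext l; simp [ind]; ring
    rw [hind] at hb
    have m1 : ff K p N ∈ XP K p ((c - fun _ => (u:ℤ)) - (c - fun _ => ((u+1 : ℕ):ℤ))) := by
      have : ((c - fun _ => (u:ℤ)) - (c - fun _ => ((u+1 : ℕ):ℤ))) = fun _ => 1 := by
        ext l; simp
      rw [this]; exact ff_mem p N
    have m2 : ff K p N ^ u ∈ XP K p (c - (c - fun _ => (u:ℤ))) := by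
      have := XP_pow (ff_mem (K := K) p N) u
      convert this using 2
      ext l; simp
    rw [pow_succ]
    refine ⟨fun hi => IA.comp m1 (hb.1 hi) (ih.1 hi), fun hi => SA.comp m2 (hb.2 ?_) (ih.2 ?_)⟩
    · rcases hi with hi | ⟨l, hl⟩
      · exact Or.inl hi
      · right; refine ⟨l, ?_⟩
        push_cast at hl
        simp only [Pi.sub_apply]; linarith
    · rcases hi with hi | ⟨l, hl⟩
      · exact Or.inl hi
      · right; refine ⟨l, ?_⟩
        push_cast at hl
        linarith

theorem base (K : Type) [Field K] (k t : ℕ) : ∀ N, BaseSt K k t N := by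
  intro N
  induction N with
  | zero =>
    intro p c i hp hN hc hi
    have hb := fun i => base_pow (K := K) (t := t) (i := i) hp hN (by omega) c hc t
    refine KD.V_cone (IA_iff.2 ?_) (SA_iff.2 ?_)
    · by_cases h : 0 ≤ i - 1
      · exact (hb (i-1)).1 h
      · exact IA_of_neg (by omega)
    · by_cases h : 0 ≤ i
      · refine (hb i).2 ?_
        rcases hi with hi | ⟨l, hl⟩
        · exact Or.inl hi
        · right; refine ⟨l, ?_⟩
          push_cast at hl ⊢; linarith
      · exact SA_of_neg (by omega)
  | succ N ih =>
    intro p c i hp hN hc hi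
    have hb := fun i => base_pow (K := K) (t := t) (i := i) hp hN (fun M hM => by
      have : N = M := by omega
      subst this; exact ih) c hc t
    refine KD.V_cone (IA_iff.2 ?_) (SA_iff.2 ?_)
    · by_cases h : 0 ≤ i - 1
      · exact (hb (i-1)).1 h
      · exact IA_of_neg (by omega)
    · by_cases h : 0 ≤ i
      · refine (hb i).2 ?_
        rcases hi with hi | ⟨l, hl⟩
        · exact Or.inl hi
        · right; refine ⟨l, ?_⟩
          push_cast at hl ⊢; linarith
      · exact SA_of_neg (by omega)

end T
end Kz


/-! ## Part 4: propagation -/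

namespace Kz
section T
variable {K : Type} [Field K] {k : ℕ} {t N : ℕ} {p : Fin k → ℕ}

theorem update_self_succ (l : Fin k) (r : ℕ) : Function.update p l (r+1) l = r + 1 :=
  Function.update_self _ _ _

theorem W_A {l : Fin k} {r : ℕ} {i : ℤ} {c : Fin k → ℤ} 
    (h1 : VT K t N (Function.update p l (r+1)) i c)
    (h2 : VT K t N (Function.update p l (r+1)) (i-1) (c - Pi.single l 1)) :
    VT K t N (Function.update p l r) i c := by
  have := VT_A (update_self_succ l r) h1 h2
  rwa [Function.update_idem] at this

theorem W_B {l : Fin k} {r : ℕ} {i : ℤ} {c : Fin k → ℤ} 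
    (h1 : VT K t N (Function.update p l (r+1)) i (c - Pi.single l 1))
    (h2 : VT K t N (Function.update p l r) i c) : VT K t N (Function.update p l (r+1)) i c := by
  refine VT_B (update_self_succ l r) h1 ?_
  rwa [Function.update_idem]

theorem W_C {l : Fin k} {r : ℕ} {i : ℤ} {c : Fin k → ℤ} 
    (h1 : VT K t N (Function.update p l (r+1)) i c)
    (h2 : VT K t N (Function.update p l r) (i+1) c) :
    VT K t N (Function.update p l (r+1)) i (c - Pi.single l 1) := by
  refine VT_C (update_self_succ l r) h1 ?_
  rwa [Function.update_idem]

theorem W_Astar {l : Fin k} (j : ℕ) : ∀ (r : ℕ) (i : ℤ) (c : Fin k → ℤ),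
    (∀ q : ℕ, q ≤ j → VT K t N (Function.update p l (r + j)) (i - q) (c - (q:ℤ) • Pi.single l 1)) →
    VT K t N (Function.update p l r) i c := by
  induction j with
  | zero => intro r i c h; simpa using h 0 le_rfl
  | succ j ih =>
    intro r i c h
    refine W_A (ih (r+1) i c fun q hq => ?_) (ih (r+1) _ _ fun q hq => ?_)
    · have := h q (by omega)
      rwa [show r + (j+1) = r + 1 + j by omega] at this
    · have := h (q+1) (by omega)
      rw [show r + (j+1) = r + 1 + j by omega] at this
      convert this using 1
      · push_cast; ring
      · push_cast; rw [add_smul, one_smul]; abel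

theorem U_lem {l : Fin k} (i : ℤ) (c : Fin k → ℤ) (h0 : VT K t N (Function.update p l 0) i c)
    (h : ∀ q : ℕ, q < p l → VT K t N p (i - q) (c - ((q:ℤ) + 1) • Pi.single l 1)) :
    VT K t N p i c := by
  have key : ∀ r, r ≤ p l → VT K t N (Function.update p l r) i c := by
    intro r
    induction r with
    | zero => intro _; exact h0
    | succ r ih =>
      intro hr
      refine W_B ?_ (ih (by omega))
      refine W_Astar (p l - (r+1)) (r+1) _ _ fun q hq => ?_
      rw [show r + 1 + (p l - (r+1)) = p l by omega, Function.update_eq_self]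
      have := h q (by omega)
      convert this using 1
      rw [add_smul, one_smul]; abel
  have := key (p l) le_rfl
  rwa [Function.update_eq_self] at this

theorem L_lem {l : Fin k} (i : ℤ) (c : Fin k → ℤ)
    (h0 : VT K t N (Function.update p l 0) (i + p l) (c + (p l : ℤ) • Pi.single l 1))
    (h : ∀ q : ℕ, q < p l → VT K t N p (i + q) (c + ((q:ℤ) + 1) • Pi.single l 1)) :
    VT K t N p i c := by
  have key : ∀ r s : ℕ, r + s = p l →
      VT K t N (Function.update p l r) (i + s) (c + (s:ℤ) • Pi.single l 1) := by
    intro r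
    induction r with
    | zero => intro s hs; rw [zero_add] at hs; subst hs; exact h0
    | succ r ih =>
      intro s hs
      have e : c + (s:ℤ) • Pi.single l 1 = (c + ((s+1 : ℕ):ℤ) • Pi.single l 1) - Pi.single l 1 := by
        push_cast; rw [add_smul, one_smul]; abel
      rw [e]
      refine W_C ?_ ?_
      · refine W_Astar s (r+1) _ _ fun q hq => ?_
        rw [hs, Function.update_eq_self]
        have := h (s - q) (by omega)
        convert this using 1
        · push_cast [Nat.cast_sub hq]; ring
        · push_cast [Nat.cast_sub hq]
          rw [add_sub_assoc, ← sub_smul]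
          congr 2; ring
      · have := ih (s+1) (by omega)
        convert this using 1
        push_cast; ring
  have := key (p l) 0 (by omega)
  rw [Function.update_eq_self] at this
  simpa using this

theorem sum_update_lt {b : Fin k → ℤ} (f : Fin k → ℤ → ℕ) (l : Fin k) (x : ℤ)
    (h : f l x < f l (b l)) :
    ∑ l', f l' (Function.update b l x l') < ∑ l', f l' (b l') := by
  refine Finset.sum_lt_sum (fun l' _ => ?_) ⟨l, mem_univ _, by rwa [Function.update_self]⟩
  by_cases hl : l' = l
  · subst hl; rw [Function.update_self]; exact h.le
  · rw [Function.update_of_ne hl]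

def cc (n t : ℕ) (b : Fin k → ℤ) : Fin k → ℤ := fun l => b l + n * t

theorem cc_sub (n t : ℕ) (b : Fin k → ℤ) (l : Fin k) (x : ℤ) :
    cc n t b - x • Pi.single l 1 = cc n t (Function.update b l (b l - x)) := by
  ext l'
  simp only [cc, Pi.sub_apply, Pi.smul_apply, Pi.single_apply, Function.update_apply]
  split_ifs with h
  · subst h; simp; ring
  · simp

theorem cc_add (n t : ℕ) (b : Fin k → ℤ) (l : Fin k) (x : ℤ) :
    cc n t b + x • Pi.single l 1 = cc n t (Function.update b l (b l + x)) := by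
  have := cc_sub n t b l (-x)
  rwa [neg_smul, sub_neg_eq_add, sub_neg_eq_add] at this

/-- bounds -/
def Bd (p : Fin k → ℕ) (t : ℕ) (b : Fin k → ℤ) : Prop := ∀ l, -(t:ℤ) < b l ∧ b l < t ∧ p l < t

theorem Bd.update {b : Fin k → ℤ} (h : Bd p t b) (l : Fin k) (x : ℤ) (h1 : -(t:ℤ) < x)
    (h2 : x < t) : Bd p t (Function.update b l x) := by
  intro l'
  by_cases hl : l' = l
  · subst hl; rw [Function.update_self]; exact ⟨h1, h2, (h l').2.2⟩
  · rw [Function.update_of_ne hl]; exact h l'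

theorem mul_bd (x z : ℤ) (t : ℕ) (h1 : -(t:ℤ) < x) (h2 : x < t) (hx : x ≠ 0 ∨ z ≠ 0) :
    x + z * t ≠ 0 := by
  intro h0
  have ht : (0:ℤ) < t := by omega
  rcases lt_trichotomy z 0 with hz | hz | hz
  · have : z * t ≤ (-1) * t := mul_le_mul_of_nonneg_right (by omega) ht.le
    omega
  · subst hz; simp at hx h0; exact hx h0
  · have : 1 * (t:ℤ) ≤ z * t := mul_le_mul_of_nonneg_right (by omega) ht.le
    omega

theorem W0_empty {q : Fin k → ℕ} {b : Fin k → ℤ} {n : ℕ} {j : ℤ} (l : Fin k) (hq : q l = 0)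
    (h1 : -(t:ℤ) < b l) (h2 : b l < t) (h : b l ≠ 0 ∨ j ≠ n) : VT K t N q j (cc n t b) := by
  refine VT_empty_zero l hq ?_
  have := mul_bd (b l) (n - j) t h1 h2 (by rcases h with h | h; exact Or.inl h; right; omega)
  rw [cc]
  intro h0; apply this; linarith

theorem neg_empty {q : Fin k → ℕ} {b : Fin k → ℤ} {n : ℕ} (l : Fin k) 
    (h : b l < 0) : VT K t N q n (cc n t b) := by
  refine VT_empty_neg l ?_
  rw [cc]; linarith

variable {m : ℕ}

theorem Z_lem (hp : ∀ l, 1 ≤ p l) (hm : ∑ l, (p l - 1) = m) (l0 : Fin k) : ∀ (s : ℕ)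
    (b : Fin k → ℤ) (j : ℤ), ∑ l, (2 * b l + p l + 1).natAbs = s → Bd p t b →
    -(p l0 : ℤ) < b l0 → b l0 < 0 → VT K t (m+1) p j (cc (m+1) t b) := by
  intro s
  induction s using Nat.strong_induction_on with
  | _ s ih =>
  intro b j hs hb h1 h2
  have step : ∀ l, l ≠ l0 → ∀ x : ℤ, (2 * x + p l + 1).natAbs < (2 * b l + p l + 1).natAbs →
      -(t:ℤ) < x → x < t → ∀ j', VT K t (m+1) p j' (cc (m+1) t (Function.update b l x)) := by
    intro l hl x hx hx1 hx2 j'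
    refine ih _ ?_ _ j' rfl (hb.update l x hx1 hx2) ?_ ?_
    · rw [← hs]; exact sum_update_lt (fun l x => (2 * x + p l + 1).natAbs) l x hx
    · rwa [Function.update_of_ne (Ne.symm hl)]
    · rwa [Function.update_of_ne (Ne.symm hl)]
  by_cases hU : ∃ l, 0 ≤ b l
  · obtain ⟨l, hl⟩ := hU
    have hll : l ≠ l0 := by rintro rfl; omega
    have hbl := hb l
    have hpl := hp l
    refine U_lem (l := l) j _ ?_ ?_
    · by_cases hj : j = ((m+1 : ℕ):ℤ)
      · rw [hj]; exact neg_empty l0 h2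
      · exact W0_empty l (Function.update_self _ _ _) hbl.1 hbl.2.1 (Or.inr hj)
    · intro q hq
      rw [cc_sub]
      exact step l hll _ (by omega) (by omega) (by omega) _
  by_cases hL : ∃ l, b l < -(p l : ℤ)
  · obtain ⟨l, hl⟩ := hL
    have hll : l ≠ l0 := by rintro rfl; omega
    have hbl := hb l
    have hpl := hp l
    refine L_lem (l := l) j _ ?_ ?_
    · rw [cc_add]
      refine W0_empty l (Function.update_self _ _ _) ?_ ?_ (Or.inl ?_) <;>
      rw [Function.update_self] <;> omega
    · intro q hq
      rw [cc_add]
      exact step l hll _ (by omega) (by omega) (by omega) _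
  push Not at hU hL
  refine base K k t m p _ j hp hm ?_ (Or.inr ⟨l0, ?_⟩)
  · intro l l' _
    have := hU l
    have := hL l'
    simp only [cc]; omega
  · simp only [cc]; push_cast; linarith

/-- the index -/
def II (p : Fin k → ℕ) (b : Fin k → ℤ) : ℤ := ∑ l, if b l ≤ -(p l : ℤ) then ((p l : ℤ) - 1) else 0

theorem II_update (b : Fin k → ℤ) (l : Fin k) (x : ℤ) :
    II p (Function.update b l x) = II p b - (if b l ≤ -(p l : ℤ) then ((p l : ℤ) - 1) else 0) +
      (if x ≤ -(p l : ℤ) then ((p l : ℤ) - 1) else 0) := by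
  rw [II, II, ← Finset.add_sum_erase _ _ (mem_univ l), ← Finset.add_sum_erase univ
    (fun l => if b l ≤ -(p l : ℤ) then ((p l : ℤ) - 1) else 0) (mem_univ l)]
  rw [Function.update_self]
  have : ∑ x_1 ∈ univ.erase l, (if Function.update b l x x_1 ≤ -(p x_1 : ℤ) then ((p x_1 : ℤ) - 1) else 0)
     = ∑ x ∈ univ.erase l, if b x ≤ -(p x : ℤ) then ((p x : ℤ) - 1) else 0 := by
    refine sum_congr rfl fun y hy => ?_
    rw [Function.update_of_ne (ne_of_mem_erase hy)]
  rw [this]; ring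

theorem II_nonneg (hp : ∀ l, 1 ≤ p l) (b : Fin k → ℤ) : 0 ≤ II p b := by
  refine sum_nonneg fun l _ => ?_
  have := hp l
  split_ifs <;> omega

theorem mid_lem (hp : ∀ l, 1 ≤ p l) (hm : ∑ l, (p l - 1) = m) (l0 : Fin k) 
    (b : Fin k → ℤ) (j : ℤ) (hb : Bd p t b)
    (h1 : -(p l0 : ℤ) < b l0) (h2 : b l0 < 0) : VT K t (m+1) p j (cc (m+1) t b) :=
  Z_lem hp hm l0 _ b j rfl hb h1 h2

theorem sum_cast (hp : ∀ l, 1 ≤ p l) (hm : ∑ l, (p l - 1) = m) : ∑ l, ((p l : ℤ) - 1) = m := by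
  rw [← hm]; push_cast
  refine sum_congr rfl fun l _ => ?_
  rw [Nat.cast_sub (hp l)]; simp

theorem Up_lem (hp : ∀ l, 1 ≤ p l) (hm : ∑ l, (p l - 1) = m) : ∀ (s : ℕ)
    (b : Fin k → ℤ) (j : ℤ), ∑ l, (b l + t).natAbs = s → Bd p t b →
    j < m - II p b → VT K t (m+1) p j (cc (m+1) t b) := by
  intro s
  induction s using Nat.strong_induction_on with
  | _ s ih =>
  intro b j hs hb hj
  by_cases hmid : ∃ l, -(p l : ℤ) < b l ∧ b l < 0
  · obtain ⟨l, h1, h2⟩ := hmid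
    exact mid_lem hp hm l b j hb h1 h2
  by_cases hU : ∃ l, 0 ≤ b l
  · obtain ⟨l, hl⟩ := hU
    have hbl := hb l
    have hpl := hp l
    have hI := II_nonneg hp b
    refine U_lem (l := l) j _ ?_ ?_
    · exact W0_empty l (Function.update_self _ _ _) hbl.1 hbl.2.1 (Or.inr (by push_cast; omega))
    · intro q hq
      rw [cc_sub]
      by_cases hmid2 : -(p l : ℤ) < b l - (q + 1) ∧ b l - (q+1) < 0
      · refine mid_lem hp hm l _ _ (hb.update l _ (by omega) (by omega)) ?_ ?_
        · rw [Function.update_self]; exact hmid2.1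
        · rw [Function.update_self]; exact hmid2.2
      · refine ih _ ?_ _ _ rfl (hb.update l _ (by omega) (by omega)) ?_
        · rw [← hs]; exact sum_update_lt (fun l x => (x + t).natAbs) l _ (by omega)
        · rw [II_update]
          split_ifs <;> omega
  · refine (DT K t p).V_neg ?_
    have : II p b = m := by
      rw [← sum_cast hp hm]
      refine sum_congr rfl fun l _ => ?_
      rw [if_pos]
      push Not at hU hmid
      by_contra hc
      have := hmid l (by omega)
      have := hU l
      omega
    omega

theorem ff0_ne (hp : ∀ l, 1 ≤ p l) : ff K p 0 ≠ 0 := by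
  rw [ff_zero p hp]
  exact prod_ne_zero_iff.2 fun l _ => X_ne_zero _

theorem V_top (hp : ∀ l, 1 ≤ p l) (N : ℕ) : ∀ (j : ℤ) (c : Fin k → ℤ), (N:ℤ) + 1 ≤ j →
    VT K t (N+1) p j c := by
  induction N with
  | zero =>
    intro j c hj ω hω h0
    obtain ⟨a, b, rfl⟩ := kmk_surj ω
    rw [KD.P, mem_kP_succ] at hω
    have ha := kP_gt _ _ _ _ _ (by push_cast at *; omega) a hω.1
    subst ha
    rw [KD.d, kd_succ, mk_eq_zero] at h0
    obtain ⟨b, rfl⟩ := kz_surj b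
    have hb := h0.1
    rw [map_zero, zero_add, kmap_zero', kz_eq_zero] at hb
    have hb0 : b = 0 := by
      rcases mul_eq_zero.1 (show ff K p 0 ^ t * b = 0 from hb) with h | h
      · exact absurd h (pow_ne_zero t (ff0_ne hp))
      · exact h
    subst hb0
    refine ⟨0, zero_mem _, ?_⟩
    rw [map_zero, eq_comm, mk_eq_zero, kz_eq_zero]
    exact ⟨rfl, rfl⟩
  | succ N ih =>
    intro j c hj
    push_cast at hj
    exact KD.V_succ (ih j c (by omega)) (ih _ _ (by omega))

theorem Lo_lem (hp : ∀ l, 1 ≤ p l) (hm : ∑ l, (p l - 1) = m) : ∀ (s : ℕ)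
    (b : Fin k → ℤ) (j : ℤ), ∑ l, (t - b l).natAbs = s → Bd p t b →
    m - II p b < j → VT K t (m+1) p j (cc (m+1) t b) := by
  intro s
  induction s using Nat.strong_induction_on with
  | _ s ih =>
  intro b j hs hb hj
  by_cases hmid : ∃ l, -(p l : ℤ) < b l ∧ b l < 0
  · obtain ⟨l, h1, h2⟩ := hmid
    exact mid_lem hp hm l b j hb h1 h2
  by_cases hU : ∃ l, b l ≤ - (p l : ℤ)
  · obtain ⟨l, hl⟩ := hU
    have hbl := hb l
    have hpl := hp l
    refine L_lem (l := l) j _ ?_ ?_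
    · rw [cc_add]
      by_cases hc : b l + p l ≠ 0 ∨ j + p l ≠ ((m+1 : ℕ) : ℤ)
      · refine W0_empty l (Function.update_self _ _ _) ?_ ?_ ?_ <;>
        rw [Function.update_self]
        · omega
        · omega
        · exact hc
      · push Not at hc
        have : ∃ l', l' ≠ l ∧ b l' ≤ -(p l' : ℤ) := by
          by_contra hno
          push Not at hno
          have : II p b = p l - 1 := by
            rw [II, sum_eq_single l, if_pos hl]
            · intro l' _ hl'
              rw [if_neg (by have := hno l' hl'; omega)]
            · simp
          have := hc.2
          push_cast at this
          omega
        obtain ⟨l', hl', hb'⟩ := this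
        rw [hc.2]
        refine neg_empty l' ?_
        rw [Function.update_of_ne hl']
        have := hp l'; omega
    · intro q hq
      rw [cc_add]
      by_cases hmid2 : -(p l : ℤ) < b l + (q + 1) ∧ b l + (q+1) < 0
      · refine mid_lem hp hm l _ _ (hb.update l _ (by omega) (by omega)) ?_ ?_
        · rw [Function.update_self]; exact hmid2.1
        · rw [Function.update_self]; exact hmid2.2
      · refine ih _ ?_ _ _ rfl (hb.update l _ (by omega) (by omega)) ?_
        · rw [← hs]; exact sum_update_lt (fun l x => (t - x).natAbs) l _ (by omega)
        · rw [II_update]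
          split_ifs <;> omega
  · refine V_top hp m _ _ ?_
    have : II p b = 0 := by
      refine sum_eq_zero fun l _ => ?_
      rw [if_neg]
      push Not at hU
      have := hU l; omega
    omega

/-- main vanishing result on the multigraded side -/
theorem VT_main (hp : ∀ l, 1 ≤ p l) (hm : ∑ l, (p l - 1) = m) (b : Fin k → ℤ) (j : ℤ)
    (hb : Bd p t b) (h : j ≠ m - II p b) : VT K t (m+1) p j (cc (m+1) t b) := by
  rcases lt_or_gt_of_ne h with h | h
  · exact Up_lem hp hm _ b j rfl hb h
  · exact Lo_lem hp hm _ b j rfl hb h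

end T
end Kz

namespace Kz
section p5
variable {K : Type} [Field K] {n : ℕ}

theorem mem_hz {q : PolyS K n} {v : ℤ} :
    q ∈ homogZ K n v ↔ ∀ μ, coeff μ q ≠ 0 → ((μ.degree : ℕ) : ℤ) = v := by
  unfold homogZ
  by_cases h : 0 ≤ v
  · simp only [h, iSup_pos, mem_homogeneousSubmodule, IsHomogeneous, IsWeightedHomogeneous]
    refine forall_congr' fun μ => imp_congr_right fun _ => ?_
    rw [Finsupp.degree_eq_weight_one]
    simp only [Pi.one_def] at *
    constructor <;> intro h' <;> omega
  · simp only [h, iSup_false, Submodule.mem_bot]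
    constructor
    · rintro rfl; simp
    · intro h'
      ext μ
      rw [coeff_zero]
      by_contra hc
      have := h' μ hc
      omega

theorem mem_fp {r : ℕ} {dg : Fin r → ℤ} {u : ℤ} {v : Fin r → PolyS K n} :
    v ∈ freePiece dg u ↔ ∀ p, v p ∈ homogZ K n (u - dg p) := by
  simp [freePiece, Submodule.mem_pi]

theorem hz_mul {q q' : PolyS K n} {v v' : ℤ} (h : q ∈ homogZ K n v) (h' : q' ∈ homogZ K n v') :
    q * q' ∈ homogZ K n (v + v') := by
  rw [mem_hz] at *
  intro μ hμ
  classical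
  rw [coeff_mul] at hμ
  obtain ⟨x, hx, hne⟩ := Finset.exists_ne_zero_of_sum_ne_zero hμ
  have h1 := h x.1 (left_ne_zero_of_mul hne)
  have h2 := h' x.2 (right_ne_zero_of_mul hne)
  rw [← HasAntidiagonal.mem_antidiagonal.1 hx, ← h1, ← h2, map_add]; push_cast; rfl

theorem hz_monomial (μ : Fin n →₀ ℕ) (a : K) {v : ℤ} (h : ((μ.degree : ℕ) : ℤ) = v) :
    monomial μ a ∈ homogZ K n v := by
  rw [mem_hz]
  intro ν hν
  rw [coeff_monomial] at hν
  split_ifs at hν with h1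
  · rw [← h1]; exact h
  · exact absurd rfl hν

theorem hz_X (s : Fin n) : (X s : PolyS K n) ∈ homogZ K n 1 :=
  hz_monomial _ _ (by simp)

theorem hz_one : (1 : PolyS K n) ∈ homogZ K n 0 := hz_monomial _ _ (by simp)

theorem hz_pow {q : PolyS K n} {v : ℤ} (h : q ∈ homogZ K n v) (t : ℕ) :
    q ^ t ∈ homogZ K n (t * v) := by
  induction t with
  | zero => simpa using hz_one
  | succ t ih =>
    rw [pow_succ]
    have := hz_mul ih h
    convert this using 2; push_cast; ring

def xs (K : Type) [Field K] (n : ℕ) (s : ℕ) : PolyS K n := if h : s < n then X ⟨s, h⟩ else 0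

theorem xs_mem (s : ℕ) : xs K n s ∈ homogZ K n 1 := by
  unfold xs
  split_ifs
  · exact hz_X _
  · exact zero_mem _

theorem xs_pow_mem (s t : ℕ) : xs K n s ^ t ∈ homogZ K n t := by
  simpa using hz_pow (xs_mem (K := K) (n := n) s) t

theorem xs_pow_eq {s : ℕ} (h : s < n) (t : ℕ) :
    xs K n s ^ t = monomial (Finsupp.single ⟨s, h⟩ t) 1 := by
  rw [xs, dif_pos h, X_pow_eq_monomial]

theorem hz_smul_vec {r : ℕ} {dg : Fin r → ℤ} {u w : ℤ} {v : Fin r → PolyS K n} {q : PolyS K n}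
    (hq : q ∈ homogZ K n w) (h : v ∈ freePiece dg u) : q • v ∈ freePiece dg (w + u) := by
  rw [mem_fp] at *
  intro p
  have := hz_mul hq (h p)
  rw [Pi.smul_apply, smul_eq_mul]
  convert this using 2; ring

/-- the Koszul datum of a homogeneous submodule -/
def KZ {r : ℕ} (dg : Fin r → ℤ) (Z : Submodule (PolyS K n) (Fin r → PolyS K n)) (t : ℕ) :
    KD ℤ (t : ℤ) where
  A := Fin r → PolyS K n
  g := fun s => DistribSMul.toAddMonoidHom _ (xs K n s ^ t)
  X := fun u => ((freePiece dg u) ⊓ (Z.restrictScalars K)).toAddSubgroup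
  comm := fun s s' a => by
    show xs K n s ^ t • xs K n s' ^ t • a = xs K n s' ^ t • xs K n s ^ t • a
    rw [smul_comm]
  shift := fun s c a ha => by
    refine ⟨?_, Z.smul_mem _ ha.2⟩
    have := hz_smul_vec (xs_pow_mem s t) ha.1
    rwa [add_sub_cancel] at this

theorem KZ_mem {r : ℕ} {dg : Fin r → ℤ} {Z : Submodule (PolyS K n) (Fin r → PolyS K n)} {t : ℕ}
    {u : ℤ} {v : Fin r → PolyS K n} :
    v ∈ (KZ dg Z t).X u ↔ v ∈ freePiece dg u ∧ v ∈ Z := Iff.rfl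

theorem div_lem (t : ℕ) : ∀ (N : ℕ) (_ : N ≤ n) (q : PolyS K n) (v : ℤ), q ∈ homogZ K n v →
    (∀ μ, coeff μ q ≠ 0 → ∃ s : Fin n, s.1 < N ∧ t ≤ μ s) →
    ∃ Q : ℕ → PolyS K n, (∀ s, Q s ∈ homogZ K n (v - t)) ∧
      q = ∑ s ∈ range N, xs K n s ^ t * Q s
  | 0, _, q, v, _, h => by
    refine ⟨0, fun _ => zero_mem _, ?_⟩
    ext μ
    by_contra hc
    obtain ⟨s, hs, _⟩ := h μ (by simpa using hc)
    omega
  | N + 1, hN, q, v, hq, h => by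
    have hN' : N < n := hN
    set e : Fin n →₀ ℕ := Finsupp.single ⟨N, hN'⟩ t with he
    have hle : ∀ μ : Fin n →₀ ℕ, e ≤ μ ↔ t ≤ μ ⟨N, hN'⟩ := by
      intro μ; rw [he, Finsupp.single_le_iff]
    rw [mem_hz] at hq
    obtain ⟨Q, hQ, hs⟩ := div_lem t N (by omega) (q.modMonomial e) v (by
      rw [mem_hz]
      intro μ hμ
      by_cases hc : e ≤ μ
      · exact absurd (coeff_modMonomial_of_le _ hc) hμ
      · rw [coeff_modMonomial_of_not_le _ hc] at hμ
        exact hq μ hμ) (by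
      intro μ hμ
      by_cases hc : e ≤ μ
      · exact absurd (coeff_modMonomial_of_le _ hc) hμ
      · rw [coeff_modMonomial_of_not_le _ hc] at hμ
        obtain ⟨s, hs, hs'⟩ := h μ hμ
        refine ⟨s, ?_, hs'⟩
        rw [hle] at hc
        by_contra h1
        have : s = ⟨N, hN'⟩ := Fin.ext (by simp; omega)
        rw [this] at hs'; omega)
    refine ⟨Function.update Q N (q.divMonomial e), ?_, ?_⟩
    · intro s
      by_cases hs : s = N
      · subst hs
        rw [Function.update_self, mem_hz]
        intro μ hμ
        rw [coeff_divMonomial] at hμ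
        have := hq _ hμ
        rw [map_add, he, Finsupp.degree_single] at this
        push_cast at this
        omega
      · rw [Function.update_of_ne hs]; exact hQ s
    · rw [sum_range_succ, Function.update_self, xs_pow_eq hN']
      have : ∑ s ∈ range N, xs K n s ^ t * Function.update Q N (q.divMonomial e) s
        = ∑ s ∈ range N, xs K n s ^ t * Q s := by
        refine sum_congr rfl fun s hs => ?_
        rw [Function.update_of_ne (by simp at hs; omega)]
      rw [this, ← hs, add_comm, divMonomial_add_modMonomial]

theorem div_conv {t N : ℕ} (hN : N ≤ n) {q : PolyS K n} {Q : ℕ → PolyS K n}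
    (h : q = ∑ s ∈ range N, xs K n s ^ t * Q s) (μ : Fin n →₀ ℕ) (hμ : coeff μ q ≠ 0) :
    ∃ s : Fin n, s.1 < N ∧ t ≤ μ s := by
  rw [h, coeff_sum] at hμ
  obtain ⟨s, hs, hne⟩ := Finset.exists_ne_zero_of_sum_ne_zero hμ
  have hs' : s < n := by simp at hs; omega
  refine ⟨⟨s, hs'⟩, by simpa using hs, ?_⟩
  rw [xs_pow_eq hs', coeff_monomial_mul'] at hne
  split_ifs at hne with h1
  · rwa [Finsupp.single_le_iff] at h1
  · exact absurd rfl hne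

theorem div_vec {r : ℕ} {dg : Fin r → ℤ} (t : ℕ) (N : ℕ) (hN : N ≤ n) (q : Fin r → PolyS K n)
    (u : ℤ) (hq : q ∈ freePiece dg u)
    (h : ∀ p μ, coeff μ (q p) ≠ 0 → ∃ s : Fin n, s.1 < N ∧ t ≤ μ s) :
    ∃ Q : ℕ → Fin r → PolyS K n, (∀ s, Q s ∈ freePiece dg (u - t)) ∧
      q = ∑ s ∈ range N, xs K n s ^ t • Q s := by
  rw [mem_fp] at hq
  choose Q hQ hs using fun p => div_lem t N hN (q p) (u - dg p) (hq p) (h p)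
  refine ⟨fun s p => Q p s, fun s => ?_, ?_⟩
  · rw [mem_fp]; intro p
    convert hQ p s using 2; ring
  · ext1 p
    rw [hs p, Finset.sum_apply]
    rfl

/-- the Koszul datum of a free module -/
abbrev KF (K : Type) [Field K] (n : ℕ) {r : ℕ} (dg : Fin r → ℤ) (t : ℕ) : KD ℤ (t : ℤ) :=
  KZ (K := K) (n := n) dg ⊤ t

theorem free_Inj {r : ℕ} (dg : Fin r → ℤ) (t N : ℕ) (hN : N < n) (c : ℤ) :
    KD.Inj ((KF K n dg t).sh t) (KF K n dg t) ((KF K n dg t).g N) N 0 c := by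
  rintro a ha - ⟨η, hη, h⟩
  rw [KD.sh_P] at ha
  obtain ⟨q, hq, rfl⟩ := eq_inc _ _ _ _ _ ha
  rw [kmap_inc, zero_add] at *
  obtain ⟨Q, hQ, hs⟩ := KD.exists_of_d_eq_inc N c η _ hη h
  change Fin r → PolyS K n at q
  change ℕ → Fin r → PolyS K n at Q
  replace hs : xs K n N ^ t • q = ∑ s ∈ range N, xs K n s ^ t • Q s := hs
  obtain ⟨Q', hQ', hs'⟩ := div_vec (dg := dg) t N hN.le q (c - t) hq.1 (by
    intro p μ hμ
    have h1 : xs K n N ^ t * q p = ∑ s ∈ range N, xs K n s ^ t * Q s p := by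
      have := congrFun hs p
      rwa [Finset.sum_apply] at this
    obtain ⟨s, hs1, hs2⟩ := div_conv hN.le h1 (Finsupp.single ⟨N, hN⟩ t + μ) (by
      rw [xs_pow_eq hN, coeff_monomial_mul, one_mul]; exact hμ)
    refine ⟨s, hs1, ?_⟩
    rw [Finsupp.add_apply, Finsupp.single_eq_of_ne (by
      intro h; rw [h] at hs1; simp at hs1)] at hs2
    simpa using hs2)
  obtain ⟨ζ, hζ, h⟩ := KD.exists_d_eq_inc (D := (KF K n dg t).sh t) N c Q'
    (fun s => ⟨by simpa using hQ' s, trivial⟩)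
  exact ⟨ζ, hζ, h.trans (congrArg _ hs'.symm)⟩

/-- Koszul acyclicity of free modules -/
theorem free_V {r : ℕ} (dg : Fin r → ℤ) (t : ℕ) : ∀ (N : ℕ) (_ : N ≤ n) (j c : ℤ) (_ : 1 ≤ j),
    (KF K n dg t).V N j c
  | 0, _, j, c, hj => KD.V_gt _ (by push_cast; omega)
  | N + 1, hN, j, c, hj => by
    refine KD.V_cone ?_ (KD.Surj_of_V (free_V dg t N (by omega) j c hj))
    by_cases h1 : j = 1
    · subst h1
      rw [sub_self]
      exact free_Inj dg t N hN c
    · exact KD.Inj_of_V ((KD.sh_V _ _ _ _ _).2 (free_V dg t N (by omega) _ _ (by omega)))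

end p5
end Kz

namespace Kz
section p6
variable {K : Type} [Field K] {n : ℕ}

/-- homogeneous component of integer degree -/
def zc (z : ℤ) (q : PolyS K n) : PolyS K n :=
  if 0 ≤ z then homogeneousComponent z.toNat q else 0

theorem coeff_zc (z : ℤ) (q : PolyS K n) (μ : Fin n →₀ ℕ) :
    coeff μ (zc z q) = if ((μ.degree : ℕ) : ℤ) = z then coeff μ q else 0 := by
  unfold zc
  by_cases h : 0 ≤ z
  · rw [if_pos h, coeff_homogeneousComponent]
    refine if_congr ?_ rfl rfl
    omega
  · rw [if_neg h, coeff_zero, if_neg]; omega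

theorem zc_mem (z : ℤ) (q : PolyS K n) : zc z q ∈ homogZ K n z := by
  rw [mem_hz]
  intro μ hμ
  rw [coeff_zc] at hμ
  by_contra h
  rw [if_neg h] at hμ
  exact hμ rfl

theorem zc_add (z : ℤ) (q q' : PolyS K n) : zc z (q + q') = zc z q + zc z q' := by
  ext μ; simp only [coeff_zc, coeff_add]; split_ifs <;> simp

theorem zc_zero (z : ℤ) : zc z (0 : PolyS K n) = 0 := by
  ext μ; simp [coeff_zc]

theorem zc_sum {ι : Type} (s : Finset ι) (z : ℤ) (f : ι → PolyS K n) :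
    zc z (∑ i ∈ s, f i) = ∑ i ∈ s, zc z (f i) := by
  classical
  induction s using Finset.induction_on with
  | empty => simp [zc_zero]
  | insert a s ha ih => rw [sum_insert ha, sum_insert ha, zc_add, ih]

theorem zc_mul {w z z' : ℤ} {a : PolyS K n} (ha : a ∈ homogZ K n w) (q : PolyS K n)
    (h : z' = z + w) : zc z' (a * q) = a * zc z q := by
  classical
  subst h
  rw [mem_hz] at ha
  ext μ
  rw [coeff_zc, coeff_mul, coeff_mul]
  by_cases h : ((μ.degree : ℕ) : ℤ) = z + w
  · rw [if_pos h]
    refine sum_congr rfl fun x hx => ?_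
    rw [coeff_zc]
    by_cases hc : coeff x.1 a = 0
    · rw [hc, zero_mul, zero_mul]
    · have := ha _ hc
      rw [← HasAntidiagonal.mem_antidiagonal.1 hx, map_add] at h
      push_cast at h
      rw [if_pos (by omega)]
  · rw [if_neg h, eq_comm]
    refine sum_eq_zero fun x hx => ?_
    rw [coeff_zc]
    by_cases hc : coeff x.1 a = 0
    · rw [hc, zero_mul]
    · have := ha _ hc
      rw [← HasAntidiagonal.mem_antidiagonal.1 hx, map_add] at h
      push_cast at h
      rw [if_neg (by omega), mul_zero]

theorem zc_of_mem {z : ℤ} {q : PolyS K n} (h : q ∈ homogZ K n z) : zc z q = q := by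
  rw [mem_hz] at h
  ext μ
  rw [coeff_zc]
  split_ifs with h1
  · rfl
  · by_contra hc; exact h1 (h μ (Ne.symm hc))

/-- homogeneous component of a vector -/
def hc {r : ℕ} (dg : Fin r → ℤ) (u : ℤ) (v : Fin r → PolyS K n) : Fin r → PolyS K n :=
  fun p => zc (u - dg p) (v p)

theorem hc_mem {r : ℕ} (dg : Fin r → ℤ) (u : ℤ) (v : Fin r → PolyS K n) :
    hc dg u v ∈ freePiece dg u := by
  rw [mem_fp]; exact fun p => zc_mem _ _

theorem hc_of_mem {r : ℕ} {dg : Fin r → ℤ} {u : ℤ} {v : Fin r → PolyS K n}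
    (h : v ∈ freePiece dg u) : hc dg u v = v := by
  rw [mem_fp] at h; ext1 p; exact zc_of_mem (h p)

def degs {r : ℕ} (dg : Fin r → ℤ) (v : Fin r → PolyS K n) : Finset ℤ :=
  univ.biUnion fun p => (v p).support.image fun μ => ((μ.degree : ℕ) : ℤ) + dg p

theorem sum_hc {r : ℕ} (dg : Fin r → ℤ) (v : Fin r → PolyS K n) :
    ∑ u ∈ degs dg v, hc dg u v = v := by
  ext p μ
  rw [Finset.sum_apply, coeff_sum]
  simp only [hc, coeff_zc]
  by_cases h : coeff μ (v p) = 0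
  · rw [h]; simp
  · rw [Finset.sum_eq_single (((μ.degree : ℕ) : ℤ) + dg p)]
    · rw [if_pos (by ring)]
    · intro b _ hb
      rw [if_neg (by omega)]
    · intro hn
      refine absurd ?_ hn
      simp only [degs, mem_biUnion, Finset.mem_univ, true_and, Finset.mem_image]
      exact ⟨p, μ, by simpa using h, rfl⟩

def IsH {r : ℕ} (dg : Fin r → ℤ) (Z : Submodule (PolyS K n) (Fin r → PolyS K n)) : Prop :=
  ∀ v ∈ Z, ∀ u, hc dg u v ∈ Z

def IsHM {r r' : ℕ} (dg : Fin r → ℤ) (dg' : Fin r' → ℤ)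
    (D : Matrix (Fin r) (Fin r') (PolyS K n)) : Prop :=
  ∀ p q, D p q ∈ homogZ K n (dg' q - dg p)

theorem mulVec_hc {r r' : ℕ} {dg : Fin r → ℤ} {dg' : Fin r' → ℤ}
    {D : Matrix (Fin r) (Fin r') (PolyS K n)} (hD : IsHM dg dg' D) (u : ℤ)
    (v : Fin r' → PolyS K n) : D.mulVec (hc dg' u v) = hc dg u (D.mulVec v) := by
  ext1 p
  simp only [Matrix.mulVec, dotProduct, hc]
  rw [zc_sum]
  refine sum_congr rfl fun q _ => ?_
  exact (zc_mul (hD p q) _ (by ring)).symm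

theorem ker_IsH {r r' : ℕ} {dg : Fin r → ℤ} {dg' : Fin r' → ℤ}
    {D : Matrix (Fin r) (Fin r') (PolyS K n)} (hD : IsHM dg dg' D) :
    IsH dg' (LinearMap.ker D.mulVecLin) := by
  intro v hv u
  rw [LinearMap.mem_ker, Matrix.mulVecLin_apply] at *
  rw [mulVec_hc hD, hv]
  ext1 p; exact zc_zero _

theorem mulVec_mem {r r' : ℕ} {dg : Fin r → ℤ} {dg' : Fin r' → ℤ}
    {D : Matrix (Fin r) (Fin r') (PolyS K n)} (hD : IsHM dg dg' D) {u : ℤ}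
    {v : Fin r' → PolyS K n} (hv : v ∈ freePiece dg' u) : D.mulVec v ∈ freePiece dg u := by
  rw [← hc_of_mem hv, mulVec_hc hD]
  exact hc_mem _ _ _

def HasCols {r : ℕ} (dg : Fin r → ℤ) (Z : Submodule (PolyS K n) (Fin r → PolyS K n)) (r' : ℕ) :
    Prop := ∃ (dg' : Fin r' → ℤ) (c : Fin r' → Fin r → PolyS K n),
    (∀ q, c q ∈ freePiece dg (dg' q)) ∧ Submodule.span (PolyS K n) (Set.range c) = Z

theorem exists_cols {r : ℕ} (dg : Fin r → ℤ) (Z : Submodule (PolyS K n) (Fin r → PolyS K n))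
    (hZ : IsH dg Z) : ∃ r', HasCols dg Z r' := by
  set C : Set (Fin r → PolyS K n) := {w | w ∈ Z ∧ ∃ u, w ∈ freePiece dg u} with hC
  have hsp : Submodule.span (PolyS K n) C = Z := by
    apply le_antisymm
    · rw [Submodule.span_le]; exact fun w hw => hw.1
    · intro v hv
      rw [← sum_hc dg v]
      exact sum_mem fun u _ => Submodule.subset_span ⟨hZ v hv u, u, hc_mem _ _ _⟩
  have hfg : (Submodule.span (PolyS K n) C).FG := by
    exact IsNoetherian.noetherian _
  obtain ⟨F, hF, hF2⟩ := (Submodule.fg_span_iff_fg_span_finset_subset C).1 hfg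
  have hF' : ∀ x : F, ∃ u, x.1 ∈ freePiece dg u := fun x => (hF x.2).2
  choose dgF hdg using hF'
  refine ⟨F.card, fun q => dgF (F.equivFin.symm q), fun q => (F.equivFin.symm q).1,
    fun q => hdg _, ?_⟩
  rw [← hsp, hF2]
  congr 1
  ext x
  constructor
  · rintro ⟨q, rfl⟩; exact (F.equivFin.symm q).2
  · intro hx; exact ⟨F.equivFin ⟨x, hx⟩, by simp⟩

/-- the step lemma -/
theorem exists_step {r : ℕ} (dg : Fin r → ℤ) (Z : Submodule (PolyS K n) (Fin r → PolyS K n))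
    (hZ : IsH dg Z) : ∃ (r' : ℕ) (dg' : Fin r' → ℤ) (D : Matrix (Fin r) (Fin r') (PolyS K n)),
    IsHM dg dg' D ∧ LinearMap.range D.mulVecLin = Z ∧
    ∀ u, ∀ v ∈ freePiece dg' u, D.mulVec v = 0 → ∀ q, coeff 0 (v q) = 0 := by
  classical
  obtain ⟨r', ⟨dg', c, hc, hsp⟩, hmin⟩ : ∃ r', HasCols dg Z r' ∧ ∀ s, HasCols dg Z s → r' ≤ s :=
    ⟨Nat.find (exists_cols dg Z hZ), Nat.find_spec (exists_cols dg Z hZ),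
      fun s hs => Nat.find_min' _ hs⟩
  have hmul : ∀ v : Fin r' → PolyS K n, (Matrix.of fun p q => c q p).mulVec v
      = ∑ q, v q • c q := by
    intro v
    ext1 p
    simp [Matrix.mulVec, dotProduct, Finset.sum_apply, mul_comm]
  refine ⟨r', dg', Matrix.of fun p q => c q p, fun p q => mem_fp.1 (hc q) p, ?_, ?_⟩
  · rw [Matrix.range_mulVecLin, ← hsp]; rfl
  · intro u v hv h0 q0
    by_contra hne
    rw [hmul] at h0
    have hu : v q0 = C (coeff 0 (v q0)) := by
      have h1 := mem_hz.1 (mem_fp.1 hv q0)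
      have h2 := h1 0 hne
      ext μ
      rw [coeff_C]
      split_ifs with h3
      · rw [h3]
      · by_contra hc
        have := h1 μ hc
        rw [← h2, map_zero, Nat.cast_inj, Finsupp.degree_eq_zero_iff] at this
        exact h3 this.symm
    have hmem : c q0 ∈ Submodule.span (PolyS K n) (c '' {q | q ≠ q0}) := by
      rw [← Finset.add_sum_erase _ _ (mem_univ q0), hu] at h0
      have h1 : c q0 = (C (coeff 0 (v q0))⁻¹ : PolyS K n) • ((C (coeff 0 (v q0)) : PolyS K n) • c q0) := by
        rw [smul_smul, ← C_mul, inv_mul_cancel₀ hne, C_1, one_smul]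
      rw [h1, eq_neg_of_add_eq_zero_left h0]
      refine Submodule.smul_mem _ _ (neg_mem (sum_mem fun q hq => Submodule.smul_mem _ _ ?_))
      exact Submodule.subset_span ⟨q, (Finset.mem_erase.1 hq).1, rfl⟩
    obtain _ | s := r'
    · exact q0.elim0
    have : HasCols dg Z s := by
      refine ⟨fun q => dg' (Fin.succAbove q0 q), fun q => c (Fin.succAbove q0 q),
        fun q => hc _, ?_⟩
      have hr : (Set.range fun q => c (Fin.succAbove q0 q)) = c '' {q | q ≠ q0} := by
        ext x
        constructor
        · rintro ⟨q, rfl⟩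
          exact ⟨_, Fin.succAbove_ne _ _, rfl⟩
        · rintro ⟨q, hq, rfl⟩
          obtain ⟨q', rfl⟩ := Fin.exists_succAbove_eq hq
          exact ⟨q', rfl⟩
      rw [hr, ← hsp]
      apply le_antisymm
      · exact Submodule.span_mono (Set.image_subset_range _ _)
      · rw [Submodule.span_le]
        rintro _ ⟨q, rfl⟩
        by_cases hq : q = q0
        · rw [hq]; exact hmem
        · exact Submodule.subset_span ⟨q, hq, rfl⟩
    have := hmin _ this
    omega

end p6
end Kz

namespace Kz
section p7
variable {K : Type} [Field K] {n : ℕ}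

structure Node (K : Type) [Field K] (n : ℕ) where
  r : ℕ
  dg : Fin r → ℤ
  Z : Submodule (PolyS K n) (Fin r → PolyS K n)
  hZ : IsH dg Z

namespace Node

def r' (N : Node K n) : ℕ := (exists_step N.dg N.Z N.hZ).choose
def dg' (N : Node K n) : Fin N.r' → ℤ := (exists_step N.dg N.Z N.hZ).choose_spec.choose
def D (N : Node K n) : Matrix (Fin N.r) (Fin N.r') (PolyS K n) :=
  (exists_step N.dg N.Z N.hZ).choose_spec.choose_spec.choose

theorem spec (N : Node K n) : IsHM N.dg N.dg' N.D ∧ LinearMap.range N.D.mulVecLin = N.Z ∧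
    ∀ u, ∀ v ∈ freePiece N.dg' u, N.D.mulVec v = 0 → ∀ q, coeff 0 (v q) = 0 :=
  (exists_step N.dg N.Z N.hZ).choose_spec.choose_spec.choose_spec

def next (N : Node K n) : Node K n where
  r := N.r'
  dg := N.dg'
  Z := LinearMap.ker N.D.mulVecLin
  hZ := ker_IsH N.spec.1

/-- the sequence of syzygies -/
def nd (N : Node K n) : ℕ → Node K n
  | 0 => N
  | i + 1 => (nd N i).next

abbrev kz (N : Node K n) (t : ℕ) : KD ℤ (t : ℤ) := KZ N.dg N.Z t
abbrev kf (N : Node K n) (t : ℕ) : KD ℤ (t : ℤ) := KF K n N.dg t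

theorem ses (N : Node K n) (t : ℕ) :
    KD.SES (N.next.kz t) (N.next.kf t) (N.kz t) (AddMonoidHom.id (Fin N.r' → PolyS K n))
      (N.D.mulVecLin.toAddMonoidHom) where
  h1 := ⟨fun _ _ => rfl, fun c a ha => ⟨ha.1, trivial⟩⟩
  h2 := ⟨fun s a => by
      exact N.D.mulVecLin.map_smul (xs K n s ^ t) a, fun c a ha => by
      refine ⟨mulVec_mem N.spec.1 ha.1, ?_⟩
      show N.D.mulVecLin a ∈ N.Z
      rw [← N.spec.2.1]; exact ⟨a, rfl⟩⟩
  inj := fun c a _ h => h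
  zero := fun c a ha => ha.2
  exact := fun c b hb h => ⟨b, ⟨hb.1, h⟩, rfl⟩
  surj := fun c b hb => by
    have hb2 : b ∈ N.Z := hb.2
    rw [← N.spec.2.1] at hb2
    obtain ⟨w, hw⟩ := hb2
    refine ⟨hc N.dg' c w, ⟨hc_mem _ _ _, trivial⟩, ?_⟩
    refine (mulVec_hc N.spec.1 c w).trans (Eq.trans ?_ (hc_of_mem hb.1))
    rw [← hw]; rfl


/-- the module resolved, at the level of Koszul data -/
def Base (N : Node K n) (G : ∀ t : ℕ, KD ℤ (t : ℤ)) : Prop :=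
  ∀ t, ∃ φ, KD.SES (N.kz t) (N.kf t) (G t) (AddMonoidHom.id (Fin N.r → PolyS K n)) φ

variable {N : Node K n} {G : ∀ t : ℕ, KD ℤ (t : ℤ)}

theorem V_shift (hB : N.Base G) (t : ℕ) : ∀ (i : ℕ) (j c : ℤ), 1 ≤ j →
    (G t).V n (j + i + 1) c → ((N.nd i).kz t).V n j c
  | 0, j, c, hj, h => by
    obtain ⟨φ, hs⟩ := hB t
    refine KD.V_of_Inj hs.h1 (hs.Inj_of ?_) (free_V _ t n le_rfl j c hj)
    simpa using h
  | i + 1, j, c, hj, h => by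
    refine KD.V_of_Inj ((N.nd i).ses t).h1 (((N.nd i).ses t).Inj_of ?_)
      (free_V _ t n le_rfl j c hj)
    refine V_shift hB t i (j+1) c (by omega) ?_
    convert h using 1; push_cast; ring

theorem Inj_shift (hB : N.Base G) (t : ℕ) : ∀ (i : ℕ) (c : ℤ), (G t).V n (i + 1) c →
    KD.Inj ((N.nd i).kz t) ((N.nd i).kf t) (AddMonoidHom.id (Fin (N.nd i).r → PolyS K n)) n 0 c
  | 0, c, h => by
    obtain ⟨φ, hs⟩ := hB t
    exact hs.Inj_of (by simpa using h)
  | i + 1, c, h => by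
    refine ((N.nd i).ses t).Inj_of ?_
    rw [zero_add]
    refine V_shift hB t i 1 c le_rfl ?_
    convert h using 1; push_cast; ring

theorem mem_shift (hB : N.Base G) (t i : ℕ) (c : ℤ) (h : (G t).V n (i + 1) c)
    (Q : ℕ → Fin (N.nd i).r → PolyS K n) (hQ : ∀ s, Q s ∈ freePiece (N.nd i).dg (c - t))
    (hz : ∑ s ∈ range n, xs K n s ^ t • Q s ∈ (N.nd i).Z) :
    ∃ Q' : ℕ → Fin (N.nd i).r → PolyS K n,
      (∀ s, Q' s ∈ freePiece (N.nd i).dg (c - t) ∧ Q' s ∈ (N.nd i).Z) ∧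
      ∑ s ∈ range n, xs K n s ^ t • Q s = ∑ s ∈ range n, xs K n s ^ t • Q' s := by
  obtain ⟨η, hη, hh⟩ := KD.exists_d_eq_inc (D := (N.nd i).kf t) n c Q (fun s => ⟨hQ s, trivial⟩)
  have hzf : ∑ s ∈ range n, xs K n s ^ t • Q s ∈ freePiece (N.nd i).dg c := by
    refine sum_mem fun s _ => ?_
    have := hz_smul_vec (xs_pow_mem s t) (hQ s)
    rwa [add_sub_cancel] at this
  have hki := kmap_inc (AddMonoidHom.id (Fin (N.nd i).r → PolyS K n)) n
    (∑ s ∈ range n, xs K n s ^ t • Q s)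
  have hI := Inj_shift hB t i c h
    (inc (A := ((N.nd i).kz t).A) n (∑ s ∈ range n, xs K n s ^ t • Q s))
    ((inc_mem _ _ _ _ _).2 ⟨hzf, hz⟩) (kd_inc _ _ _)
    ⟨η, hη, hh.trans hki.symm⟩
  obtain ⟨b, hb, hbd⟩ := hI
  obtain ⟨Q', hQ', hs⟩ := KD.exists_of_d_eq_inc n c b _ hb hbd
  exact ⟨Q', fun s => hQ' s, hs⟩

theorem fp_eq_zero {r : ℕ} {dg : Fin r → ℤ} {u : ℤ} (hu : ∀ p, u < dg p)
    {v : Fin r → PolyS K n} (hv : v ∈ freePiece dg u) : v = 0 := by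
  ext p μ
  by_contra h
  have := mem_hz.1 (mem_fp.1 hv p) μ h
  have := hu p
  omega

theorem exists_lb {r : ℕ} (dg : Fin r → ℤ) : ∃ B, ∀ p, B ≤ dg p := by
  refine ⟨-∑ p, |dg p|, fun p => ?_⟩
  have h1 : |dg p| ≤ ∑ p, |dg p| := 
    Finset.single_le_sum (f := fun p => |dg p|) (fun i _ => abs_nonneg _) (Finset.mem_univ p)
  have := neg_abs_le (dg p)
  omega

theorem Z_eq_bot_of (M : Node K n) (h : ∀ u, ∀ v ∈ M.Z, v ∈ freePiece M.dg u → v = 0) :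
    M.Z = ⊥ := by
  rw [eq_bot_iff]
  intro v hv
  rw [← sum_hc M.dg v]
  exact sum_mem fun u _ => h u _ (M.hZ v hv u) (hc_mem _ _ _)

theorem Z_n (hB : N.Base G) (hn : 0 < n) : (N.nd n).Z = ⊥ := by
  obtain ⟨B, hBd⟩ := exists_lb (N.nd n).dg
  have key : ∀ (k : ℕ) (v : Fin (N.nd n).r → PolyS K n), v ∈ (N.nd n).Z →
      v ∈ freePiece (N.nd n).dg (B - 1 + k) → v = 0 := by
    intro k
    induction k with
    | zero => exact fun v _ hv => fp_eq_zero (fun p => by have := hBd p; push_cast; omega) hv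
    | succ k ih =>
      intro v hvZ hv
      have h0 : ∀ p, coeff 0 (v p) = 0 := by
        obtain ⟨i, rfl⟩ : ∃ i, n = i + 1 := ⟨n - 1, by omega⟩
        exact (N.nd i).spec.2.2 _ v hv hvZ
      obtain ⟨Q, hQ, hs⟩ := div_vec 1 n le_rfl v _ hv (by
        intro p μ hμ
        by_contra hc
        push Not at hc
        have : μ = 0 := by
          ext s; have := hc s s.2; simp at *; omega
        rw [this] at hμ; exact hμ (h0 p))
      obtain ⟨Q', hQ', hs'⟩ := mem_shift hB 1 n _ (KD.V_gt _ (by omega)) Q hQ (by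
        rw [← hs]; exact hvZ)
      rw [hs, hs']
      refine sum_eq_zero fun s _ => ?_
      rw [ih (Q' s) (hQ' s).2 (by
        have := (hQ' s).1
        push_cast at this
        convert this using 1; ring_nf), smul_zero]
  refine Z_eq_bot_of _ fun u v hv hvu => ?_
  by_cases hu : B - 1 ≤ u
  · refine key (u - (B-1)).toNat v hv ?_
    convert hvu using 1
    congr 1
    omega
  · exact fp_eq_zero (fun p => by have := hBd p; omega) hvu

theorem r_zero_of (M : Node K n) (h : M.Z = ⊥) : M.next.r = 0 := by
  by_contra hr
  have q : Fin M.r' := ⟨0, Nat.pos_of_ne_zero hr⟩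
  have hm : (Pi.single q 1 : Fin M.r' → PolyS K n) ∈ freePiece M.dg' (M.dg' q) := by
    rw [mem_fp]
    intro p
    by_cases hp : p = q
    · subst hp; rw [Pi.single_eq_same, sub_self]; exact hz_one
    · rw [Pi.single_eq_of_ne hp]; exact zero_mem _
  have h1 := M.spec.2.2 _ _ hm (by
    have : M.D.mulVecLin (Pi.single q 1) ∈ M.Z := by rw [← M.spec.2.1]; exact ⟨_, rfl⟩
    rw [h] at this
    exact this) q
  rw [Pi.single_eq_same] at h1
  simp at h1

theorem r_zero (hB : N.Base G) (hn : 0 < n) : ∀ j, (N.nd (n + 1 + j)).r = 0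
  | 0 => r_zero_of _ (Z_n hB hn)
  | j + 1 => by
    refine r_zero_of (N.nd (n + 1 + j)) ?_
    rw [eq_bot_iff]
    intro v _
    have := r_zero hB hn j
    have : IsEmpty (Fin (N.nd (n + 1 + j)).r) := by rw [this]; infer_instance
    rw [Submodule.mem_bot]
    exact Subsingleton.elim _ _

theorem mat_mul_zero {a b c : ℕ} (D : Matrix (Fin a) (Fin b) (PolyS K n))
    (D' : Matrix (Fin b) (Fin c) (PolyS K n)) (h : ∀ v, D.mulVec (D'.mulVec v) = 0) :
    D * D' = 0 := by
  rw [← Matrix.mulVec_injective.eq_iff]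
  ext1 v
  rw [← Matrix.mulVec_mulVec, Matrix.zero_mulVec, h]

/-- the free resolution -/
def cx (N : Node K n) (h : ∀ i, n < i → (N.nd i).r = 0) : FreeComplex K n where
  len := n
  rk := fun i => (N.nd i).r
  deg := fun i => (N.nd i).dg
  dd := fun i => (N.nd i).D
  rk_eq_zero := h
  isHomog := fun i => (N.nd i).spec.1
  isComplex := fun i => by
    refine mat_mul_zero (N.nd i).D (N.nd (i+1)).D fun v => ?_
    have h1 : (N.nd (i+1)).D.mulVecLin v ∈ (N.nd (i+1)).Z := by
      rw [← (N.nd (i+1)).spec.2.1]; exact ⟨v, rfl⟩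
    exact h1

theorem cx_res (N : Node K n) (h) : IsResolution (N.cx h) := fun i =>
  ((N.nd (i+1)).spec.2.1).symm

end Node
end p7
end Kz

namespace Kz
section p8
variable {K : Type} [Field K] {n : ℕ}

def T0 (n t : ℕ) : Fin n →₀ ℕ := Finsupp.equivFunOnFinite.symm fun _ => t - 1

theorem T0_apply (t : ℕ) (s : Fin n) : T0 n t s = t - 1 := rfl

theorem T0_degree (t : ℕ) : (T0 n t).degree = n * (t - 1) := by
  rw [Finsupp.degree_eq_sum]; simp [T0_apply]

theorem degree_sub {μ ν : Fin n →₀ ℕ} (h : ν ≤ μ) : (μ - ν).degree + ν.degree = μ.degree := by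
  rw [← map_add, tsub_add_cancel_of_le h]

/-- the residue pairing -/
def pr {r : ℕ} (t : ℕ) (ψ : Fin r → PolyS K n) : (Fin r → PolyS K n) →ₗ[K] K where
  toFun w := coeff (T0 n t) (ψ ⬝ᵥ w)
  map_add' := fun a b => by rw [dotProduct_add, coeff_add]
  map_smul' := fun a b => by rw [dotProduct_smul, coeff_smul]; rfl

theorem pr_apply {r : ℕ} (t : ℕ) (ψ w : Fin r → PolyS K n) :
    pr t ψ w = coeff (T0 n t) (ψ ⬝ᵥ w) := rfl

theorem pr_single {r : ℕ} (t : ℕ) (ψ : Fin r → PolyS K n) (p : Fin r) (ν : Fin n →₀ ℕ) (a : K) :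
    pr t ψ (Pi.single p (monomial ν a)) =
      if ν ≤ T0 n t then coeff (T0 n t - ν) (ψ p) * a else 0 := by
  rw [pr_apply, dotProduct_single, coeff_mul_monomial']

theorem single_mem_fp {r : ℕ} {dg : Fin r → ℤ} {c : ℤ} (p : Fin r) (q : PolyS K n)
    (h : q ∈ homogZ K n (c - dg p)) : Pi.single p q ∈ freePiece dg c := by
  rw [mem_fp]
  intro p'
  by_cases hp : p' = p
  · subst hp; rwa [Pi.single_eq_same]
  · rw [Pi.single_eq_of_ne hp]; exact zero_mem _

theorem pr_zero {r : ℕ} {dg : Fin r → ℤ} {t : ℕ} {c e : ℤ} (ht : 1 ≤ t)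
    (hce : c + e = n * ((t : ℤ) - 1))
    (θ : Fin r → PolyS K n) (hθ : θ ∈ freePiece (fun p => - dg p) e) (hd : ∀ p, e + dg p < t)
    (h : ∀ w ∈ freePiece dg c, pr t θ w = 0) : θ = 0 := by
  ext p κ
  rw [Pi.zero_apply, coeff_zero]
  by_contra hne
  have h1 := mem_hz.1 (mem_fp.1 hθ p) κ hne
  have hle : κ ≤ T0 n t := by
    intro s
    rw [T0_apply]
    have := Finsupp.le_degree s κ
    have := hd p
    omega
  have hdeg := degree_sub hle
  rw [T0_degree] at hdeg
  have h2 := h (Pi.single p (monomial (T0 n t - κ) 1)) (single_mem_fp p _ (hz_monomial _ _ (by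
    have : (((T0 n t - κ).degree + κ.degree : ℕ) : ℤ) = n * ((t : ℤ) - 1) := by
      rw [hdeg]; push_cast [ht]; ring
    push_cast at this
    rw [h1] at this
    linarith)))
  rw [pr_single, if_pos tsub_le_self, mul_one, tsub_tsub_cancel_of_le hle] at h2
  exact hne h2

def US {r : ℕ} (dg : Fin r → ℤ) (t : ℕ) (c : ℤ) : Submodule K (Fin r → PolyS K n) where
  carrier := {v | ∃ Q : ℕ → Fin r → PolyS K n, (∀ s, Q s ∈ freePiece dg (c - t)) ∧
    v = ∑ s ∈ range n, xs K n s ^ t • Q s}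
  add_mem' := by
    rintro _ _ ⟨Q, hQ, rfl⟩ ⟨Q', hQ', rfl⟩
    refine ⟨fun s => Q s + Q' s, fun s => add_mem (hQ s) (hQ' s), ?_⟩
    simp only [smul_add, sum_add_distrib]
  zero_mem' := ⟨fun _ => 0, fun _ => zero_mem _, by simp⟩
  smul_mem' := by
    rintro a _ ⟨Q, hQ, rfl⟩
    refine ⟨fun s => a • Q s, fun s => Submodule.smul_mem _ _ (hQ s), ?_⟩
    rw [smul_sum]
    exact sum_congr rfl fun s _ => smul_comm _ _ _

theorem pr_xs {r : ℕ} {t : ℕ} (ht : 1 ≤ t) (ψ : Fin r → PolyS K n) (Q : ℕ → Fin r → PolyS K n) :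
    pr t ψ (∑ s ∈ range n, xs K n s ^ t • Q s) = 0 := by
  rw [map_sum]
  refine sum_eq_zero fun s hs => ?_
  have hs' : s < n := by simpa using hs
  rw [pr_apply, dotProduct_smul, smul_eq_mul, xs_pow_eq hs', coeff_monomial_mul', if_neg]
  rw [Finsupp.single_le_iff, T0_apply]; omega

/-- representability of functionals -/
theorem exists_repr {r : ℕ} (dg : Fin r → ℤ) {t : ℕ} (ht : 1 ≤ t) {c e : ℤ}
    (hce : c + e = n * ((t : ℤ) - 1)) (lam : (Fin r → PolyS K n) →ₗ[K] K)
    (hlam : ∀ v ∈ US dg t c, lam v = 0) :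
    ∃ ψ' ∈ freePiece (K := K) (n := n) (fun p => - dg p) e, ∀ w ∈ freePiece dg c,
      pr t ψ' w = lam w := by
  classical
  set ψ' : Fin r → PolyS K n := fun p =>
    ∑ μ ∈ (Finset.Iic (T0 n t)).filter (fun μ => ((μ.degree : ℕ) : ℤ) = c - dg p),
      monomial (T0 n t - μ) (lam (Pi.single p (monomial μ 1))) with hψ'
  refine ⟨ψ', ?_, ?_⟩
  · rw [mem_fp]
    intro p
    refine sum_mem fun μ hμ => hz_monomial _ _ ?_
    simp only [Finset.mem_filter, Finset.mem_Iic] at hμ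
    have hdeg := degree_sub hμ.1
    rw [T0_degree] at hdeg
    have : (((T0 n t - μ).degree + μ.degree : ℕ) : ℤ) = n * ((t : ℤ) - 1) := by
      rw [hdeg]; push_cast [ht]; ring
    push_cast at this
    linarith [hμ.2]
  · intro w hw
    have hsum : w = ∑ p, ∑ ν ∈ (w p).support, Pi.single p (monomial ν (coeff ν (w p))) := by
      ext1 p
      rw [Finset.sum_apply, Finset.sum_eq_single p]
      · rw [Finset.sum_apply]
        simp only [Pi.single_eq_same]
        exact (w p).as_sum
      · intro b _ hb
        rw [Finset.sum_apply]
        exact sum_eq_zero fun ν _ => Pi.single_eq_of_ne hb.symm _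
      · simp
    rw [hsum, map_sum, map_sum]
    refine sum_congr rfl fun p _ => ?_
    rw [map_sum, map_sum]
    refine sum_congr rfl fun ν hν => ?_
    have hνd := mem_hz.1 (mem_fp.1 hw p) ν (by simpa using hν)
    rw [pr_single]
    have hsm : (Pi.single p (monomial ν (coeff ν (w p))) : Fin r → PolyS K n)
        = coeff ν (w p) • Pi.single p (monomial ν 1) := by
      rw [← Pi.single_smul, smul_monomial, smul_eq_mul, mul_one]
    rw [hsm, map_smul, smul_eq_mul]
    by_cases hle : ν ≤ T0 n t
    · rw [if_pos hle, mul_comm]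
      congr 1
      rw [hψ']
      simp only
      rw [coeff_sum, Finset.sum_eq_single ν]
      · rw [coeff_monomial, if_pos rfl]
      · intro μ hμ hne
        rw [coeff_monomial, if_neg]
        intro h
        simp only [Finset.mem_filter, Finset.mem_Iic] at hμ
        exact hne ((tsub_right_inj hμ.1 hle).1 h)
      · intro h
        exact absurd (by simp only [Finset.mem_filter, Finset.mem_Iic]; exact ⟨hle, hνd⟩) h
    · rw [if_neg hle, hlam, mul_zero]
      refine div_vec t n le_rfl _ c (single_mem_fp p _ (hz_monomial _ _ hνd)) ?_
      intro p' μ hμ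
      have hμν : μ = ν := by
        by_cases hp : p' = p
        · subst hp
          rw [Pi.single_eq_same, coeff_monomial] at hμ
          by_contra hh
          rw [if_neg (Ne.symm hh)] at hμ; exact hμ rfl
        · rw [Pi.single_eq_of_ne hp] at hμ; simp at hμ
      rw [hμν]
      rw [Finsupp.le_def] at hle
      push Not at hle
      obtain ⟨s, hs⟩ := hle
      rw [T0_apply] at hs
      exact ⟨s, s.2, by omega⟩

/-- duality, abstract form -/
theorem dual_step {r r' : ℕ} {dg : Fin r → ℤ} {dg' : Fin r' → ℤ}
    {D : Matrix (Fin r) (Fin r') (PolyS K n)} (hD : IsHM dg dg' D)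
    {t : ℕ} (ht : 1 ≤ t) {c e : ℤ} (hce : c + e = n * ((t : ℤ) - 1))
    (H : ∀ Q : ℕ → Fin r → PolyS K n, (∀ s, Q s ∈ freePiece dg (c - t)) →
      ∑ s ∈ range n, xs K n s ^ t • Q s ∈ LinearMap.range D.mulVecLin →
      ∃ Q' : ℕ → Fin r' → PolyS K n,
      ∑ s ∈ range n, xs K n s ^ t • Q s = ∑ s ∈ range n, xs K n s ^ t • D.mulVec (Q' s))
    (hd : ∀ p, e + dg' p < t)
    (ψ : Fin r' → PolyS K n) (hψ : ψ ∈ freePiece (fun p => - dg' p) e)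
    (hψ0 : ∀ v, D.mulVec v = 0 → ψ ⬝ᵥ v = 0) :
    ∃ ψ' ∈ freePiece (K := K) (n := n) (fun p => - dg p) e, D.transpose.mulVec ψ' = ψ := by
  set A : (freePiece (K := K) (n := n) dg' c) →ₗ[K] ((Fin r → PolyS K n) ⧸ US (K := K) dg t c) :=
    (US (K := K) dg t c).mkQ ∘ₗ (D.mulVecLin.restrictScalars K) ∘ₗ
      (freePiece (K := K) (n := n) dg' c).subtype with hA
  set f : Module.Dual K (freePiece (K := K) (n := n) dg' c) :=
    (pr t ψ) ∘ₗ (freePiece (K := K) (n := n) dg' c).subtype with hf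
  have hfr : f ∈ LinearMap.range A.dualMap := by
    rw [LinearMap.range_dualMap_eq_dualAnnihilator_ker, Submodule.mem_dualAnnihilator]
    rintro ⟨w, hw⟩ hker
    rw [LinearMap.mem_ker] at hker
    replace hker : (US (K := K) dg t c).mkQ (D.mulVec w) = 0 := hker
    rw [Submodule.mkQ_apply, Submodule.Quotient.mk_eq_zero] at hker
    obtain ⟨Q, hQ, hs⟩ := hker
    obtain ⟨Q', hs'⟩ := H Q hQ (by rw [← hs]; exact ⟨w, rfl⟩)
    have h0 := hψ0 (w - ∑ s ∈ range n, xs K n s ^ t • Q' s) (by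
      rw [Matrix.mulVec_sub, Matrix.mulVec_sum, hs, hs', sub_eq_zero]
      exact sum_congr rfl fun s _ => (Matrix.mulVec_smul _ _ _).symm)
    rw [dotProduct_sub, sub_eq_zero] at h0
    show pr t ψ w = 0
    rw [pr_apply, h0, ← pr_apply, pr_xs ht]
  obtain ⟨g, hg⟩ := hfr
  obtain ⟨ψ', hψ'm, hψ'⟩ := exists_repr dg ht hce (g ∘ₗ (US (K := K) dg t c).mkQ) (by
    intro v hv
    have : (US (K := K) dg t c).mkQ v = 0 := by
      rw [Submodule.mkQ_apply, Submodule.Quotient.mk_eq_zero]; exact hv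
    rw [LinearMap.comp_apply, this, map_zero])
  refine ⟨ψ', hψ'm, ?_⟩
  rw [← sub_eq_zero]
  have hDt : IsHM (fun p => - dg' p) (fun p => - dg p) D.transpose := by
    intro p q
    rw [neg_sub_neg]; exact hD q p
  refine pr_zero ht hce _ (sub_mem (mulVec_mem hDt hψ'm) hψ) hd ?_
  intro w hw
  have h1 := hψ' (D.mulVec w) (mulVec_mem hD hw)
  have h2 : g ((US (K := K) dg t c).mkQ (D.mulVec w)) = pr t ψ w :=
    LinearMap.congr_fun hg ⟨w, hw⟩
  rw [LinearMap.comp_apply, h2] at h1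
  rw [pr_apply, sub_dotProduct, coeff_sub, Matrix.mulVec_transpose, ← Matrix.dotProduct_mulVec]
  rw [← pr_apply, ← pr_apply, h1, sub_self]

theorem dual_zero {r : ℕ} {dg : Fin r → ℤ}
    (Z : Submodule (PolyS K n) (Fin r → PolyS K n))
    {t : ℕ} (ht : 1 ≤ t) {c e : ℤ} (hce : c + e = n * ((t : ℤ) - 1))
    (H : ∀ w ∈ freePiece (K := K) (n := n) dg c, ∃ Q : ℕ → Fin r → PolyS K n,
      w - ∑ s ∈ range n, xs K n s ^ t • Q s ∈ Z)
    (hd : ∀ p, e + dg p < t)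
    (ψ : Fin r → PolyS K n) (hψ : ψ ∈ freePiece (fun p => - dg p) e)
    (hψ0 : ∀ v ∈ Z, ψ ⬝ᵥ v = 0) : ψ = 0 := by
  refine pr_zero ht hce _ hψ hd ?_
  intro w hw
  obtain ⟨Q, hQ⟩ := H w hw
  have h0 := hψ0 _ hQ
  rw [dotProduct_sub, sub_eq_zero] at h0
  rw [pr_apply, h0, ← pr_apply, pr_xs ht]

end p8
end Kz

namespace Kz
section p9
variable {K : Type} [Field K] {n : ℕ}

theorem exists_ub {r : ℕ} (dg : Fin r → ℤ) : ∃ B : ℕ, ∀ p, dg p ≤ B := by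
  refine ⟨(∑ p, |dg p|).toNat, fun p => ?_⟩
  have h1 : |dg p| ≤ ∑ p, |dg p| :=
    Finset.single_le_sum (f := fun p => |dg p|) (fun i _ => abs_nonneg _) (Finset.mem_univ p)
  have := le_abs_self (dg p)
  omega

/-- eventual vanishing of Koszul homology -/
def Ev (n : ℕ) (G : ∀ t : ℕ, KD ℤ (t : ℤ)) (j e : ℤ) : Prop :=
  ∃ T : ℕ, ∀ t : ℕ, T ≤ t → (G t).V n j (n * ((t : ℤ) - 1) - e)

namespace Node
variable {N : Node K n} {G : ∀ t : ℕ, KD ℤ (t : ℤ)}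

theorem dot_ker (N : Node K n) (ψ : Fin N.r → PolyS K n) (h0 : N.D.transpose.mulVec ψ = 0)
    (v : Fin N.r → PolyS K n) (hv : v ∈ N.Z) : ψ ⬝ᵥ v = 0 := by
  rw [← N.spec.2.1] at hv
  obtain ⟨w, rfl⟩ := hv
  rw [Matrix.mulVecLin_apply, Matrix.dotProduct_mulVec, ← Matrix.mulVec_transpose, h0,
    zero_dotProduct]

theorem coex_succ (hB : N.Base G) (i : ℕ) (e : ℤ) (hV : Ev n G (i + 1) e)
    (ψ : Fin (N.nd (i+1)).r → PolyS K n) (hψ : ψ ∈ freePiece (fun p => - (N.nd (i+1)).dg p) e)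
    (h0 : (N.nd (i+1)).D.transpose.mulVec ψ = 0) :
    ∃ ψ' ∈ freePiece (K := K) (n := n) (fun p => - (N.nd i).dg p) e,
      (N.nd i).D.transpose.mulVec ψ' = ψ := by
  obtain ⟨T, hT⟩ := hV
  obtain ⟨B, hBd⟩ := exists_ub (N.nd (i+1)).dg
  set t := T + B + e.toNat + 1 with ht
  refine dual_step (dg := (N.nd i).dg) (dg' := (N.nd (i+1)).dg) (N.nd i).spec.1
    (t := t) (by omega) (c := n * ((t : ℤ) - 1) - e) (by ring) ?_ ?_ ψ hψ ?_
  · intro Q hQ hz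
    obtain ⟨Q', hQ', hs⟩ := mem_shift hB t i _ (hT t (by omega)) Q hQ
      ((N.nd i).spec.2.1.le hz)
    have : ∀ s, ∃ w, (N.nd i).D.mulVecLin w = Q' s := by
      intro s
      exact (N.nd i).spec.2.1.ge (hQ' s).2
    choose W hW using this
    refine ⟨W, hs.trans (sum_congr rfl fun s _ => ?_)⟩
    rw [← hW s]; rfl
  · intro p
    have := hBd p
    omega
  · intro v hv
    exact dot_ker (N.nd (i+1)) ψ h0 v hv

theorem coex_zero (hB : N.Base G) (e : ℤ) (hV : Ev n G 0 e)
    (ψ : Fin N.r → PolyS K n) (hψ : ψ ∈ freePiece (fun p => - N.dg p) e)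
    (h0 : N.D.transpose.mulVec ψ = 0) : ψ = 0 := by
  obtain ⟨T, hT⟩ := hV
  obtain ⟨B, hBd⟩ := exists_ub N.dg
  set t := T + B + e.toNat + 1 with ht
  obtain ⟨φ, hs⟩ := hB t
  refine dual_zero (dg := N.dg) N.Z (t := t) (by omega) (c := n * ((t : ℤ) - 1) - e) (by ring)
    ?_ ?_ ψ hψ (dot_ker N ψ h0)
  · intro w hw
    have hw' : w ∈ (N.kf t).X (n * ((t : ℤ) - 1) - e) := ⟨hw, trivial⟩
    obtain ⟨Q, hQ, hq⟩ := KD.V_zero_iff.1 (hT t (by omega)) (φ w) (hs.h2.mem _ _ hw')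
    choose W hW hWQ using fun s => hs.surj _ _ (hQ s)
    change ℕ → Fin N.r → PolyS K n at W
    refine ⟨W, ?_⟩
    have hm : w - ∑ s ∈ range n, xs K n s ^ t • W s ∈ freePiece N.dg (n * ((t : ℤ) - 1) - e) := by
      refine sub_mem hw (sum_mem fun s _ => ?_)
      have := hz_smul_vec (xs_pow_mem s t) (hW s).1
      rwa [add_sub_cancel] at this
    have hφ : φ (w - ∑ s ∈ range n, xs K n s ^ t • W s) = 0 := by
      refine (map_sub φ w _).trans (sub_eq_zero.2 (hq.trans ?_))
      refine Eq.trans ?_ (map_sum φ _ _).symm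
      refine sum_congr rfl fun s _ => ?_
      exact (congrArg ((G t).g s) (hWQ s)).symm.trans (hs.h2.comm s (W s)).symm
    obtain ⟨a, ha, hae⟩ := hs.exact _ _ ⟨hm, trivial⟩ hφ
    replace hae : a = w - ∑ s ∈ range n, xs K n s ^ t • W s := hae
    rw [← hae]; exact ha.2
  · intro p
    have := hBd p
    omega

theorem cohomDim_eq_zero_of {E : CoComplex K n} {i : ℕ} {e : ℤ}
    (h : ∀ ψ ∈ freePiece (K := K) (n := n) (E.deg i) e, (E.dd i).mulVec ψ = 0 → ψ ∈ E.imSub i) :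
    cohomDim E i e = 0 := by
  unfold cohomDim
  suffices hh : Submodule.comap (E.kerPiece i e).subtype (E.imSub i) = ⊤ by
    rw [hh]
    exact finrank_zero_of_subsingleton
  rw [eq_top_iff]
  rintro ⟨ψ, hψ⟩ -
  exact h ψ hψ.2 hψ.1

theorem ext_zero (hB : N.Base G) (h) (j e : ℤ) (hV : Ev n G j e) : extDim (N.cx h) j e = 0 := by
  unfold extDim
  split_ifs with hj
  · refine cohomDim_eq_zero_of ?_
    obtain ⟨i, rfl⟩ := Int.eq_ofNat_of_zero_le hj
    rw [Int.toNat_natCast]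
    cases i with
    | zero =>
      intro ψ hψ h0
      rw [coex_zero hB e hV ψ hψ h0]
      exact zero_mem _
    | succ i =>
      intro ψ hψ h0
      obtain ⟨ψ', -, hh⟩ := coex_succ hB i e (by simpa using hV) ψ hψ h0
      exact ⟨ψ', hh⟩
  · rfl

end Node
end p9
end Kz

namespace Kz
section p10
variable {K : Type} [Field K] {n k : ℕ}

theorem card_sum_eq (a v : ℕ) : Nat.card {P : Fin a → ℕ // ∑ i, P i = v} = a.multichoose v := by
  rw [← Nat.card_congr (Sym.equivNatSumOfFintype (Fin a) v), Nat.card_eq_fintype_card,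
    Sym.card_sym_eq_multichoose, Fintype.card_fin]

instance fin_sum_eq (a v : ℕ) : Finite {P : Fin a → ℕ // ∑ i, P i = v} :=
  Finite.of_equiv _ (Sym.equivNatSumOfFintype (Fin a) v)

theorem md_apply (μ : Fin k × ℕ →₀ ℕ) (l : Fin k) :
    md μ l = μ.sum fun x e => if x.1 = l then (e : ℤ) else 0 := by
  rw [md, Finsupp.weight_apply, Finsupp.sum, Finset.sum_apply]
  refine sum_congr rfl fun x _ => ?_
  rw [Pi.smul_apply, Pi.single_apply]
  by_cases h : x.1 = l
  · simp [h]
  · simp [h, Ne.symm h]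

theorem md_apply' (p : Fin k → ℕ) (μ : Fin k × ℕ →₀ ℕ) (l : Fin k)
    (h : ∀ x, μ x ≠ 0 → x.2 < p x.1) : md μ l = ((∑ i : Fin (p l), μ (l, i) : ℕ) : ℤ) := by
  rw [md_apply, Fin.sum_univ_eq_sum_range (fun i => μ (l, i)) (p l)]
  push_cast
  rw [Finsupp.sum, ← sum_filter]
  symm
  refine sum_bij_ne_zero (fun i _ _ => (l, i)) ?_ ?_ ?_ ?_
  · intro i hi h0
    rw [Finset.mem_filter, Finsupp.mem_support_iff]
    exact ⟨by exact_mod_cast h0, rfl⟩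
  · intro i _ _ j _ _ hij
    exact (Prod.mk.inj hij).2
  · rintro ⟨l', i⟩ hx h0
    rw [Finset.mem_filter, Finsupp.mem_support_iff] at hx
    obtain ⟨hx1, rfl⟩ := hx
    exact ⟨i, Finset.mem_range.2 (h _ hx1), h0, rfl⟩
  · intro i _ _; rfl

/-- the monomials in a multigraded piece -/
def MS (p : Fin k → ℕ) (c : Fin k → ℤ) : Set (Fin k × ℕ →₀ ℕ) :=
  {μ | md μ = c ∧ ∀ x, μ x ≠ 0 → x.2 < p x.1}

def msMap (p : Fin k → ℕ) (c : Fin k → ℕ) (μ : MS p (fun l => (c l : ℤ))) :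
    (l : Fin k) → {P : Fin (p l) → ℕ // ∑ i, P i = c l} := fun l =>
  ⟨fun i => μ.1 (l, i), by
    have := md_apply' p μ.1 l μ.2.2
    rw [congrFun μ.2.1 l] at this
    exact_mod_cast this.symm⟩

def msInv (p : Fin k → ℕ) (P : (l : Fin k) → Fin (p l) → ℕ) : Fin k × ℕ →₀ ℕ :=
  Finsupp.onFinset ((univ : Finset (Fin k)) ×ˢ range (∑ l, p l))
    (fun x => if h : x.2 < p x.1 then P x.1 ⟨x.2, h⟩ else 0) (by
      rintro ⟨l, i⟩ h
      rw [Finset.mem_product]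
      refine ⟨Finset.mem_univ _, ?_⟩
      by_cases hi : i < p l
      · exact Finset.mem_range.2 (lt_of_lt_of_le hi (Finset.single_le_sum (f := p) (fun _ _ => Nat.zero_le _) (Finset.mem_univ l)))
      · exact absurd (dif_neg hi) h)

theorem msInv_apply (p : Fin k → ℕ) (P : (l : Fin k) → Fin (p l) → ℕ) (x) :
    msInv p P x = if h : x.2 < p x.1 then P x.1 ⟨x.2, h⟩ else 0 := rfl

theorem msInv_supp (p : Fin k → ℕ) (P : (l : Fin k) → Fin (p l) → ℕ) (x) (h : msInv p P x ≠ 0) :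
    x.2 < p x.1 := by
  by_contra hc
  exact h ((msInv_apply p P x).trans (dif_neg hc))

theorem msMap_bij (p : Fin k → ℕ) (c : Fin k → ℕ) : Function.Bijective (msMap p c) := by
  constructor
  · rintro ⟨μ, hμ⟩ ⟨ν, hν⟩ h
    refine Subtype.ext (Finsupp.ext ?_)
    rintro ⟨l, i⟩
    by_cases hi : i < p l
    · exact congrFun (congrArg Subtype.val (congrFun h l)) ⟨i, hi⟩
    · have h1 : μ (l, i) = 0 := by by_contra hc; exact hi (hμ.2 _ hc)
      have h2 : ν (l, i) = 0 := by by_contra hc; exact hi (hν.2 _ hc)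
      exact h1.trans h2.symm
  · intro P
    have hs := msInv_supp p (fun l => (P l).1)
    refine ⟨⟨msInv p (fun l => (P l).1), ?_, hs⟩, ?_⟩
    · ext1 l
      rw [md_apply' p _ l hs, ← (P l).2]
      congr 1
      refine sum_congr rfl fun i _ => ?_
      rw [msInv_apply, dif_pos i.2]
    · ext1 l
      refine Subtype.ext ?_
      ext1 i
      show msInv p (fun l => (P l).1) (l, i) = _
      rw [msInv_apply, dif_pos i.2]

theorem MS_finite (p : Fin k → ℕ) (c : Fin k → ℤ) : Finite (MS p c) := by
  by_cases h : ∀ l, 0 ≤ c l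
  · obtain ⟨d, rfl⟩ : ∃ d : Fin k → ℕ, c = fun l => (d l : ℤ) :=
      ⟨fun l => (c l).toNat, by ext l; have := h l; simp [this]⟩
    exact Finite.of_injective _ (msMap_bij p d).1
  · push Not at h
    obtain ⟨l, hl⟩ := h
    have : IsEmpty (MS p c) := ⟨fun μ => by
      have := md_nonneg μ.1 l
      rw [μ.2.1] at this
      omega⟩
    infer_instance

instance XP_fin (p : Fin k → ℕ) (c : Fin k → ℤ) : Module.Finite K (XP K p c) := by
  have := MS_finite p c
  exact Module.Finite.of_basis (basisRestrictSupport K (MS p c))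

theorem XP_finrank (p : Fin k → ℕ) (c : Fin k → ℕ) :
    finrank K (XP K p (fun l => (c l : ℤ))) = ∏ l, (p l).multichoose (c l) := by
  refine (finrank_eq_nat_card_basis
    (basisRestrictSupport K (MS p (fun l => (c l : ℤ))))).trans ?_
  rw [Nat.card_congr (Equiv.ofBijective _ (msMap_bij p c)), Nat.card_pi]
  exact prod_congr rfl fun l _ => card_sum_eq _ _

/-- monomials of a given degree -/
def HS (n : ℕ) (v : ℤ) : Set (Fin n →₀ ℕ) := {μ | ((μ.degree : ℕ) : ℤ) = v}

theorem homogZ_eq (v : ℤ) : homogZ K n v = restrictSupport K (HS n v) := by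
  ext q
  rw [mem_hz, mem_restrictSupport_iff]
  constructor
  · intro h μ hμ
    exact h μ (by simpa using hμ)
  · intro h μ hμ
    exact h (by simpa using hμ)

def hsEquiv (n v : ℕ) : HS n v ≃ {P : Fin n → ℕ // ∑ i, P i = v} :=
  Finsupp.equivFunOnFinite.subtypeEquiv fun μ => by
    show ((μ.degree : ℕ) : ℤ) = v ↔ _
    rw [Finsupp.degree_eq_sum]
    exact Nat.cast_inj

theorem HS_finite (n : ℕ) (v : ℤ) : Finite (HS n v) := by
  by_cases h : 0 ≤ v
  · obtain ⟨d, rfl⟩ := Int.eq_ofNat_of_zero_le h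
    exact Finite.of_equiv _ (hsEquiv n d).symm
  · have : IsEmpty (HS n v) := ⟨fun μ => by
      have : ((μ.1.degree : ℕ) : ℤ) = v := μ.2
      omega⟩
    infer_instance

instance homogZ_fin (v : ℤ) : Module.Finite K (homogZ K n v) := by
  rw [homogZ_eq]
  have := HS_finite n v
  exact Module.Finite.of_basis (basisRestrictSupport K (HS n v))

theorem homogZ_finrank (v : ℕ) : finrank K (homogZ K n (v : ℤ)) = n.multichoose v := by
  rw [homogZ_eq, finrank_eq_nat_card_basis (basisRestrictSupport K (HS n v)),
    Nat.card_congr (hsEquiv n v)]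
  exact card_sum_eq _ _

end p10
end Kz

namespace Kz
section p11
variable {K : Type} [Field K] {n k m : ℕ} {p : Fin k → ℕ} {a : Fin k → ℤ}

/-- the graded pieces of the module -/
abbrev Xa (K : Type) [Field K] {k : ℕ} (p : Fin k → ℕ) (a : Fin k → ℤ) (u : ℤ) :
    Submodule K (TT K k) := XP K p (fun l => a l + u)

theorem abs_bd (a : Fin k → ℤ) (l : Fin k) : |a l| ≤ ∑ l, |a l| :=
  Finset.single_le_sum (f := fun p => |a p|) (fun _ _ => abs_nonneg _) (Finset.mem_univ l)

theorem p_bd (p : Fin k → ℕ) (l : Fin k) : p l ≤ ∑ l, p l :=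
  Finset.single_le_sum (f := p) (fun _ _ => Nat.zero_le _) (Finset.mem_univ l)

/-- the Koszul data of the module -/
def GG (K : Type) [Field K] {k : ℕ} (p : Fin k → ℕ) (a : Fin k → ℤ) (t : ℕ) : KD ℤ (t : ℤ) :=
  (DT K t p).pull (fun u => fun l => a l + u) t (by intro c; ext l; simp [add_sub_assoc])

theorem Ev_GG (hp : ∀ l, 1 ≤ p l) (hm : ∑ l, (p l - 1) = m) (d j : ℤ)
    (h : j ≠ m - II p (fun l => a l + d)) : Ev (m+1) (GG K p a) j (-d - (m+1)) := by
  refine ⟨(∑ l, |a l|).toNat + d.toNat + (-d).toNat + ∑ l, p l + 1, fun t ht => ?_⟩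
  rw [GG, KD.pull_V]
  have hb : Bd p t (fun l => a l + d) := by
    intro l
    have h1 := abs_bd a l
    have h2 := p_bd p l
    have h3 := le_abs_self (a l)
    have h4 := neg_abs_le (a l)
    refine ⟨?_, ?_, ?_⟩
    · show -(t:ℤ) < a l + d
      omega
    · show a l + d < t
      omega
    · omega
  have := VT_main (K := K) hp hm (fun l => a l + d) j hb h
  unfold VT at this
  convert this using 1
  ext l
  simp only [cc]
  push_cast
  ring

theorem II_zero {b : Fin k → ℤ} (hp : ∀ l, 1 ≤ p l) (hb : ∀ l, 0 ≤ b l) : II p b = 0 := by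
  unfold II
  refine sum_eq_zero fun l _ => ?_
  rw [if_neg]
  have := hb l
  have := hp l
  omega

theorem fg_step (hp : ∀ l, 1 ≤ p l) (hm : ∑ l, (p l - 1) = m) (hm1 : 1 ≤ m) :
    ∃ U : ℤ, ∀ u, U ≤ u → ∀ q ∈ Xa K p a u, ∃ Q : ℕ → TT K k,
      (∀ s, Q s ∈ Xa K p a (u - 1)) ∧ q = ∑ s ∈ range (m+1), ff K p s * Q s := by
  set A := ∑ l, |a l| with hA
  set P := ∑ l, p l with hP
  have hA0 : 0 ≤ A := sum_nonneg fun _ _ => abs_nonneg _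
  refine ⟨A + (m+1) * (2 * A + m + 2 + P), fun u hu q hq => ?_⟩
  obtain ⟨t, d, ht, hd1, hd2, hud⟩ : ∃ (t : ℕ) (d : ℤ), 2 * A + m + 2 + P ≤ t ∧ A ≤ d ∧
      d < A + m + 1 ∧ u = d + (m+1) * t := by
    have h0 : (0:ℤ) < m + 1 := by omega
    have e1 := Int.emod_nonneg (u - A) h0.ne'
    have e2 := Int.emod_lt_of_pos (u - A) h0
    have e3 := Int.emod_add_mul_ediv (u - A) (m+1)
    have e4 : 2 * A + m + 2 + P ≤ (u - A) / (m+1) := by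
      rw [Int.le_ediv_iff_mul_le h0]
      nlinarith
    refine ⟨((u - A) / (m+1)).toNat, A + (u - A) % (m+1), ?_, ?_, ?_, ?_⟩
    · omega
    · omega
    · omega
    · rw [Int.toNat_of_nonneg (by omega)]; linarith
  have hb0 : ∀ l, 0 ≤ a l + d := by
    intro l
    have h1 := abs_bd a l
    have h4 := neg_abs_le (a l)
    omega
  have hb : Bd p t (fun l => a l + d) := by
    intro l
    have h1 := abs_bd a l
    have h2 := p_bd p l
    have h3 := le_abs_self (a l)
    have := hb0 l
    refine ⟨?_, ?_, ?_⟩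
    · show -(t:ℤ) < a l + d
      omega
    · show a l + d < t
      omega
    · omega
  have hV := VT_main (K := K) hp hm (fun l => a l + d) 0 hb (by
    rw [II_zero hp hb0]; omega)
  unfold VT at hV
  have hc : cc (m+1) t (fun l => a l + d) = fun l => a l + u := by
    ext l; simp only [cc]; rw [hud]; push_cast; ring
  rw [hc] at hV
  obtain ⟨Q, hQ, hs⟩ := KD.V_zero_iff.1 hV q hq
  change ℕ → TT K k at Q
  have ht1 : 1 ≤ t := by omega
  refine ⟨fun s => ff K p s ^ (t - 1) * Q s, fun s => ?_, ?_⟩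
  · have := XP_mul (XP_pow (ff_mem (K := K) p s) (t-1)) (hQ s)
    convert this using 2
    ext l
    rw [Pi.add_apply, Pi.sub_apply, Pi.smul_apply, nsmul_eq_mul]
    rw [Nat.cast_sub ht1]; push_cast; ring
  · refine Eq.trans hs (sum_congr rfl fun s _ => ?_)
    show ff K p s ^ t * Q s = _
    rw [← mul_assoc, ← pow_succ', Nat.sub_add_cancel ht1]

/-- the algebra map from the polynomial ring -/
def phi (K : Type) [Field K] {k : ℕ} (p : Fin k → ℕ) (n : ℕ) : PolyS K n →ₐ[K] TT K k :=
  aeval fun s : Fin n => ff K p s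

theorem phi_mem {q : PolyS K n} {v : ℤ} (hq : q ∈ homogZ K n v) :
    phi K p n q ∈ XP K p (fun _ => v) := by
  rw [mem_hz] at hq
  rw [q.as_sum, map_sum]
  refine sum_mem fun μ hμ => ?_
  have hd := hq μ (by simpa using hμ)
  rw [phi, aeval_monomial]
  rw [← Algebra.smul_def]
  refine Submodule.smul_mem _ _ ?_
  rw [Finsupp.prod]
  have := XP_prod (p := p) μ.support (fun s => ff K p s ^ μ s) (fun s => μ s • fun _ => (1:ℤ))
    (fun s _ => XP_pow (ff_mem p s) _)
  convert this using 2
  ext l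
  rw [Finset.sum_apply, ← hd, Finsupp.degree_apply]
  simp

theorem ff_zero_of (hp : ∀ l, 1 ≤ p l) (hm : ∑ l, (p l - 1) = m) (s : ℕ) (hs : m < s) :
    ff K p s = 0 := by
  have := (ff_top_aux (K := K) p hp univ).1
  rw [hm] at this
  exact Polynomial.coeff_eq_zero_of_natDegree_lt (lt_of_le_of_lt this hs)

theorem phi_xs (hp : ∀ l, 1 ≤ p l) (hm : ∑ l, (p l - 1) = m) (s : ℕ) :
    phi K p (m+1) (xs K (m+1) s) = ff K p s := by
  unfold xs
  split_ifs with h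
  · rw [phi, aeval_X]
  · rw [map_zero, ff_zero_of hp hm s (by omega)]

/-- the presentation map -/
def PI (K : Type) [Field K] {k : ℕ} (p : Fin k → ℕ) (n : ℕ) {r : ℕ} (γ : Fin r → TT K k) :
    (Fin r → PolyS K n) →+ TT K k where
  toFun := fun v => ∑ i, phi K p n (v i) * γ i
  map_zero' := by simp
  map_add' := fun v w => by simp [add_mul, sum_add_distrib]

theorem PI_apply {r : ℕ} (γ : Fin r → TT K k) (v : Fin r → PolyS K n) :
    PI K p n γ v = ∑ i, phi K p n (v i) * γ i := rfl

theorem PI_smul {r : ℕ} (γ : Fin r → TT K k) (c : PolyS K n) (v : Fin r → PolyS K n) :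
    PI K p n γ (c • v) = phi K p n c * PI K p n γ v := by
  simp only [PI_apply, Pi.smul_apply, smul_eq_mul, map_mul, mul_sum, mul_assoc]

theorem PI_ksmul {r : ℕ} (γ : Fin r → TT K k) (c : K) (v : Fin r → PolyS K n) :
    PI K p n γ (c • v) = c • PI K p n γ v := by
  simp only [PI_apply, Pi.smul_apply, map_smul, smul_sum, smul_mul_assoc]

theorem PI_mem {r : ℕ} {γ : Fin r → TT K k} {dg : Fin r → ℤ} (hγ : ∀ i, γ i ∈ Xa K p a (dg i))
    {u : ℤ} {v : Fin r → PolyS K n} (hv : v ∈ freePiece dg u) : PI K p n γ v ∈ Xa K p a u := by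
  rw [PI_apply]
  refine sum_mem fun i _ => ?_
  have := XP_mul (phi_mem (p := p) (mem_fp.1 hv i)) (hγ i)
  convert this using 2
  ext l; simp [add_comm]

def PIker (K : Type) [Field K] {k : ℕ} (p : Fin k → ℕ) (n : ℕ) {r : ℕ} (γ : Fin r → TT K k) :
    Submodule (PolyS K n) (Fin r → PolyS K n) where
  carrier := {v | PI K p n γ v = 0}
  zero_mem' := map_zero _
  add_mem' := fun {v w} hv hw => by
    show PI K p n γ (v + w) = 0
    rw [map_add, show PI K p n γ v = 0 from hv, show PI K p n γ w = 0 from hw, add_zero]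
  smul_mem' := fun c v hv => by
    show PI K p n γ (c • v) = 0
    rw [PI_smul, show PI K p n γ v = 0 from hv, mul_zero]

theorem hc_zero_of {r : ℕ} (dg : Fin r → ℤ) (v : Fin r → PolyS K n) (u : ℤ)
    (hu : u ∉ degs dg v) : hc dg u v = 0 := by
  ext i μ
  show coeff μ (zc _ _) = coeff μ 0
  rw [coeff_zc, coeff_zero]
  split_ifs with h
  · by_contra hne
    refine hu ?_
    rw [degs, Finset.mem_biUnion]
    refine ⟨i, Finset.mem_univ _, Finset.mem_image.2 ⟨μ, by simpa using hne, by omega⟩⟩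
  · rfl

theorem PIker_IsH (hk : 0 < k) {r : ℕ} {γ : Fin r → TT K k} {dg : Fin r → ℤ}
    (hγ : ∀ i, γ i ∈ Xa K p a (dg i)) : IsH dg (PIker K p n γ) := by
  intro v hv u
  replace hv : PI K p n γ v = 0 := hv
  show PI K p n γ (hc dg u v) = 0
  by_cases hu : u ∈ degs dg v
  · rw [← sum_hc dg v, map_sum] at hv
    ext μ
    rw [coeff_zero]
    by_contra hne
    have h1 := (mem_XP.1 (PI_mem hγ (hc_mem dg u v)) μ hne).1
    have h2 := congrArg (coeff μ) hv
    rw [coeff_sum, coeff_zero, Finset.sum_eq_single_of_mem u hu] at h2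
    · exact hne h2
    · intro u' _ huu
      by_contra hne'
      have h3 := (mem_XP.1 (PI_mem hγ (hc_mem dg u' v)) μ hne').1
      have := congrFun (h3.symm.trans h1) ⟨0, hk⟩
      simp at this
      exact huu this
  · rw [hc_zero_of dg v u hu, map_zero]

theorem exists_gens (hk : 0 < k) (hp : ∀ l, 1 ≤ p l) (hm : ∑ l, (p l - 1) = m) (hm1 : 1 ≤ m) :
    ∃ (r : ℕ) (γ : Fin r → TT K k) (dg : Fin r → ℤ), (∀ i, γ i ∈ Xa K p a (dg i)) ∧
      ∀ u, ∀ q ∈ Xa K p a u, ∃ v ∈ freePiece dg u, PI K p (m+1) γ v = q := by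
  obtain ⟨U, hU⟩ := fg_step (K := K) (a := a) hp hm hm1
  set L : ℤ := - a ⟨0, hk⟩ with hL
  let ι := (u : ↥(Finset.Icc L U)) × Fin (finrank K (Xa K p a u))
  let e : Fin (Fintype.card ι) ≃ ι := (Fintype.equivFin ι).symm
  let γ : Fin (Fintype.card ι) → TT K k := fun i => (finBasis K (Xa K p a (e i).1)) (e i).2
  let dg : Fin (Fintype.card ι) → ℤ := fun i => (e i).1
  have hγ : ∀ i, γ i ∈ Xa K p a (dg i) := fun i => Subtype.property _
  refine ⟨_, γ, dg, hγ, ?_⟩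
  have key : ∀ (j : ℕ) (u : ℤ), u < L + j → ∀ q ∈ Xa K p a u, ∃ v ∈ freePiece dg u,
      PI K p (m+1) γ v = q := by
    intro j
    induction j with
    | zero =>
      intro u hu q hq
      refine ⟨0, zero_mem _, ?_⟩
      rw [map_zero, XP_empty_neg ⟨0, hk⟩ (by push_cast at hu; omega) q hq]
    | succ j ih =>
      intro u hu q hq
      by_cases h1 : u < L
      · refine ⟨0, zero_mem _, ?_⟩
        rw [map_zero, XP_empty_neg ⟨0, hk⟩ (by omega) q hq]
      by_cases h2 : u ≤ U
      · have huI : u ∈ Finset.Icc L U := Finset.mem_Icc.2 ⟨by omega, h2⟩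
        have hq' := (finBasis K (Xa K p a u)).sum_repr ⟨q, hq⟩
        have hsp : q ∈ Submodule.span K (Set.range fun j : Fin (finrank K (Xa K p a u)) =>
            ((finBasis K (Xa K p a u)) j : TT K k)) := by
          have h3 := congrArg Subtype.val hq'
          simp only [AddSubmonoidClass.coe_finsetSum, SetLike.val_smul] at h3
          rw [← h3]
          exact Submodule.sum_mem _ fun j _ => Submodule.smul_mem _ _ (Submodule.subset_span ⟨j, rfl⟩)
        clear hq' hq
        induction hsp using Submodule.span_induction with
        | mem x hx =>
          obtain ⟨j, rfl⟩ := hx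
          refine ⟨Pi.single (e.symm ⟨⟨u, huI⟩, j⟩) 1, ?_, ?_⟩
          · rw [mem_fp]
            intro i
            by_cases hi : i = e.symm ⟨⟨u, huI⟩, j⟩
            · subst hi
              rw [Pi.single_eq_same]
              have : dg (e.symm ⟨⟨u, huI⟩, j⟩) = u := by
                simp only [dg, Equiv.apply_symm_apply]
              rw [this, sub_self]; exact hz_one
            · rw [Pi.single_eq_of_ne hi]; exact zero_mem _
          · rw [PI_apply, Finset.sum_eq_single (e.symm ⟨⟨u, huI⟩, j⟩)]
            · rw [Pi.single_eq_same, map_one, one_mul]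
              have : ∀ x : ι, ((finBasis K (Xa K p a (e (e.symm x)).1)) (e (e.symm x)).2 : TT K k) =
                (finBasis K (Xa K p a x.1)) x.2 := by intro x; rw [Equiv.apply_symm_apply]
              exact this ⟨⟨u, huI⟩, j⟩
            · intro i _ hi; rw [Pi.single_eq_of_ne hi, map_zero, zero_mul]
            · intro h; exact absurd (Finset.mem_univ _) h
        | zero => exact ⟨0, zero_mem _, map_zero _⟩
        | add x y _ _ hx hy =>
          obtain ⟨v, hv, rfl⟩ := hx
          obtain ⟨w, hw, rfl⟩ := hy
          exact ⟨v + w, add_mem hv hw, map_add _ _ _⟩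
        | smul c x _ hx =>
          obtain ⟨v, hv, rfl⟩ := hx
          exact ⟨c • v, Submodule.smul_mem _ _ hv, PI_ksmul _ _ _⟩
      · obtain ⟨Q, hQ, hs⟩ := hU u (by omega) q hq
        choose v hv hvQ using fun s => ih (u - 1) (by push_cast at hu; omega) (Q s) (hQ s)
        refine ⟨∑ s ∈ range (m+1), xs K (m+1) s • v s, sum_mem fun s _ => ?_, ?_⟩
        · have := hz_smul_vec (xs_mem s) (hv s)
          rwa [add_sub_cancel] at this
        · rw [map_sum, hs]
          refine sum_congr rfl fun s _ => ?_
          rw [PI_smul, phi_xs hp hm, hvQ]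
  intro u q hq
  exact key (u - L + 1).toNat u (by omega) q hq

theorem exists_base (hk : 0 < k) (hp : ∀ l, 1 ≤ p l) (hm : ∑ l, (p l - 1) = m) (hm1 : 1 ≤ m) :
    ∃ (N : Node K (m+1)) (γ : Fin N.r → TT K k), (∀ i, γ i ∈ Xa K p a (N.dg i)) ∧
      N.Z = PIker K p (m+1) γ ∧
      (∀ u, ∀ q ∈ Xa K p a u, ∃ v ∈ freePiece N.dg u, PI K p (m+1) γ v = q) ∧
      N.Base (GG K p a) := by
  obtain ⟨r, γ, dg, hγ, hs⟩ := exists_gens (K := K) (a := a) hk hp hm hm1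
  refine ⟨⟨r, dg, PIker K p (m+1) γ, PIker_IsH hk hγ⟩, γ, hγ, rfl, hs, fun t => ⟨PI K p (m+1) γ, ?_⟩⟩
  refine ⟨⟨fun _ _ => rfl, fun c a ha => ⟨ha.1, trivial⟩⟩, ⟨?_, fun c v hv => PI_mem hγ hv.1⟩,
    fun c a _ h => h, fun c a ha => ha.2, fun c b hb h => ⟨b, ⟨hb.1, h⟩, rfl⟩, ?_⟩
  · intro s v
    refine (PI_smul γ (xs K (m+1) s ^ t) v).trans ?_
    rw [map_pow, phi_xs hp hm]; rfl
  · intro c b hb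
    obtain ⟨v, hv, hh⟩ := hs c b hb
    exact ⟨v, ⟨hv, trivial⟩, hh⟩

end p11
end Kz

namespace Kz
section p12
variable {K : Type} [Field K] {k m : ℕ} {p : Fin k → ℕ} {a : Fin k → ℤ}

theorem MPieceDim_zero {n : ℕ} (F : FreeComplex K n) (d : ℤ)
    (h : ∀ v ∈ freePiece (K := K) (n := n) (F.deg 0) d, v ∈ LinearMap.range (F.dd 0).mulVecLin) :
    MPieceDim F d = 0 := by
  unfold MPieceDim
  suffices hh : Submodule.comap (freePiece (F.deg 0) d).subtype
      ((LinearMap.range ((F.dd 0).mulVecLin)).restrictScalars K) = ⊤ by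
    rw [hh]
    exact finrank_zero_of_subsingleton
  rw [eq_top_iff]
  rintro ⟨ψ, hψ⟩ -
  exact h ψ hψ

theorem natural (hp : ∀ l, 1 ≤ p l) (hm : ∑ l, (p l - 1) = m) (N : Node K (m+1))
    (γ : Fin N.r → TT K k) (hγ : ∀ i, γ i ∈ Xa K p a (N.dg i))
    (hZ : N.Z = PIker K p (m+1) γ) (hB : N.Base (GG K p a)) (h) :
    HasNaturalCohomology (N.cx h) := by
  have hext : ∀ d j, extDim (N.cx h) j (-d - ((m+1 : ℕ) : ℤ)) ≠ 0 →
      j = m - II p (fun l => a l + d) := by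
    intro d j hne
    by_contra hc
    refine hne (Node.ext_zero hB h j _ ?_)
    have := Ev_GG (K := K) hp hm d j hc
    push_cast
    exact this
  have key : ∀ d i, sheafH (N.cx h) i d ≠ 0 → (i : ℤ) = II p (fun l => a l + d) := by
    intro d i hne
    unfold sheafH at hne
    split_ifs at hne with hi
    · subst hi
      by_cases h1 : MPieceDim (N.cx h) d = 0
      · rw [h1, Nat.zero_sub, zero_add] at hne
        have := hext d _ hne
        push_cast at *
        omega
      · rw [II_zero hp]
        · rfl
        · by_contra hc
          push Not at hc
          obtain ⟨l, hl⟩ := hc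
          refine h1 (MPieceDim_zero _ _ fun v hv => ?_)
          refine N.spec.2.1.ge ?_
          rw [hZ]
          exact XP_empty_neg l hl _ (PI_mem hγ hv)
    · have := hext d _ hne
      push_cast at *
      omega
  intro d i i' h1 h2
  have := key d i h1
  have := key d i' h2
  omega

end p12
end Kz

namespace Kz
section p13
variable {K : Type} [Field K] {n k m : ℕ} {p : Fin k → ℕ} {a : Fin k → ℤ}

theorem finrank_split {V W : Type} [AddCommGroup V] [Module K V] [AddCommGroup W] [Module K W]
    (f : V →ₗ[K] W) (U : Submodule K V) [Module.Finite K U] :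
    finrank K U = finrank K ↥(U ⊓ LinearMap.ker f) + finrank K ↥(U.map f) := by
  rw [← LinearMap.finrank_range_add_finrank_ker (f.domRestrict U), LinearMap.range_domRestrict,
    add_comm]
  congr 1
  have : U ⊓ LinearMap.ker f = (LinearMap.ker (f.domRestrict U)).map U.subtype := by
    rw [LinearMap.ker_domRestrict, Submodule.map_comap_subtype]
  rw [this]
  exact (LinearEquiv.finrank_eq (Submodule.equivMapOfInjective _ U.injective_subtype _))

def fpEquiv {r : ℕ} (dg : Fin r → ℤ) (u : ℤ) :
    freePiece (K := K) (n := n) dg u ≃ₗ[K] ((i : Fin r) → homogZ K n (u - dg i)) where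
  toFun v i := ⟨v.1 i, mem_fp.1 v.2 i⟩
  invFun w := ⟨fun i => (w i).1, mem_fp.2 fun i => (w i).2⟩
  map_add' _ _ := rfl
  map_smul' _ _ := rfl
  left_inv _ := rfl
  right_inv _ := rfl

instance fp_fin {r : ℕ} (dg : Fin r → ℤ) (u : ℤ) :
    Module.Finite K (freePiece (K := K) (n := n) dg u) :=
  Module.Finite.equiv (fpEquiv dg u).symm

theorem fp_finrank {r : ℕ} (dg : Fin r → ℤ) (u : ℤ) :
    finrank K (freePiece (K := K) (n := n) dg u) = ∑ i, finrank K (homogZ K n (u - dg i)) := by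
  rw [(fpEquiv dg u).finrank_eq, finrank_pi_fintype]

theorem multichoose_eq (m v : ℕ) : ((m+1).multichoose v : ℚ) =
    (m.factorial : ℚ)⁻¹ * ∏ i ∈ range m, ((v : ℚ) + (i + 1)) := by
  have h1 := Nat.ascFactorial_eq_factorial_mul_choose v m
  have h2 := Nat.ascFactorial_eq_prod_range (v+1) m
  have h3 : (m+1).multichoose v = (v + m).choose m := by
    rw [Nat.multichoose_eq, show m + 1 + v - 1 = v + m by omega]
    rw [Nat.choose_symm_add]
  rw [h3, eq_inv_mul_iff_mul_eq₀ (by positivity)]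
  rw [h2] at h1
  have : ((∏ i ∈ range m, (v + 1 + i) : ℕ) : ℚ) = ((m.factorial * (v + m).choose m : ℕ) : ℚ) := by
    rw [h1]
  push_cast at this
  rw [← this]
  refine prod_congr rfl fun i _ => by ring

theorem genHilb_eval (b u : ℤ) (h : b ≤ u) :
    (genHilb (m+1) b).eval (u : ℚ) = (finrank K (homogZ K (m+1) (u - b)) : ℚ) := by
  obtain ⟨v, hv⟩ := Int.eq_ofNat_of_zero_le (sub_nonneg.2 h)
  rw [hv, homogZ_finrank, multichoose_eq]
  unfold genHilb
  rw [if_neg (by omega), Nat.add_sub_cancel, Polynomial.eval_mul, Polynomial.eval_C,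
    Polynomial.eval_prod]
  congr 1
  refine prod_congr rfl fun i _ => ?_
  have : (v : ℚ) = u - b := by
    have : ((u - b : ℤ) : ℚ) = ((v : ℤ) : ℚ) := by rw [hv]
    push_cast at this
    exact this.symm
  rw [this]
  simp

namespace Node

/-- degree pieces of the syzygies -/
def zp (N : Node K n) (u : ℤ) : Submodule K (Fin N.r → PolyS K n) :=
  freePiece N.dg u ⊓ N.Z.restrictScalars K

theorem zp_step (N : Node K n) (u : ℤ) :
    finrank K (freePiece (K := K) (n := n) N.next.dg u) =
      finrank K (N.next.zp u) + finrank K (N.zp u) := by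
  have h1 := finrank_split (N.D.mulVecLin.restrictScalars K) (freePiece (K := K) (n := n) N.dg' u)
  have h2 : (freePiece (K := K) (n := n) N.dg' u).map (N.D.mulVecLin.restrictScalars K) =
      N.zp u := by
    ext w
    constructor
    · rintro ⟨v, hv, rfl⟩
      exact ⟨mulVec_mem N.spec.1 hv, N.spec.2.1.le ⟨v, rfl⟩⟩
    · intro hw
      obtain ⟨v, hv⟩ := N.spec.2.1.ge hw.2
      refine ⟨hc N.dg' u v, hc_mem _ _ _, ?_⟩
      refine (mulVec_hc N.spec.1 u v).trans (Eq.trans ?_ (hc_of_mem hw.1))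
      rw [← hv]; rfl
  rw [h2] at h1
  exact h1

theorem alt_sum (N : Node K n) (u : ℤ) (x : ℤ)
    (h0 : (finrank K (freePiece (K := K) (n := n) N.dg u) : ℤ) = finrank K (N.zp u) + x) :
    ∀ M : ℕ, ∑ i ∈ range (M+1), (-1 : ℤ) ^ i * finrank K (freePiece (K := K) (n := n) (N.nd i).dg u)
      = x + (-1) ^ M * finrank K ((N.nd M).zp u)
  | 0 => by
    rw [zero_add, sum_range_one, pow_zero, one_mul, one_mul]
    exact h0.trans (add_comm _ _)
  | M + 1 => by
    rw [sum_range_succ, alt_sum N u x h0 M]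
    have := zp_step (N.nd M) u
    change _ + (-1) ^ (M+1) * ((finrank K (freePiece (K := K) (n := n) (N.nd M).next.dg u) : ℕ) : ℤ)
      = x + (-1) ^ (M+1) * ((finrank K ((N.nd M).next.zp u) : ℕ) : ℤ)
    rw [this, pow_succ]
    push_cast
    ring

end Node

def PIl (K : Type) [Field K] {k : ℕ} (p : Fin k → ℕ) (n : ℕ) {r : ℕ} (γ : Fin r → TT K k) :
    (Fin r → PolyS K n) →ₗ[K] TT K k where
  toFun := PI K p n γ
  map_add' := map_add _
  map_smul' := PI_ksmul γ

theorem hilb_eval (N : Node K (m+1))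
    (γ : Fin N.r → TT K k) (hγ : ∀ i, γ i ∈ Xa K p a (N.dg i))
    (hZ : N.Z = PIker K p (m+1) γ)
    (hs : ∀ u, ∀ q ∈ Xa K p a u, ∃ v ∈ freePiece N.dg u, PI K p (m+1) γ v = q)
    (hB : N.Base (GG K p a)) (h) : ∃ U0 : ℤ, ∀ u, U0 ≤ u →
    (hilbPoly (N.cx h)).eval (u : ℚ) = (finrank K (Xa K p a u) : ℚ) := by
  have hub : ∃ U0 : ℤ, ∀ i ∈ range (m+2), ∀ q, (N.nd i).dg q ≤ U0 := by
    choose B hB using fun i => exists_ub (N.nd i).dg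
    refine ⟨((∑ i ∈ range (m+2), B i : ℕ) : ℤ), fun i hi q => (hB i q).trans ?_⟩
    exact_mod_cast Finset.single_le_sum (f := B) (fun _ _ => Nat.zero_le _) hi
  obtain ⟨U0, hU0⟩ := hub
  refine ⟨U0, fun u hu => ?_⟩
  have h0 : (finrank K (freePiece (K := K) (n := m+1) N.dg u) : ℤ) =
      finrank K (N.zp u) + finrank K (Xa K p a u) := by
    rw [finrank_split (PIl K p (m+1) γ) (freePiece (K := K) (n := m+1) N.dg u)]
    have h3 : (freePiece (K := K) (n := m+1) N.dg u).map (PIl K p (m+1) γ) = Xa K p a u := by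
      ext w
      constructor
      · rintro ⟨v, hv, rfl⟩; exact PI_mem hγ hv
      · intro hw
        obtain ⟨v, hv, hh⟩ := hs u w hw
        exact ⟨v, hv, hh⟩
    have h4 : freePiece (K := K) (n := m+1) N.dg u ⊓ LinearMap.ker (PIl K p (m+1) γ) = N.zp u := by
      unfold Node.zp
      rw [hZ]; rfl
    rw [h3, h4]
    push_cast
    rfl
  have h1 := Node.alt_sum N u _ h0 (m+1)
  have h2 : (N.nd (m+1)).zp u = ⊥ := by
    unfold Node.zp
    rw [Node.Z_n hB (by omega)]
    rw [Submodule.restrictScalars_bot, inf_bot_eq]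
  rw [h2, finrank_bot, Nat.cast_zero, mul_zero, add_zero] at h1
  have h3 := congrArg (fun x : ℤ => (x : ℚ)) h1
  simp only [Int.cast_natCast] at h3
  rw [← h3]
  unfold hilbPoly
  rw [Polynomial.eval_finsetSum]
  push_cast
  refine sum_congr rfl fun i hi => ?_
  rw [Polynomial.eval_mul, Polynomial.eval_C]
  congr 1
  rw [Polynomial.eval_finsetSum, fp_finrank]
  push_cast
  refine sum_congr rfl fun q _ => ?_
  exact genHilb_eval _ _ ((hU0 i hi q).trans hu)

theorem hilb_eq (N : Node K (m+1)) (hp : ∀ l, 1 ≤ p l)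
    (γ : Fin N.r → TT K k) (hγ : ∀ i, γ i ∈ Xa K p a (N.dg i))
    (hZ : N.Z = PIker K p (m+1) γ)
    (hs : ∀ u, ∀ q ∈ Xa K p a u, ∃ v ∈ freePiece N.dg u, PI K p (m+1) γ v = q)
    (hB : N.Base (GG K p a)) (h) : hilbPoly (N.cx h) =
    ∏ l, (Polynomial.C ((((p l - 1).factorial : ℕ) : ℚ)⁻¹) *
      ∏ i ∈ range (p l - 1), (Polynomial.X + Polynomial.C ((a l : ℚ) + i + 1))) := by
  obtain ⟨U0, hU⟩ := hilb_eval N γ hγ hZ hs hB h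
  set A := ∑ l, |a l| with hA
  refine Polynomial.eq_of_infinite_eval_eq _ _ ?_
  refine Set.Infinite.mono (s := Set.range fun j : ℕ => ((((max U0 A) + j : ℤ)) : ℚ)) ?_ ?_
  · rintro _ ⟨j, rfl⟩
    set u : ℤ := max U0 A + j with hu
    have hu1 : U0 ≤ u := by omega
    have hu2 : A ≤ u := by omega
    show Polynomial.eval ((max U0 A + j : ℤ) : ℚ) _ = Polynomial.eval ((max U0 A + j : ℤ) : ℚ) _
    rw [← hu]
    clear_value u
    rw [hU u hu1]
    have hnn : ∀ l, 0 ≤ a l + u := by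
      intro l
      have h1 := abs_bd a l
      have h4 := neg_abs_le (a l)
      omega
    obtain ⟨c, hc⟩ : ∃ c : Fin k → ℕ, (fun l => a l + u) = fun l => (c l : ℤ) :=
      ⟨fun l => (a l + u).toNat, by ext l; have := hnn l; simp [this]⟩
    rw [Xa, hc, XP_finrank, Polynomial.eval_prod]
    push_cast
    refine prod_congr rfl fun l _ => ?_
    obtain ⟨q, hq⟩ : ∃ q, p l = q + 1 := ⟨p l - 1, by have := hp l; omega⟩
    rw [hq, multichoose_eq, Nat.add_sub_cancel, Polynomial.eval_mul, Polynomial.eval_C,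
      Polynomial.eval_prod]
    congr 1
    refine prod_congr rfl fun i _ => ?_
    have hcl : (c l : ℚ) = a l + u := by
      have := congrFun hc l
      have : ((a l + u : ℤ) : ℚ) = ((c l : ℤ) : ℚ) := by rw [← this]
      push_cast at this
      exact this.symm
    rw [hcl]
    simp only [Polynomial.eval_add, Polynomial.eval_X, Polynomial.eval_C]
    ring
  · refine Set.infinite_range_of_injective fun i j hij => ?_
    simpa using hij

theorem prod_coeff (m : ℕ) (c : ℕ → ℚ) :
    (∏ i ∈ range m, (Polynomial.X + Polynomial.C (c i))).coeff m = 1 := by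
  have h1 : (∏ i ∈ range m, (Polynomial.X + Polynomial.C (c i))).Monic :=
    Polynomial.monic_prod_of_monic _ _ fun i _ => Polynomial.monic_X_add_C _
  have h2 : (∏ i ∈ range m, (Polynomial.X + Polynomial.C (c i))).natDegree = m := by
    rw [Polynomial.natDegree_prod_of_monic _ _ fun i _ => Polynomial.monic_X_add_C _]
    simp
  have := h1.coeff_natDegree
  rwa [h2] at this

theorem genHilb_coeff (b : ℤ) : (genHilb (m+1) b).coeff m = (m.factorial : ℚ)⁻¹ := by
  unfold genHilb
  rw [if_neg (by omega), Nat.add_sub_cancel, Polynomial.coeff_C_mul]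
  have : ∏ k ∈ range m, (Polynomial.X - Polynomial.C (b : ℚ) + Polynomial.C ((k : ℚ) + 1)) =
      ∏ k ∈ range m, (Polynomial.X + Polynomial.C ((k : ℚ) + 1 - b)) := by
    refine prod_congr rfl fun i _ => ?_
    rw [Polynomial.C_sub]; ring
  rw [this, prod_coeff, mul_one]

theorem hilb_coeff (F : FreeComplex K (m+1)) : (hilbPoly F).coeff m =
    (m.factorial : ℚ)⁻¹ * ∑ i ∈ range (F.len + 1), (-1) ^ i * (F.rk i : ℚ) := by
  unfold hilbPoly
  rw [Polynomial.finsetSum_coeff, mul_sum]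
  refine sum_congr rfl fun i _ => ?_
  rw [Polynomial.coeff_C_mul, Polynomial.finsetSum_coeff]
  simp only [genHilb_coeff, sum_const, card_univ, Fintype.card_fin, nsmul_eq_mul]
  ring

theorem prod_z (msz : Fin k → ℕ)
    (z : Fin m → ℤ) (hz : StrictAnti z)
    (start : Fin k → ℤ)
    (hblocks : ∀ i : Fin m, ∃ j : Fin k, start j - msz j < z i ∧ z i ≤ start j)
    (hcover : ∀ (j : Fin k) (w : ℤ), start j - msz j < w → w ≤ start j → ∃ i, z i = w)
    (hdisj : ∀ j j' : Fin k, j ≠ j' → ∀ w : ℤ,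
      ¬((start j - msz j < w ∧ w ≤ start j) ∧ (start j' - msz j' < w ∧ w ≤ start j')))
    (g : ℤ → Polynomial ℚ) :
    ∏ l, ∏ i ∈ range (msz l), g (start l - i) = ∏ i, g (z i) := by
  have hc : ∀ x : (_ : Fin k) × ℕ, ∃ i : ℕ, ∀ _ : x.2 < msz x.1, ∃ h : i < m, z ⟨i, h⟩ = start x.1 - x.2 := by
    rintro ⟨l, i⟩
    by_cases hi : i < msz l
    · obtain ⟨j, hj⟩ := hcover l (start l - i) (by omega) (by omega)
      exact ⟨j, fun _ => ⟨j.2, hj⟩⟩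
    · exact ⟨0, fun h => absurd h hi⟩
  choose f hf using hc
  rw [prod_sigma']
  have hfm : ∀ x ∈ univ.sigma fun l => range (msz l), x.2 < msz x.1 := by
    intro x hx
    simpa using hx
  refine prod_bij (fun x hx => (⟨f x, (hf x (hfm x hx)).1⟩ : Fin m)) (fun _ _ => Finset.mem_univ _) ?_ ?_ ?_
  · rintro ⟨l, i⟩ h1 ⟨l', i'⟩ h2 heq
    have e1 := (hf _ (hfm _ h1)).2
    have e2 := (hf _ (hfm _ h2)).2
    have b1 := hfm _ h1
    have b2 := hfm _ h2
    rw [heq] at e1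
    have e3 := e1.symm.trans e2
    simp only at e3 b1 b2
    by_cases hl : l = l'
    · subst hl
      have : i = i' := by omega
      rw [this]
    · exact absurd ⟨⟨by omega, by omega⟩, ⟨by omega, by omega⟩⟩ (hdisj l l' hl (start l - i))
  · intro i _
    obtain ⟨l, h1, h2⟩ := hblocks i
    have hx : (⟨l, (start l - z i).toNat⟩ : (_ : Fin k) × ℕ) ∈ univ.sigma fun l => range (msz l) := by
      simp; omega
    refine ⟨_, hx, hz.injective ?_⟩
    rw [(hf _ (hfm _ hx)).2]
    simp only
    omega
  · intro x hx
    rw [(hf x (hfm x hx)).2]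

end p13
end Kz

namespace Kz
section p14
variable {K : Type} [Field K] {n k m : ℕ} {p : Fin k → ℕ} {a : Fin k → ℤ}

theorem Ev_large (hp : ∀ l, 1 ≤ p l) (hm : ∑ l, (p l - 1) = m) :
    ∃ E0 : ℤ, ∀ e, E0 ≤ e → ∀ j : ℤ, 1 ≤ j → Ev (m+1) (GG K p a) j e := by
  refine ⟨∑ l, |a l| + ∑ l, (p l : ℤ), fun e he j hj => ?_⟩
  have h := Ev_GG (K := K) (a := a) hp hm (-e - (m+1)) j (by
    have : II p (fun l => a l + (-e - (m+1))) = m := by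
      unfold II
      rw [← hm]
      push_cast
      refine sum_congr rfl fun l _ => ?_
      have h1 : |a l| ≤ ∑ l, |a l| :=
        Finset.single_le_sum (f := fun l => |a l|) (fun i _ => abs_nonneg _) (Finset.mem_univ l)
      have h2 : (p l : ℤ) ≤ ∑ l, (p l : ℤ) :=
        Finset.single_le_sum (f := fun l => (p l : ℤ)) (fun i _ => by positivity) (Finset.mem_univ l)
      have h3 := le_abs_self (a l)
      have h4 : (0:ℤ) ≤ ∑ i, ((p i - 1 : ℕ) : ℤ) := by positivity
      have h5 := hp l
      rw [if_pos (by omega)]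
      omega
    rw [this]; omega)
  convert h using 1
  ring

/-- cocycle lifting after multiplication by a power of `x` -/
def Lift (F : FreeComplex K n) (x : PolyS K n) : Prop :=
  ∀ (i b : ℕ) (C : Matrix (Fin b) (Fin (F.rk (i+1))) (PolyS K n)), C * F.dd (i+1) = 0 →
    ∃ (M : ℕ) (H : Matrix (Fin b) (Fin (F.rk i)) (PolyS K n)), H * F.dd i = x ^ M • C

theorem Lift_of_vec (F : FreeComplex K n) (x : PolyS K n)
    (h : ∀ (i : ℕ) (ψ : Fin (F.rk (i+1)) → PolyS K n), (F.dd (i+1)).transpose.mulVec ψ = 0 →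
      ∃ (M : ℕ) (ψ' : Fin (F.rk i) → PolyS K n), (F.dd i).transpose.mulVec ψ' = x ^ M • ψ) :
    Lift F x := by
  intro i b C hC
  have hrow : ∀ q, (F.dd (i+1)).transpose.mulVec (C q) = 0 := by
    intro q
    rw [Matrix.mulVec_transpose]
    exact congrFun hC q
  choose M ψ' hψ using fun q => h i (C q) (hrow q)
  have hle : ∀ q, M q ≤ ∑ q, M q := fun q =>
    Finset.single_le_sum (f := M) (fun i _ => Nat.zero_le _) (Finset.mem_univ q)
  refine ⟨∑ q, M q, Matrix.of fun q => x ^ (∑ q, M q - M q) • ψ' q, ?_⟩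
  ext1 q
  have h1 := hψ q
  rw [Matrix.mulVec_transpose] at h1
  have : (Matrix.of (fun q => x ^ (∑ q, M q - M q) • ψ' q) * F.dd i) q =
      Matrix.vecMul (x ^ (∑ q, M q - M q) • ψ' q) (F.dd i) := rfl
  rw [this, Matrix.smul_vecMul, h1, smul_smul, ← pow_add, Nat.sub_add_cancel (hle q)]
  intro j; rfl

theorem comb {a b : ℕ} (D : Matrix (Fin b) (Fin a) (PolyS K n)) (x : PolyS K n) (α β : ℕ)
    (v1 v2 : Fin a → PolyS K n) (w1 w2 : Fin b → PolyS K n) (h1 : D.mulVec v1 = x ^ α • w1)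
    (h2 : D.mulVec v2 = x ^ β • w2) :
    D.mulVec (x ^ β • v1 + x ^ α • v2) = x ^ (α + β) • (w1 + w2) := by
  rw [Matrix.mulVec_add, Matrix.mulVec_smul, Matrix.mulVec_smul, h1, h2, smul_add, smul_smul,
    smul_smul, ← pow_add, ← pow_add, add_comm β α]

theorem cx_Lift {N : Node K n} {G : ∀ t : ℕ, KD ℤ (t : ℤ)} (hB : N.Base G) (h) (E0 : ℤ)
    (hE : ∀ e, E0 ≤ e → ∀ j : ℤ, 1 ≤ j → Ev n G j e) (s : ℕ) : Lift (N.cx h) (xs K n s) := by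
  refine Lift_of_vec _ _ fun i ψ h0 => ?_
  change Fin (N.nd (i+1)).r → PolyS K n at ψ
  change (N.nd (i+1)).D.transpose.mulVec ψ = 0 at h0
  have hom : IsHM (fun q => - (N.nd (i+1)).dg' q) (fun p => -(N.nd (i+1)).dg p)
      (N.nd (i+1)).D.transpose := by
    intro q p
    have := (N.nd (i+1)).spec.1 p q
    rw [neg_sub_neg]
    exact this
  have key : ∀ U : Finset ℤ, ∃ (M : ℕ) (ψ' : Fin (N.nd i).r → PolyS K n),
      (N.nd i).D.transpose.mulVec ψ' =
        xs K n s ^ M • (∑ u ∈ U, hc (fun p => -(N.nd (i+1)).dg p) u ψ) := by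
    classical
    intro U
    induction U using Finset.induction_on with
    | empty => exact ⟨0, 0, by rw [sum_empty, smul_zero, Matrix.mulVec_zero]; rfl⟩
    | insert u U hu ih =>
      obtain ⟨M, ψ', hh⟩ := ih
      have hc0 : (N.nd (i+1)).D.transpose.mulVec (hc (fun p => -(N.nd (i+1)).dg p) u ψ) = 0 := by
        rw [mulVec_hc hom, h0]
        ext1 q; exact zc_zero _
      obtain ⟨ψ2, -, h2⟩ := Node.coex_succ hB i ((E0 - u).toNat + u) (hE _ (by omega) _ (by omega))
        (xs K n s ^ (E0 - u).toNat • hc (fun p => -(N.nd (i+1)).dg p) u ψ)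
        (hz_smul_vec (xs_pow_mem s _) (hc_mem _ _ _))
        (by rw [Matrix.mulVec_smul, hc0, smul_zero])
      have := comb _ (xs K n s) _ _ _ _ _ _ h2 hh
      rw [sum_insert hu]
      exact ⟨_, _, this⟩
  obtain ⟨M, ψ', hh⟩ := key (degs (fun p => -(N.nd (i+1)).dg p) ψ)
  rw [sum_hc] at hh
  exact ⟨M, ψ', hh⟩

theorem htpy (F : FreeComplex K n) (x : PolyS K n) (hL : Lift F x) : ∀ (q j : ℕ), F.len ≤ j + q →
    ∃ (M : ℕ) (H : Matrix (Fin (F.rk (j+2))) (Fin (F.rk (j+1))) (PolyS K n))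
      (H' : Matrix (Fin (F.rk (j+1))) (Fin (F.rk j)) (PolyS K n)),
      F.dd (j+1) * H + H' * F.dd j = x ^ M • (1 : Matrix _ _ (PolyS K n))
  | 0, j, hj => by
    have : IsEmpty (Fin (F.rk (j+1))) := by
      rw [F.rk_eq_zero (j+1) (by omega)]; infer_instance
    exact ⟨0, 0, 0, Subsingleton.elim _ _⟩
  | q+1, j, hj => by
    obtain ⟨M, H, H', hh⟩ := htpy F x hL q (j+1) (by omega)
    have hC : (x ^ M • (1 : Matrix (Fin (F.rk (j+1))) (Fin (F.rk (j+1))) (PolyS K n))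
        - F.dd (j+1) * H') * F.dd (j+1) = 0 := by
      rw [Matrix.sub_mul, Matrix.smul_mul, Matrix.one_mul, Matrix.mul_assoc, ← add_sub_cancel_left (F.dd (j+1+1) * H) (H' * F.dd (j+1)), hh, Matrix.mul_sub, ← Matrix.mul_assoc, F.isComplex (j+1), Matrix.zero_mul, sub_zero, Matrix.mul_smul, Matrix.mul_one, sub_self]
    obtain ⟨M', H2, h2⟩ := hL j _ _ hC
    refine ⟨M' + M, x ^ M' • H', H2, ?_⟩
    rw [h2, smul_sub, smul_smul, ← pow_add, Matrix.mul_smul]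
    abel

theorem rank_add_le' {L : Type*} [Field L] {a b : ℕ} (A B : Matrix (Fin a) (Fin b) L) :
    (A + B).rank ≤ A.rank + B.rank := by
  unfold Matrix.rank
  rw [Matrix.mulVecLin_add]
  refine (Submodule.finrank_mono ?_).trans (Submodule.finrank_add_le_finrank_add_finrank _ _)
  rintro _ ⟨v, rfl⟩
  exact Submodule.add_mem_sup ⟨v, rfl⟩ ⟨v, rfl⟩

theorem rank_step (F : FreeComplex K n) (x : PolyS K n) (hL : Lift F x) {L : Type*} [Field L]
    (f : PolyS K n →+* L) (hf : f x ≠ 0) (j : ℕ) :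
    ((F.dd j).map f).rank + ((F.dd (j+1)).map f).rank = F.rk (j+1) := by
  apply le_antisymm
  · have := Matrix.rank_add_rank_le_card_of_mul_eq_zero (A := (F.dd j).map f)
      (B := (F.dd (j+1)).map f) (by
        rw [← Matrix.map_mul, F.isComplex j]; ext; simp)
    simpa using this
  · obtain ⟨M, H, H', hh⟩ := htpy F x hL F.len j (by omega)
    have h2 := congrArg (fun A => A.map f) hh
    rw [Matrix.map_add f (by simp), Matrix.map_mul, Matrix.map_mul] at h2
    have h3 : (x ^ M • (1 : Matrix (Fin (F.rk (j+1))) (Fin (F.rk (j+1))) (PolyS K n))).map f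
        = (f x ^ M) • (1 : Matrix (Fin (F.rk (j+1))) (Fin (F.rk (j+1))) L) := by
      ext p q
      simp [Matrix.one_apply, apply_ite f]
    have h4 : (((x ^ M • (1 : Matrix (Fin (F.rk (j+1))) (Fin (F.rk (j+1))) (PolyS K n))).map f)).rank = F.rk (j+1) := by
      rw [h3, Matrix.rank_of_det_ne_zero, Fintype.card_fin]
      rw [Matrix.det_smul, Matrix.det_one, mul_one]
      exact pow_ne_zero _ (pow_ne_zero _ hf)
    rw [← h2] at h4
    refine h4.ge.trans ((rank_add_le' _ _).trans ?_)
    have := Matrix.rank_mul_le_left ((F.dd (j+1)).map f) (H.map f)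
    have := Matrix.rank_mul_le_right (H'.map f) ((F.dd j).map f)
    omega

theorem rank_tele (F : FreeComplex K n) (x : PolyS K n) (hL : Lift F x) {L : Type*} [Field L]
    (f : PolyS K n →+* L) (hf : f x ≠ 0) (M : ℕ) :
    ∑ i ∈ range (M+1), (-1 : ℤ) ^ i * (F.rk i : ℤ) =
      F.rk 0 - ((F.dd 0).map f).rank + (-1) ^ M * ((F.dd M).map f).rank := by
  induction M with
  | zero => simp
  | succ M ih =>
    have h := congrArg (fun q : ℕ => (q : ℤ)) (rank_step F x hL f hf M)
    push_cast at h
    rw [sum_range_succ, ih]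
    linear_combination -(-1 : ℤ) ^ (M+1) * h

theorem rank_zero_eq (F : FreeComplex K n) (x : PolyS K n) (hL : Lift F x) {L : Type*} [Field L]
    (f : PolyS K n →+* L) (hf : f x ≠ 0) (r : ℕ)
    (hr : (r : ℤ) = ∑ i ∈ range (F.len+1), (-1 : ℤ) ^ i * (F.rk i : ℤ)) :
    ((F.dd 0).map f).rank + r = F.rk 0 := by
  have h := rank_tele F x hL f hf F.len
  have h1 : ((F.dd F.len).map f).rank = 0 := by
    have := Matrix.rank_le_width ((F.dd F.len).map f)
    have h2 := F.rk_eq_zero (F.len+1) (by omega)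
    omega
  rw [← hr, h1] at h
  simp at h
  omega

theorem exists_rows {L : Type*} [Field L] {a b : ℕ} (A : Matrix (Fin a) (Fin b) L) (ρ : ℕ)
    (h : A.rank = ρ) : ∃ e : Fin ρ ↪ Fin a, (A.submatrix e id).rank = ρ := by
  obtain ⟨κ, i, hi, hs, hl⟩ := exists_linearIndependent' L A.row
  have : Fintype κ := Fintype.ofInjective i hi
  have hc : Fintype.card κ = ρ := by
    rw [← h, Matrix.rank_eq_finrank_span_row, ← hs, finrank_span_eq_card hl]
  let E : Fin ρ ≃ κ := (Fintype.equivFinOfCardEq hc).symm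
  refine ⟨⟨i ∘ E, hi.comp E.injective⟩, ?_⟩
  have h2 : LinearIndependent L (A.submatrix (i ∘ E) id).row := hl.comp E E.injective
  have := h2.rank_matrix
  simpa using this

theorem exists_minor {L : Type*} [Field L] {a b : ℕ} (A : Matrix (Fin a) (Fin b) L) (ρ : ℕ)
    (h : A.rank = ρ) : ∃ (e : Fin ρ ↪ Fin a) (e' : Fin ρ ↪ Fin b),
      (A.submatrix e e').det ≠ 0 := by
  obtain ⟨e, he⟩ := exists_rows A ρ h
  obtain ⟨e', he'⟩ := exists_rows (A.submatrix e id).transpose ρ (by rw [Matrix.rank_transpose, he])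
  refine ⟨e, e', ?_⟩
  have h1 : ((A.submatrix e e').transpose).rank = ρ := he'
  rw [Matrix.rank_transpose] at h1
  have hl : LinearIndependent L (A.submatrix e e').row := by
    rw [linearIndependent_iff_card_eq_finrank_span, Fintype.card_fin, Set.finrank, ← Matrix.rank_eq_finrank_span_row, h1]
  have := Matrix.linearIndependent_rows_iff_isUnit.1 hl
  exact ((Matrix.isUnit_iff_isUnit_det _).1 this).ne_zero

theorem vb (F : FreeComplex K n) (hn : 0 < n) (hL : ∀ s : Fin n, Lift F (X s)) (r : ℕ)
    (hr : (r : ℤ) = ∑ i ∈ range (F.len+1), (-1 : ℤ) ^ i * (F.rk i : ℤ)) : IsVectorBundle F r := by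
  constructor
  · have hinj : Function.Injective (algebraMap (PolyS K n) (FractionRing (PolyS K n))) :=
      IsFractionRing.injective _ _
    have h1 := rank_zero_eq F (X ⟨0, hn⟩) (hL _) (algebraMap (PolyS K n) (FractionRing (PolyS K n)))
      (by
        rw [Ne, map_eq_zero_iff _ hinj]; exact X_ne_zero _) r hr
    unfold fittingIdeal
    rw [if_neg (by omega)]
    unfold minorsIdeal
    rw [Ideal.span_eq_bot]
    rintro _ ⟨⟨e, e'⟩, rfl⟩
    by_contra hne
    set M := (F.dd 0).submatrix e e' with hM
    have hd : (M.map (algebraMap (PolyS K n) (FractionRing (PolyS K n)))).det ≠ 0 := by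
      have := RingHom.map_det (algebraMap (PolyS K n) (FractionRing (PolyS K n))) M
      rw [RingHom.mapMatrix_apply] at this
      rw [← this, Ne, map_eq_zero_iff _ hinj]
      exact hne
    have h2 := Matrix.rank_of_det_ne_zero hd
    rw [Fintype.card_fin] at h2
    have h3 := Matrix.rank_submatrix_le
      ((F.dd 0).map (algebraMap (PolyS K n) (FractionRing (PolyS K n)))) e e'
    rw [Matrix.submatrix_map, h2] at h3
    omega
  · refine Ideal.exists_pow_le_of_le_radical_of_fg ?_ (IsNoetherian.noetherian _)
    unfold irrel
    rw [Ideal.span_le]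
    rintro _ ⟨s, rfl⟩
    unfold fittingIdeal
    split_ifs with hle
    · rw [Ideal.radical_top]; trivial
    · show _ ∈ Ideal.radical _
      rw [Ideal.radical_eq_sInf, Ideal.mem_sInf]
      rintro P ⟨hP, hprime⟩
      by_contra hs
      let f : PolyS K n →+* FractionRing (PolyS K n ⧸ P) :=
        (algebraMap (PolyS K n ⧸ P) (FractionRing (PolyS K n ⧸ P))).comp (Ideal.Quotient.mk P)
      have hinj : Function.Injective (algebraMap (PolyS K n ⧸ P) (FractionRing (PolyS K n ⧸ P))) :=
        IsFractionRing.injective _ _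
      have hker : ∀ y, f y = 0 ↔ y ∈ P := by
        intro y
        rw [RingHom.comp_apply, map_eq_zero_iff _ hinj, Ideal.Quotient.eq_zero_iff_mem]
      have h1 := rank_zero_eq F (X s) (hL s) f (by rw [Ne, hker]; exact hs) r hr
      obtain ⟨e, e', hd⟩ := exists_minor ((F.dd 0).map f) ((F.rk 0 : ℤ) - r).toNat (by omega)
      rw [Matrix.submatrix_map] at hd
      have := RingHom.map_det f ((F.dd 0).submatrix e e')
      rw [RingHom.mapMatrix_apply] at this
      rw [← this, Ne, hker] at hd
      exact hd (hP (Ideal.subset_span ⟨(e, e'), rfl⟩))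

end p14
end Kz

namespace Kz
section p15
variable {K : Type} [Field K] {k m : ℕ}

/-- the structure sheaf of a point -/
def ptCx (K : Type) [Field K] : FreeComplex K 1 where
  len := 0
  rk := fun i => if i = 0 then 1 else 0
  deg := fun _ _ => 0
  dd := fun _ => 0
  rk_eq_zero := fun i hi => if_neg (by omega)
  isHomog := fun i p q => zero_mem _
  isComplex := fun i => Matrix.zero_mul _

theorem ptCx_empty (i : ℕ) : IsEmpty (Fin ((ptCx K).rk (i+1))) := by
  have : (ptCx K).rk (i+1) = 0 := rfl
  rw [this]; infer_instance

theorem pt_res : IsResolution (ptCx K) := by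
  intro i
  have := ptCx_empty (K := K) i
  exact Subsingleton.elim _ _

theorem pt_vb : IsVectorBundle (ptCx K) 1 := by
  refine vb _ one_pos (fun s i b C _ => ?_) 1 ?_
  · have := ptCx_empty (K := K) i
    exact ⟨0, 0, Subsingleton.elim _ _⟩
  · show ((1:ℕ):ℤ) = ∑ i ∈ range 1, (-1 : ℤ) ^ i * ((if i = 0 then 1 else 0 : ℕ) : ℤ)
    simp

theorem pt_nat : HasNaturalCohomology (ptCx K) := by
  have key : ∀ i d, sheafH (ptCx K) i d ≠ 0 → i = 0 := by
    intro i d h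
    by_contra hi
    refine h ?_
    unfold sheafH
    rw [if_neg hi]
    unfold extDim
    rw [if_neg (by push_cast; omega)]
  intro d i i' h h'
  rw [key i d h, key i' d h']

theorem pt_hilb : hilbPoly (ptCx K) = 1 := by
  have h : ∀ q : ℕ, q = 1 → ∑ p : Fin q, genHilb 1 0 = 1 := by
    rintro q rfl
    simp [genHilb]
  unfold hilbPoly
  show ∑ i ∈ range 1, Polynomial.C ((-1 : ℚ) ^ i) * ∑ p : Fin ((ptCx K).rk i), genHilb 1 0 = 1
  have h2 : ∑ p : Fin ((ptCx K).rk 0), genHilb 1 0 = 1 := h _ rfl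
  rw [sum_range_one, h2]
  simp

theorem main (K : Type) [Field K] (m k : ℕ)
    (msz : Fin k → ℕ) (hpos : ∀ j, 0 < msz j) (hsum : ∑ j, msz j = m)
    (z : Fin m → ℤ) (hz : StrictAnti z)
    (start : Fin k → ℤ)
    (hblocks : ∀ i : Fin m, ∃ j : Fin k, start j - msz j < z i ∧ z i ≤ start j)
    (hcover : ∀ (j : Fin k) (w : ℤ), start j - msz j < w → w ≤ start j → ∃ i, z i = w)
    (hdisj : ∀ j j' : Fin k, j ≠ j' → ∀ w : ℤ,
      ¬((start j - msz j < w ∧ w ≤ start j) ∧ (start j' - msz j' < w ∧ w ≤ start j'))) :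
    ∃ (F : FreeComplex K (m + 1)) (r : ℕ),
      IsResolution F ∧ IsVectorBundle F r ∧ IsSupernaturalWithRoots F z ∧
      r * (∏ j, (msz j).factorial) = m.factorial := by
  obtain rfl | hm1 := Nat.eq_zero_or_pos m
  · refine ⟨ptCx K, 1, pt_res, pt_vb, ⟨hz, pt_nat, 1, one_ne_zero, ?_⟩, ?_⟩
    · refine pt_hilb.trans ?_
      simp
    · have : ∀ j, msz j = 0 := fun j => (Finset.sum_eq_zero_iff.1 hsum) j (Finset.mem_univ j)
      simp [this]
  · have hk : 0 < k := by
      rcases Nat.eq_zero_or_pos k with rfl | h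
      · simp at hsum; omega
      · exact h
    have hp : ∀ l, 1 ≤ (fun l => msz l + 1) l := fun l => by simp
    have hm : ∑ l, ((fun l => msz l + 1) l - 1) = m := by simpa using hsum
    obtain ⟨N, γ, hγ, hZ, hs, hB⟩ := exists_base (K := K) (a := fun l => -1 - start l) hk hp hm hm1
    have h : ∀ i, m + 1 < i → (N.nd i).r = 0 := by
      intro i hi
      obtain ⟨j, rfl⟩ : ∃ j, i = m + 1 + 1 + j := ⟨i - (m+1+1), by omega⟩
      exact Node.r_zero hB (by omega) j
    have hH : hilbPoly (N.cx h) = Polynomial.C (∏ l, (((msz l).factorial : ℕ) : ℚ)⁻¹) *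
        ∏ i : Fin m, (Polynomial.X - Polynomial.C ((z i : ℚ))) := by
      rw [hilb_eq N hp γ hγ hZ hs hB h, prod_mul_distrib, map_prod,
        ← prod_z msz z hz start hblocks hcover hdisj
          (fun w => Polynomial.X - Polynomial.C ((w : ℤ) : ℚ))]
      congr 1
      refine prod_congr rfl fun l _ => prod_congr rfl fun i _ => ?_
      have : ((-1 - start l : ℤ) : ℚ) + i + 1 = -((start l - (i : ℤ) : ℤ) : ℚ) := by
        push_cast; ring
      rw [this, Polynomial.C_neg, ← sub_eq_add_neg]
    have hmon : (∏ i : Fin m, (Polynomial.X - Polynomial.C ((z i : ℚ)))).coeff m = 1 := by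
      have h1 : (∏ i : Fin m, (Polynomial.X - Polynomial.C ((z i : ℚ)))).Monic :=
        Polynomial.monic_prod_of_monic _ _ fun i _ => Polynomial.monic_X_sub_C _
      have h2 : (∏ i : Fin m, (Polynomial.X - Polynomial.C ((z i : ℚ)))).natDegree = m := by
        rw [Polynomial.natDegree_prod_of_monic _ _ fun i _ => Polynomial.monic_X_sub_C _]
        simp only [Polynomial.natDegree_X_sub_C, sum_const, card_univ, Fintype.card_fin, smul_eq_mul, mul_one]
      have := h1.coeff_natDegree
      rwa [h2] at this
    have hc := hilb_coeff (N.cx h)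
    rw [hH, Polynomial.coeff_C_mul, hmon, mul_one, Finset.prod_inv_distrib] at hc
    set χ : ℤ := ∑ i ∈ range ((N.cx h).len + 1), (-1 : ℤ) ^ i * ((N.cx h).rk i : ℤ) with hχ
    have hχQ : (χ : ℚ) = ∑ i ∈ range ((N.cx h).len + 1), (-1 : ℚ) ^ i * ((N.cx h).rk i : ℚ) := by
      rw [hχ]; push_cast; rfl
    rw [← hχQ] at hc
    have hPne : (∏ l, (((msz l).factorial : ℕ) : ℚ)) ≠ 0 :=
      Finset.prod_ne_zero_iff.2 fun l _ => by
        exact_mod_cast (msz l).factorial_ne_zero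
    have hmne : ((m.factorial : ℕ) : ℚ) ≠ 0 := by exact_mod_cast m.factorial_ne_zero
    have hχ2 : (χ : ℚ) * ∏ l, (((msz l).factorial : ℕ) : ℚ) = (m.factorial : ℚ) := by
      field_simp at hc
      linarith
    have hχ3 : χ * ∏ l, (((msz l).factorial : ℕ) : ℤ) = (m.factorial : ℤ) := by
      exact_mod_cast hχ2
    have hχpos : 0 < χ := by
      have h1 : (0:ℤ) < ∏ l, (((msz l).factorial : ℕ) : ℤ) :=
        Finset.prod_pos fun l _ => by exact_mod_cast (msz l).factorial_pos
      have h2 : (0:ℤ) < (m.factorial : ℤ) := by exact_mod_cast m.factorial_pos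
      rw [← hχ3] at h2
      exact pos_of_mul_pos_left h2 h1.le
    obtain ⟨r, hr⟩ := Int.eq_ofNat_of_zero_le hχpos.le
    obtain ⟨E0, hE⟩ := Ev_large (K := K) (a := fun l => -1 - start l) hp hm
    refine ⟨N.cx h, r, Node.cx_res N h, ?_, ⟨hz, natural hp hm N γ hγ hZ hB h, _, ?_, hH⟩, ?_⟩
    · refine vb _ (by omega) (fun s => ?_) r (by rw [← hr])
      have h1 := cx_Lift hB h E0 hE s.1
      have h2 : xs K (m+1) s.1 = X s := dif_pos s.2
      rwa [h2] at h1
    · rw [Finset.prod_inv_distrib]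
      exact inv_ne_zero hPne
    · rw [hr] at hχ3
      exact_mod_cast hχ3

end p15
end Kz

/-- Let `K` be any field and suppose `m = Σ_{j=1}^k m_j` with
each `m_j > 0`. If the strictly decreasing integer sequence `z = (z_1 > ⋯ > z_m)`
consists of `k` disjoint subsequences of consecutive integers of lengths
`m_1, …, m_k` (the `j`-th block being the integer interval
`(start_j - m_j, start_j]`), then there exists a vector bundle `𝓔` on `ℙ^m`
defined over `K` with supernatural cohomology, root sequence `z`, and rank equal
to the multinomial coefficient `m! / (m_1! ⋯ m_k!)`. -/
theorem supernatural_bundle_multinomial_rank (K : Type) [Field K] (m k : ℕ)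
    (msz : Fin k → ℕ) (hpos : ∀ j, 0 < msz j) (hsum : ∑ j, msz j = m)
    (z : Fin m → ℤ) (hz : StrictAnti z)
    (start : Fin k → ℤ)
    (hblocks : ∀ i : Fin m, ∃ j : Fin k, start j - msz j < z i ∧ z i ≤ start j)
    (hcover : ∀ (j : Fin k) (w : ℤ), start j - msz j < w → w ≤ start j → ∃ i, z i = w)
    (hdisj : ∀ j j' : Fin k, j ≠ j' → ∀ w : ℤ,
      ¬((start j - msz j < w ∧ w ≤ start j) ∧ (start j' - msz j' < w ∧ w ≤ start j'))) :
    ∃ (F : FreeComplex K (m + 1)) (r : ℕ),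
      IsResolution F ∧ IsVectorBundle F r ∧ IsSupernaturalWithRoots F z ∧
      r * (∏ j, (msz j).factorial) = m.factorial :=
  Kz.main K m k msz hpos hsum z hz start hblocks hcover hdisj

end
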